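/- arXiv:1608.05438 — 4 statements merged into one kernel-verified Lean document; each statement's English description precedes it below -/
import Mathlib

section
/- Let F : [0,∞) → (0,∞)^I be a solution of the discrete C₁₃ system with I ≥ 5. Then there exist a constant ρ > 0 and constants C₁, C₂ > 0 such that Σ_{k=1}^I k/(e^{ρk} − 1) = Σ_{k=1}^I k·F_k(0) and max_{1≤k≤I} |F_k(t) − 1/(e^{ρk} − 1)| ≤ C₁ e^{−C₂ t} for all t ≥ 0; that is, F(t) converges exponentially fast to the equilibrium F*_k = 1/(e^{ρk} − 1) having the same energy as the initial condition. -/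
/-- The right-hand side of the discrete `C₁₃` system for `k₁ ∈ {1,…,I}`. -/
noncomputable def C13 (I : ℕ) (K : ℕ → ℕ → ℕ → ℕ → ℝ) (F : ℕ → ℝ) (k₁ : ℕ) : ℝ :=
  (∑ k₂ ∈ Finset.Icc 1 I, ∑ k₃ ∈ Finset.Icc 1 I, ∑ k₄ ∈ Finset.Icc 1 I,
    if k₂ + k₃ + k₄ = k₁ then
      K k₁ k₂ k₃ k₄ * ((F k₁ + 1) * F k₂ * F k₃ * F k₄
        - F k₁ * (F k₂ + 1) * (F k₃ + 1) * (F k₄ + 1))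
    else 0)
  - 3 * (∑ k₂ ∈ Finset.Icc 1 I, ∑ k₃ ∈ Finset.Icc 1 I, ∑ k₄ ∈ Finset.Icc 1 I,
    if k₁ + k₃ + k₄ = k₂ then
      K k₂ k₁ k₃ k₄ * ((F k₂ + 1) * F k₁ * F k₃ * F k₄
        - F k₂ * (F k₁ + 1) * (F k₃ + 1) * (F k₄ + 1))
    else 0)

noncomputable def qq (K : ℕ → ℕ → ℕ → ℕ → ℝ) (F : ℕ → ℝ) (a b c d : ℕ) : ℝ :=
  K a b c d * ((F a + 1) * F b * F c * F d - F a * (F b + 1) * (F c + 1) * (F d + 1))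

theorem weak_form (I : ℕ) (K : ℕ → ℕ → ℕ → ℕ → ℝ)
    (hKsymm : ∀ a b c d, K a b c d = K b a c d ∧ K a b c d = K a c b d ∧
      K a b c d = K a b d c) (F : ℕ → ℝ) (φ : ℕ → ℝ) :
    ∑ k ∈ Finset.Icc 1 I, φ k * C13 I K F k =
    ∑ a ∈ Finset.Icc 1 I, ∑ b ∈ Finset.Icc 1 I, ∑ c ∈ Finset.Icc 1 I, ∑ d ∈ Finset.Icc 1 I,
      if b + c + d = a then qq K F a b c d * (φ a - φ b - φ c - φ d) else 0 := by
  set T : (ℕ → ℕ → ℕ → ℕ → ℝ) → ℝ := fun ψ =>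
    ∑ a ∈ Finset.Icc 1 I, ∑ b ∈ Finset.Icc 1 I, ∑ c ∈ Finset.Icc 1 I, ∑ d ∈ Finset.Icc 1 I,
      if b + c + d = a then qq K F a b c d * ψ a b c d else 0 with hT
  have q1 : ∀ a b c d, qq K F a b c d = qq K F a c b d := by
    intro a b c d; unfold qq; rw [(hKsymm a b c d).2.1]; ring
  have q2 : ∀ a b c d, qq K F a b c d = qq K F a b d c := by
    intro a b c d; unfold qq; rw [(hKsymm a b c d).2.2]; ring
  have h1 : T (fun a b c d => φ c) = T (fun a b c d => φ b) := by
    simp only [hT]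
    refine Finset.sum_congr rfl fun a _ => ?_
    rw [Finset.sum_comm]
    refine Finset.sum_congr rfl fun b _ => Finset.sum_congr rfl fun c _ =>
      Finset.sum_congr rfl fun d _ => ?_
    rw [q1 a c b d, add_comm c b]
  have h2 : T (fun a b c d => φ d) = T (fun a b c d => φ c) := by
    simp only [hT]
    refine Finset.sum_congr rfl fun a _ => Finset.sum_congr rfl fun b _ => ?_
    rw [Finset.sum_comm]
    refine Finset.sum_congr rfl fun c _ => Finset.sum_congr rfl fun d _ => ?_
    rw [q2 a b d c, add_right_comm b d c]
  have h3 : T (fun a b c d => φ a - φ b - φ c - φ d) =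
      T (fun a b c d => φ a) - T (fun a b c d => φ b) - T (fun a b c d => φ c)
        - T (fun a b c d => φ d) := by
    simp only [hT, ← Finset.sum_sub_distrib]
    refine Finset.sum_congr rfl fun a _ => Finset.sum_congr rfl fun b _ =>
      Finset.sum_congr rfl fun c _ => Finset.sum_congr rfl fun d _ => ?_
    split_ifs <;> ring
  have h4 : ∑ k ∈ Finset.Icc 1 I, φ k * C13 I K F k =
      T (fun a b c d => φ a) - 3 * T (fun a b c d => φ b) := by
    have hA : T (fun a b c d => φ a) = ∑ k ∈ Finset.Icc 1 I, φ k *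
        (∑ k₂ ∈ Finset.Icc 1 I, ∑ k₃ ∈ Finset.Icc 1 I, ∑ k₄ ∈ Finset.Icc 1 I,
          if k₂ + k₃ + k₄ = k then qq K F k k₂ k₃ k₄ else 0) := by
      simp only [hT, Finset.mul_sum, mul_ite, mul_zero]
      refine Finset.sum_congr rfl fun k _ => Finset.sum_congr rfl fun b _ =>
        Finset.sum_congr rfl fun c _ => Finset.sum_congr rfl fun d _ => ?_
      rw [mul_comm]
    have hB : T (fun a b c d => φ b) = ∑ k ∈ Finset.Icc 1 I, φ k *
        (∑ k₂ ∈ Finset.Icc 1 I, ∑ k₃ ∈ Finset.Icc 1 I, ∑ k₄ ∈ Finset.Icc 1 I,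
          if k + k₃ + k₄ = k₂ then qq K F k₂ k k₃ k₄ else 0) := by
      simp only [hT, Finset.mul_sum, mul_ite, mul_zero]
      rw [Finset.sum_comm]
      refine Finset.sum_congr rfl fun k _ => Finset.sum_congr rfl fun b _ =>
        Finset.sum_congr rfl fun c _ => Finset.sum_congr rfl fun d _ => ?_
      rw [mul_comm]
    rw [hA, hB, Finset.mul_sum, ← Finset.sum_sub_distrib]
    refine Finset.sum_congr rfl fun k _ => ?_
    change φ k * (_ - 3 * _) = _
    rw [mul_sub, mul_left_comm]
    rfl
  rw [h4]
  change _ = T (fun a b c d => φ a - φ b - φ c - φ d)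
  rw [h3, h2, h1]; ring

theorem sum_lower (I : ℕ) (f : ℕ → ℕ → ℕ → ℝ) (X Y : ℝ)
    (h : ∀ b ∈ Finset.Icc 1 I, ∀ c ∈ Finset.Icc 1 I, ∀ d ∈ Finset.Icc 1 I, -X ≤ f b c d)
    (h0 : Y = 0 ∨ ∃ b ∈ Finset.Icc 1 I, ∃ c ∈ Finset.Icc 1 I, ∃ d ∈ Finset.Icc 1 I,
      Y - X ≤ f b c d) :
    Y - (I:ℝ)^3 * X ≤ ∑ b ∈ Finset.Icc 1 I, ∑ c ∈ Finset.Icc 1 I, ∑ d ∈ Finset.Icc 1 I,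
      f b c d := by
  have e : ∑ b ∈ Finset.Icc 1 I, ∑ c ∈ Finset.Icc 1 I, ∑ d ∈ Finset.Icc 1 I, (f b c d + X)
      = (∑ b ∈ Finset.Icc 1 I, ∑ c ∈ Finset.Icc 1 I, ∑ d ∈ Finset.Icc 1 I, f b c d)
        + (I:ℝ)^3 * X := by
    simp [Finset.sum_add_distrib]; ring
  have nn : ∀ b ∈ Finset.Icc 1 I, ∀ c ∈ Finset.Icc 1 I, ∀ d ∈ Finset.Icc 1 I,
      0 ≤ f b c d + X := fun b hb c hc d hd => by linarith [h b hb c hc d hd]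
  have key : Y ≤ ∑ b ∈ Finset.Icc 1 I, ∑ c ∈ Finset.Icc 1 I, ∑ d ∈ Finset.Icc 1 I,
      (f b c d + X) := by
    rcases h0 with h0 | ⟨b, hb, c, hc, d, hd, hh⟩
    · rw [h0]
      exact Finset.sum_nonneg fun b hb => Finset.sum_nonneg fun c hc =>
        Finset.sum_nonneg fun d hd => nn b hb c hc d hd
    · calc Y ≤ f b c d + X := by linarith
        _ ≤ ∑ d ∈ Finset.Icc 1 I, (f b c d + X) :=
            Finset.single_le_sum (f := fun d => f b c d + X) (fun d hd => nn b hb c hc d hd) hd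
        _ ≤ ∑ c ∈ Finset.Icc 1 I, ∑ d ∈ Finset.Icc 1 I, (f b c d + X) :=
            Finset.single_le_sum (f := fun c => ∑ d ∈ Finset.Icc 1 I, (f b c d + X))
              (fun c hc => Finset.sum_nonneg fun d hd => nn b hb c hc d hd) hc
        _ ≤ _ := Finset.single_le_sum
              (f := fun b => ∑ c ∈ Finset.Icc 1 I, ∑ d ∈ Finset.Icc 1 I, (f b c d + X))
              (fun b hb => Finset.sum_nonneg fun c hc =>
                Finset.sum_nonneg fun d hd => nn b hb c hc d hd) hb
  linarith

theorem C13_lower (I : ℕ) (K : ℕ → ℕ → ℕ → ℕ → ℝ) (F : ℕ → ℝ) (κ Λ M : ℝ) (hκ : 0 < κ)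
    (hK : ∀ a ∈ Finset.Icc 1 I, ∀ b ∈ Finset.Icc 1 I, ∀ c ∈ Finset.Icc 1 I,
      ∀ d ∈ Finset.Icc 1 I, κ ≤ K a b c d ∧ K a b c d ≤ Λ)
    (hF : ∀ k ∈ Finset.Icc 1 I, 0 < F k ∧ F k ≤ M) (k : ℕ) (hk : k ∈ Finset.Icc 1 I) :
    (∀ b ∈ Finset.Icc 1 I, ∀ c ∈ Finset.Icc 1 I, ∀ d ∈ Finset.Icc 1 I, b + c + d = k →
      κ * (F b * F c * F d) - 4 * (I:ℝ)^3 * Λ * (1+M)^3 * F k ≤ C13 I K F k) ∧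
    (∀ a ∈ Finset.Icc 1 I, ∀ c ∈ Finset.Icc 1 I, ∀ d ∈ Finset.Icc 1 I, k + c + d = a →
      κ * F a - 4 * (I:ℝ)^3 * Λ * (1+M)^3 * F k ≤ C13 I K F k) ∧
    - (4 * (I:ℝ)^3 * Λ * (1+M)^3 * F k) ≤ C13 I K F k := by
  obtain ⟨fk, fkM⟩ := hF k hk
  have hM : 0 < M := by linarith
  have hΛ : 0 < Λ := by linarith [hK k hk k hk k hk k hk]
  set X : ℝ := Λ * (1+M)^3 * F k with hX
  have hX0 : 0 < X := by positivity
  have A : ∀ b ∈ Finset.Icc 1 I, ∀ c ∈ Finset.Icc 1 I, ∀ d ∈ Finset.Icc 1 I,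
      κ * (F b * F c * F d) - X ≤ K k b c d * ((F k + 1) * F b * F c * F d
        - F k * (F b + 1) * (F c + 1) * (F d + 1)) := by
    intro b hb c hc d hd
    obtain ⟨k1, k2⟩ := hK k hk b hb c hc d hd
    obtain ⟨b1, b2⟩ := hF b hb
    obtain ⟨c1, c2⟩ := hF c hc
    obtain ⟨d1, d2⟩ := hF d hd
    have e1 : κ * (F b * F c * F d) ≤ K k b c d * ((F k + 1) * F b * F c * F d) := by
      have : F b * F c * F d ≤ (F k + 1) * F b * F c * F d := by
        have : 0 < F b * F c * F d := by positivity
        nlinarith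
      have : 0 ≤ K k b c d := by linarith
      gcongr
    have e2 : K k b c d * (F k * (F b + 1) * (F c + 1) * (F d + 1)) ≤ X := by
      calc _ ≤ Λ * (F k * (M + 1) * (M + 1) * (M + 1)) := by gcongr
        _ = X := by rw [hX]; ring
    rw [mul_sub]; linarith
  have B : ∀ a ∈ Finset.Icc 1 I, ∀ c ∈ Finset.Icc 1 I, ∀ d ∈ Finset.Icc 1 I,
      κ * F a - X ≤ - (K a k c d * ((F a + 1) * F k * F c * F d
        - F a * (F k + 1) * (F c + 1) * (F d + 1))) := by
    intro a ha c hc d hd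
    obtain ⟨k1, k2⟩ := hK a ha k hk c hc d hd
    obtain ⟨b1, b2⟩ := hF a ha
    obtain ⟨c1, c2⟩ := hF c hc
    obtain ⟨d1, d2⟩ := hF d hd
    have e1 : κ * F a ≤ K a k c d * (F a * (F k + 1) * (F c + 1) * (F d + 1)) := by
      have : F a * 1 * 1 * 1 ≤ F a * (F k + 1) * (F c + 1) * (F d + 1) := by
        gcongr <;> linarith
      have : F a ≤ F a * (F k + 1) * (F c + 1) * (F d + 1) := by linarith
      have : 0 ≤ K a k c d := by linarith
      gcongr
    have e2 : K a k c d * ((F a + 1) * F k * F c * F d) ≤ X := by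
      calc _ ≤ Λ * ((M + 1) * F k * (M + 1) * (M + 1)) := by
            gcongr <;> linarith
        _ = X := by rw [hX]; ring
    rw [mul_sub]; linarith
  have nnA : ∀ b ∈ Finset.Icc 1 I, ∀ c ∈ Finset.Icc 1 I, ∀ d ∈ Finset.Icc 1 I,
      0 < κ * (F b * F c * F d) := by
    intro b hb c hc d hd
    have := (hF b hb).1
    have := (hF c hc).1
    have := (hF d hd).1
    positivity
  have SA := sum_lower I (fun b c d => if b + c + d = k then
      K k b c d * ((F k + 1) * F b * F c * F d
        - F k * (F b + 1) * (F c + 1) * (F d + 1)) else 0) X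
  have SB := sum_lower I (fun a c d => - (if k + c + d = a then
      K a k c d * ((F a + 1) * F k * F c * F d
        - F a * (F k + 1) * (F c + 1) * (F d + 1)) else 0)) X
  have A' : ∀ b ∈ Finset.Icc 1 I, ∀ c ∈ Finset.Icc 1 I, ∀ d ∈ Finset.Icc 1 I,
      -X ≤ (if b + c + d = k then
      K k b c d * ((F k + 1) * F b * F c * F d
        - F k * (F b + 1) * (F c + 1) * (F d + 1)) else 0) := by
    intro b hb c hc d hd
    split_ifs
    · linarith [A b hb c hc d hd, nnA b hb c hc d hd]
    · linarith
  have B' : ∀ b ∈ Finset.Icc 1 I, ∀ c ∈ Finset.Icc 1 I, ∀ d ∈ Finset.Icc 1 I,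
      -X ≤ -(if k + c + d = b then
      K b k c d * ((F b + 1) * F k * F c * F d
        - F b * (F k + 1) * (F c + 1) * (F d + 1)) else 0) := by
    intro b hb c hc d hd
    split_ifs
    · have := mul_pos hκ (hF b hb).1
      linarith [B b hb c hc d hd]
    · linarith
  have SA0 := SA 0 A' (Or.inl rfl)
  have SB0 := SB 0 B' (Or.inl rfl)
  simp only [Finset.sum_neg_distrib] at SB0 SB
  refine ⟨?_, ?_, ?_⟩
  · intro b hb c hc d hd h
    have := SA (κ * (F b * F c * F d)) A' (Or.inr ⟨b, hb, c, hc, d, hd, by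
      simp only [h, if_true]; exact A b hb c hc d hd⟩)
    unfold C13
    linarith
  · intro a ha c hc d hd h
    have h0 := (mul_pos hκ (hF a ha).1).le
    have := SB (κ * F a) B' (Or.inr ⟨a, ha, c, hc, d, hd, by
      simp only [h, if_true]; exact B a ha c hc d hd⟩)
    unfold C13
    linarith
  · unfold C13
    linarith

theorem persist (u u' : ℝ → ℝ) (η : ℝ) (hη : 0 < η) (h0 : 0 < u 0)
    (hd : ∀ t ∈ Set.Ici (0:ℝ), HasDerivWithinAt u (u' t) (Set.Ici 0) t)
    (h : ∀ t ∈ Set.Ici (0:ℝ), u t < η → 0 < u' t) :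
    ∃ m > 0, ∀ t ∈ Set.Ici (0:ℝ), m ≤ u t := by
  have hm : 0 < min (u 0) η := lt_min h0 hη
  refine ⟨min (u 0) η / 2, by positivity, fun T hT => ?_⟩
  have hc : ContinuousOn u (Set.Icc 0 T) := fun t ht =>
    ((hd t ht.1).continuousWithinAt).mono Set.Icc_subset_Ici_self
  have := image_le_of_deriv_right_lt_deriv_boundary (f := fun t => - u t) (f' := fun t => - u' t)
    (a := 0) (b := T) (B := fun _ => -(min (u 0) η / 2)) (B' := fun _ => 0) hc.neg
    (fun t ht => ((hd t ht.1).mono (Set.Ici_subset_Ici.2 ht.1)).neg)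
    (by have := min_le_left (u 0) η; linarith) (fun t => hasDerivAt_const t _)
    (fun t ht he => by
      have := h t ht.1 (by have := min_le_right (u 0) η; linarith)
      linarith) (x := T) ⟨hT, le_rfl⟩
  linarith

theorem persist' (u u' : ℝ → ℝ) (C Y : ℝ) (hC : 0 < C) (hY : 0 < Y) (h0 : 0 < u 0)
    (hd : ∀ t ∈ Set.Ici (0:ℝ), HasDerivWithinAt u (u' t) (Set.Ici 0) t)
    (h : ∀ t ∈ Set.Ici (0:ℝ), Y - C * u t ≤ u' t) :
    ∃ m > 0, ∀ t ∈ Set.Ici (0:ℝ), m ≤ u t := by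
  refine persist u u' (Y / C) (by positivity) h0 hd fun t ht hlt => ?_
  have := h t ht
  rw [lt_div_iff₀ hC] at hlt
  nlinarith

theorem exists_rho (I : ℕ) (hI : 5 ≤ I) (E : ℝ) (hE : 0 < E) : ∃ ρ > (0:ℝ),
    ∑ k ∈ Finset.Icc 1 I, (k : ℝ) / (Real.exp (ρ * k) - 1) = E := by
  have hI' : (5:ℝ) ≤ I := by exact_mod_cast hI
  set a := Real.log (1 + 1/E)
  have ha : 0 < a := Real.log_pos (by have : 0 < 1/E := by positivity
                                      linarith)
  have hab : a ≤ I / E := by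
    have h1 : a ≤ (1 + 1/E) - 1 := Real.log_le_sub_one_of_pos (by positivity)
    have h2 : 1 / E ≤ I / E := by gcongr; linarith
    linarith
  have pos : ∀ ρ : ℝ, 0 < ρ → ∀ k ∈ Finset.Icc 1 I, ρ * k ≤ Real.exp (ρ * k) - 1 := by
    intro ρ _ k _
    linarith [Real.add_one_le_exp (ρ * k)]
  have kp : ∀ k ∈ Finset.Icc 1 I, (0:ℝ) < k := by
    intro k hk
    have := (Finset.mem_Icc.1 hk).1
    exact_mod_cast this
  have hc : ContinuousOn (fun ρ : ℝ => ∑ k ∈ Finset.Icc 1 I, (k : ℝ) / (Real.exp (ρ * k) - 1))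
      (Set.Icc a (I/E)) := by
    refine continuousOn_finsetSum _ fun k hk => ?_
    refine ContinuousOn.div continuousOn_const (by fun_prop) fun ρ hρ => ?_
    have h1 : 0 < ρ := lt_of_lt_of_le ha hρ.1
    have := pos ρ h1 k hk
    have := mul_pos h1 (kp k hk)
    linarith
  have := intermediate_value_Icc' hab hc
  suffices hm : E ∈ Set.Icc _ _ by
    obtain ⟨ρ, hρ, he⟩ := this hm
    exact ⟨ρ, lt_of_lt_of_le ha hρ.1, he⟩
  · constructor
    · have hp : 0 < (I:ℝ)/E := by positivity
      calc _ ≤ ∑ k ∈ Finset.Icc 1 I, E / I := by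
            refine Finset.sum_le_sum fun k hk => ?_
            have := pos _ hp k hk
            have k0 := kp k hk
            calc (k:ℝ) / (Real.exp (I/E * k) - 1) ≤ k / (I/E*k) := by gcongr
              _ = E / I := by field_simp
        _ = E := by simp; field_simp
    · have h1 : (1:ℕ) ∈ Finset.Icc 1 I := by simp; omega
      have := Finset.single_le_sum (f := fun k : ℕ => (k : ℝ) / (Real.exp (a * k) - 1))
        (fun k hk => by
          have := pos a ha k hk
          have k0 := kp k hk
          have := mul_pos ha k0
          apply div_nonneg <;> linarith) h1
      refine le_trans (le_of_eq ?_) this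
      simp only [Nat.cast_one, mul_one]
      rw [Real.exp_log (by positivity)]
      simp

theorem log_ineq (U V m : ℝ) (hm : 0 < m) (hU : m ≤ U) (hV : m ≤ V) :
    m * (Real.log U - Real.log V)^2 ≤ (U - V) * (Real.log U - Real.log V) := by
  wlog h : V ≤ U generalizing U V
  · have := this V U hV hU (by linarith)
    nlinarith
  have hV0 : 0 < V := by linarith
  have hU0 : 0 < U := by linarith
  have h1 : 0 ≤ Real.log U - Real.log V := by linarith [Real.log_le_log hV0 h]
  have h2 : V * (Real.log U - Real.log V) ≤ U - V := by
    rw [← Real.log_div hU0.ne' hV0.ne']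
    have := Real.log_le_sub_one_of_pos (div_pos hU0 hV0)
    calc _ ≤ V * (U / V - 1) := by gcongr
      _ = U - V := by field_simp
  have : m * (Real.log U - Real.log V) ≤ U - V := by nlinarith
  nlinarith

noncomputable def zz (x y : ℝ) : ℝ :=
  Real.log x - Real.log y - (Real.log (1 + x) - Real.log (1 + y))

noncomputable def hh (x y : ℝ) : ℝ :=
  x * (Real.log x - Real.log y) - (1 + x) * (Real.log (1 + x) - Real.log (1 + y))

theorem hh_deriv (x y : ℝ) (hx : 0 < x) : HasDerivAt (fun x => hh x y) (zz x y) x := by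
  unfold hh zz
  have h1 := (hasDerivAt_id x).mul ((Real.hasDerivAt_log hx.ne').sub_const (Real.log y))
  have h2 := ((hasDerivAt_id x).const_add 1).mul
    ((((hasDerivAt_id x).const_add 1).log (by simp; linarith)).sub_const (Real.log (1 + y)))
  refine (h1.sub h2).congr_deriv ?_
  have : 1 + x ≠ 0 := by linarith
  simp
  field_simp
  ring

theorem zz_lower (x y M : ℝ) (hx : 0 < x) (hy : 0 < y) (hxM : x ≤ M) (hyM : y ≤ M) (h : y ≤ x) :
    x - y ≤ M * (1 + M) * zz x y := by
  have e : zz x y = - Real.log (y * (1 + x) / (x * (1 + y))) := by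
    rw [Real.log_div (by positivity) (by positivity), Real.log_mul (by positivity) (by positivity),
      Real.log_mul (by positivity) (by positivity)]
    unfold zz; ring
  have h1 : (x - y) / (x * (1 + y)) ≤ zz x y := by
    have := Real.log_le_sub_one_of_pos (show 0 < y * (1 + x) / (x * (1 + y)) by positivity)
    rw [e]
    have e2 : (x - y) / (x * (1 + y)) = 1 - y * (1 + x) / (x * (1 + y)) := by field_simp; ring
    linarith
  have h2 : x - y = x * (1 + y) * ((x - y) / (x * (1 + y))) := by field_simp
  have h3 : 0 ≤ (x - y) / (x * (1 + y)) := div_nonneg (by linarith) (by positivity)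
  have hM : 0 < M := by linarith
  rw [h2]
  gcongr

theorem zz_neg (x y : ℝ) : zz y x = - zz x y := by unfold zz; ring

theorem hh_lower (x y M : ℝ) (hx : 0 < x) (hy : 0 < y) (hxM : x ≤ M) (hyM : y ≤ M) :
    (x - y)^2 / (2 * (M * (1 + M))) ≤ hh x y := by
  have hM : 0 < M := by linarith
  set c := 1 / (2 * (M * (1 + M))) with hc
  have hd : ∀ s : ℝ, 0 < s → HasDerivAt (fun s => hh s y - c * (s - y)^2)
      (zz s y - 2 * c * (s - y)) s := by
    intro s hs
    refine ((hh_deriv s y hs).sub ((((hasDerivAt_id s).sub_const y).pow 2).const_mul c)).congr_deriv ?_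
    simp; ring
  have hyy : hh y y = 0 := by unfold hh; simp
  have hcc : 2 * c = 1 / (M * (1 + M)) := by rw [hc]; field_simp
  have key : 0 ≤ hh x y - c * (x - y)^2 := by
    rcases le_total y x with h | h
    · have := monotoneOn_of_hasDerivWithinAt_nonneg (convex_Icc y x)
        (f := fun s => hh s y - c * (s - y)^2) (f' := fun s => zz s y - 2 * c * (s - y))
        (fun s hs => (hd s (by linarith [hs.1])).continuousAt.continuousWithinAt)
        (fun s hs => by
          rw [interior_Icc] at hs
          exact (hd s (by linarith [hs.1])).hasDerivWithinAt)
        (fun s hs => by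
          rw [interior_Icc] at hs
          have := zz_lower s y M (by linarith [hs.1]) hy (by linarith [hs.2]) hyM hs.1.le
          rw [hcc, div_mul_eq_mul_div, sub_nonneg, div_le_iff₀ (by positivity)]
          linarith)
      have := this ⟨le_rfl, h⟩ ⟨h, le_rfl⟩ h
      simp only [hyy] at this
      simpa using this
    · have := antitoneOn_of_hasDerivWithinAt_nonpos (convex_Icc x y)
        (f := fun s => hh s y - c * (s - y)^2) (f' := fun s => zz s y - 2 * c * (s - y))
        (fun s hs => (hd s (by linarith [hs.1])).continuousAt.continuousWithinAt)
        (fun s hs => by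
          rw [interior_Icc] at hs
          exact (hd s (by linarith [hs.1])).hasDerivWithinAt)
        (fun s hs => by
          rw [interior_Icc] at hs
          have := zz_lower y s M hy (by linarith [hs.1]) hyM (by linarith [hs.2]) hs.2.le
          rw [zz_neg] at this
          rw [hcc, div_mul_eq_mul_div, sub_nonpos, le_div_iff₀ (by positivity)]
          linarith)
      have := this ⟨le_rfl, h⟩ ⟨h, le_rfl⟩ h
      simp only [hyy] at this
      simpa using this
  have : (x - y)^2 / (2 * (M * (1 + M))) = c * (x - y)^2 := by rw [hc]; ring
  linarith

theorem hh_upper (x y M : ℝ) (hx : 0 < x) (hy : 0 < y) (hxM : x ≤ M) (hyM : y ≤ M) :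
    hh x y ≤ M * (1 + M) * (zz x y)^2 := by
  have hM : 0 < M := by linarith
  have h1 : 0 ≤ hh y x := le_trans (by positivity) (hh_lower y x M hy hx hyM hxM)
  have h2 : hh x y ≤ (x - y) * zz x y := by
    have : (x - y) * zz x y - hh x y = hh y x := by unfold hh zz; ring
    linarith
  have hp : 0 < M * (1 + M) := by positivity
  rcases le_total y x with h | h
  · have := zz_lower x y M hx hy hxM hyM h
    have z0 : 0 ≤ zz x y := by by_contra hn; nlinarith
    nlinarith
  · have := zz_lower y x M hy hx hyM hxM h
    rw [zz_neg] at this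
    have z0 : zz x y ≤ 0 := by by_contra hn; nlinarith
    nlinarith

theorem diss (I : ℕ) (K : ℕ → ℕ → ℕ → ℕ → ℝ)
    (hKsymm : ∀ a b c d, K a b c d = K b a c d ∧ K a b c d = K a c b d ∧
      K a b c d = K a b d c) (F : ℕ → ℝ) (κ δ ρ : ℝ) (hκ : 0 < κ) (hδ : 0 < δ)
    (hK : ∀ a ∈ Finset.Icc 1 I, ∀ b ∈ Finset.Icc 1 I, ∀ c ∈ Finset.Icc 1 I,
      ∀ d ∈ Finset.Icc 1 I, κ ≤ K a b c d)
    (hF : ∀ k ∈ Finset.Icc 1 I, δ ≤ F k) (z : ℕ → ℝ)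
    (hz : ∀ k ∈ Finset.Icc 1 I, z k = Real.log (F k) - Real.log (1 + F k) + ρ * k) :
    ∑ k ∈ Finset.Icc 1 I, z k * C13 I K F k ≤ - (κ * δ^3 *
    ∑ a ∈ Finset.Icc 1 I, ∑ b ∈ Finset.Icc 1 I, ∑ c ∈ Finset.Icc 1 I, ∑ d ∈ Finset.Icc 1 I,
      if b + c + d = a then (z a - z b - z c - z d)^2 else 0) := by
  rw [weak_form I K hKsymm]
  simp only [Finset.mul_sum, ← Finset.sum_neg_distrib]
  refine Finset.sum_le_sum fun a ha => Finset.sum_le_sum fun b hb =>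
    Finset.sum_le_sum fun c hc => Finset.sum_le_sum fun d hd => ?_
  split_ifs with h
  · have a1 := hF a ha
    have b1 := hF b hb
    have c1 := hF c hc
    have d1 := hF d hd
    have a0 : 0 < F a := by linarith
    have b0 : 0 < F b := by linarith
    have c0 : 0 < F c := by linarith
    have d0 : 0 < F d := by linarith
    set U := (F a + 1) * F b * F c * F d with hU
    set V := F a * (F b + 1) * (F c + 1) * (F d + 1) with hV
    have hw : z a - z b - z c - z d = Real.log V - Real.log U := by
      have hc' : (a:ℝ) = b + c + d := by exact_mod_cast h.symm
      rw [hz a ha, hz b hb, hz c hc, hz d hd, hU, hV]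
      rw [Real.log_mul (by positivity) (by positivity), Real.log_mul (by positivity) (by positivity),
        Real.log_mul (by positivity) (by positivity), Real.log_mul (by positivity) (by positivity),
        Real.log_mul (by positivity) (by positivity), Real.log_mul (by positivity) (by positivity),
        hc', add_comm (F a), add_comm (F b), add_comm (F c), add_comm (F d)]
      ring
    have hUl : δ^3 ≤ U := by
      calc δ^3 = 1 * δ * δ * δ := by ring
        _ ≤ U := by rw [hU]; gcongr; linarith
    have hVl : δ^3 ≤ V := by
      calc δ^3 = δ * δ * δ * 1 := by ring
        _ ≤ V := by rw [hV]; gcongr <;> linarith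
    have := log_ineq U V (δ^3) (by positivity) hUl hVl
    have hK1 := hK a ha b hb c hc d hd
    rw [hw]
    unfold qq
    rw [← hU, ← hV]
    have p1 : 0 ≤ δ^3 * (Real.log U - Real.log V)^2 := by positivity
    have p2 := mul_le_mul hK1 this p1 (by linarith)
    nlinarith
  · simp

set_option maxHeartbeats 1000000 in
theorem coer (I : ℕ) (hI : 5 ≤ I) (z : ℕ → ℝ) (i j : ℕ) (hi : i ∈ Finset.Icc 1 I)
    (hj : j ∈ Finset.Icc 1 I) (zi : 0 ≤ z i) (zj : z j ≤ 0) (k : ℕ) (hk : k ∈ Finset.Icc 1 I) :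
    (z k)^2 ≤ 16 * (I:ℝ)^2 * ∑ a ∈ Finset.Icc 1 I, ∑ b ∈ Finset.Icc 1 I,
      ∑ c ∈ Finset.Icc 1 I, ∑ d ∈ Finset.Icc 1 I,
      if b + c + d = a then (z a - z b - z c - z d)^2 else 0 := by
  set S := ∑ a ∈ Finset.Icc 1 I, ∑ b ∈ Finset.Icc 1 I,
      ∑ c ∈ Finset.Icc 1 I, ∑ d ∈ Finset.Icc 1 I,
      if b + c + d = a then (z a - z b - z c - z d)^2 else 0 with hS
  have n1 : ∀ a b c d, 0 ≤ (if b + c + d = a then (z a - z b - z c - z d)^2 else 0) := by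
    intro a b c d; split_ifs <;> positivity
  have n2 : ∀ a b c, 0 ≤ ∑ d ∈ Finset.Icc 1 I,
      (if b + c + d = a then (z a - z b - z c - z d)^2 else 0) :=
    fun a b c => Finset.sum_nonneg fun d _ => n1 a b c d
  have n3 : ∀ a b, 0 ≤ ∑ c ∈ Finset.Icc 1 I, ∑ d ∈ Finset.Icc 1 I,
      (if b + c + d = a then (z a - z b - z c - z d)^2 else 0) :=
    fun a b => Finset.sum_nonneg fun c _ => n2 a b c
  have n4 : ∀ a, 0 ≤ ∑ b ∈ Finset.Icc 1 I, ∑ c ∈ Finset.Icc 1 I, ∑ d ∈ Finset.Icc 1 I,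
      (if b + c + d = a then (z a - z b - z c - z d)^2 else 0) :=
    fun a => Finset.sum_nonneg fun b _ => n3 a b
  have S0 : 0 ≤ S := Finset.sum_nonneg fun a _ => n4 a
  have key : ∀ a b c d, a ≤ I → 1 ≤ b → 1 ≤ c → 1 ≤ d → b + c + d = a →
      |z a - z b - z c - z d| ≤ √S := by
    intro a b c d ha hb hc hd h
    apply Real.abs_le_sqrt
    have ha : a ∈ Finset.Icc 1 I := by simp; omega
    have hb : b ∈ Finset.Icc 1 I := by simp at *; omega
    have hc : c ∈ Finset.Icc 1 I := by simp at *; omega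
    have hd : d ∈ Finset.Icc 1 I := by simp at *; omega
    calc (z a - z b - z c - z d)^2
        = (if b + c + d = a then (z a - z b - z c - z d)^2 else 0) := by rw [if_pos h]
      _ ≤ _ := Finset.single_le_sum (f := fun d => if b + c + d = a then
            (z a - z b - z c - z d)^2 else 0) (fun d _ => n1 a b c d) hd
      _ ≤ _ := Finset.single_le_sum (f := fun c => ∑ d ∈ Finset.Icc 1 I, if b + c + d = a then
            (z a - z b - z c - z d)^2 else 0) (fun c _ => n2 a b c) hc
      _ ≤ _ := Finset.single_le_sum (f := fun b => ∑ c ∈ Finset.Icc 1 I,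
            ∑ d ∈ Finset.Icc 1 I, if b + c + d = a then
            (z a - z b - z c - z d)^2 else 0) (fun b _ => n3 a b) hb
      _ ≤ S := Finset.single_le_sum (f := fun a => ∑ b ∈ Finset.Icc 1 I, ∑ c ∈ Finset.Icc 1 I,
            ∑ d ∈ Finset.Icc 1 I, if b + c + d = a then
            (z a - z b - z c - z d)^2 else 0) (fun a _ => n4 a) ha
  set s := √S with hs
  have s0 : 0 ≤ s := Real.sqrt_nonneg _
  have ss : s^2 = S := Real.sq_sqrt S0
  clear n1 n2 n3 n4
  clear_value s
  clear hs
  clear_value S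
  clear hS
  have w3 := abs_le.1 (key 3 1 1 1 (by omega) (by omega) (by omega) (by omega) rfl)
  have w5 := abs_le.1 (key 5 1 1 3 (by omega) (by omega) (by omega) (by omega) rfl)
  have w5' := abs_le.1 (key 5 1 2 2 (by omega) (by omega) (by omega) (by omega) rfl)
  have lin : ∀ k : ℕ, 1 ≤ k → k ≤ I → |z k - k * z 1| ≤ 2 * k * s := by
    intro k
    induction k using Nat.strong_induction_on with
    | _ k ih =>
      intro h1 h2
      rcases Nat.lt_or_ge k 3 with h | h
      · interval_cases k
        · simp; exact s0
        · rw [abs_le]; push_cast; constructor <;> linarith [w3.1, w3.2, w5.1, w5.2, w5'.1, w5'.2]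
      · obtain ⟨n, rfl⟩ : ∃ n, k = n + 2 := ⟨k - 2, by omega⟩
        have h3 := abs_le.1 (ih n (by omega) (by omega) (by omega))
        have h4 := abs_le.1 (key (n+2) 1 1 n h2 le_rfl le_rfl (by omega) (by ring))
        rw [abs_le]; push_cast
        constructor <;> linarith [h3.1, h3.2, h4.1, h4.2]
  rw [Finset.mem_Icc] at hi hj hk
  have li := abs_le.1 (lin i hi.1 hi.2)
  have lj := abs_le.1 (lin j hj.1 hj.2)
  have lk := abs_le.1 (lin k hk.1 hk.2)
  have i1 : (1:ℝ) ≤ i := by exact_mod_cast hi.1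
  have j1 : (1:ℝ) ≤ j := by exact_mod_cast hj.1
  have k1 : (1:ℝ) ≤ k := by exact_mod_cast hk.1
  have kI : (k:ℝ) ≤ I := by exact_mod_cast hk.2
  have za : -(2 * s) ≤ z 1 := by
    by_contra hn
    push Not at hn
    have := mul_lt_mul_of_pos_left hn (show (0:ℝ) < i by linarith)
    linarith [li.2]
  have zb : z 1 ≤ 2 * s := by
    by_contra hn
    push Not at hn
    have := mul_lt_mul_of_pos_left hn (show (0:ℝ) < j by linarith)
    linarith [lj.1]
  have zk : |z k| ≤ 4 * I * s := by
    have : |z k| ≤ 4 * k * s := by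
      have q1 := mul_le_mul_of_nonneg_left za (show (0:ℝ) ≤ k by linarith)
      have q2 := mul_le_mul_of_nonneg_left zb (show (0:ℝ) ≤ k by linarith)
      rw [abs_le]; constructor <;> linarith [lk.1, lk.2]
    have h2 : 4 * (k:ℝ) * s ≤ 4 * I * s := by gcongr
    linarith
  rw [← sq_abs]
  calc |z k|^2 ≤ (4 * I * s)^2 := by gcongr
    _ = 16 * (I:ℝ)^2 * S := by rw [← ss]; ring

theorem five_expand (K : ℕ → ℕ → ℕ → ℕ → ℝ)
    (hKsymm : ∀ a b c d, K a b c d = K b a c d ∧ K a b c d = K a c b d ∧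
      K a b c d = K a b d c) (F : ℕ → ℝ) (ε : ℝ) :
    C13 5 K F 1 + C13 5 K F 3 + C13 5 K F 4 + (1 + ε) * C13 5 K F 5 =
      -2 * qq K F 3 1 1 1 - 3 * qq K F 4 1 1 2 + 3 * ε * qq K F 5 1 2 2
      - 3 * (2 - ε) * qq K F 5 1 1 3 := by
  have h := weak_form 5 K hKsymm F (fun k => if k = 2 then 0 else if k = 5 then 1 + ε else 1)
  have q1 : ∀ a b c d, qq K F a b c d = qq K F a c b d := by
    intro a b c d; unfold qq; rw [(hKsymm a b c d).2.1]; ring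
  have q2 : ∀ a b c d, qq K F a b c d = qq K F a b d c := by
    intro a b c d; unfold qq; rw [(hKsymm a b c d).2.2]; ring
  simp [Finset.sum_Icc_succ_top] at h
  rw [q1 4 2 1 1, q2 4 1 2 1, q1 5 2 1 2, q2 5 2 2 1, q1 5 2 1 2, q1 5 3 1 1, q2 5 1 3 1] at h
  linarith

set_option maxHeartbeats 1000000 in
theorem five_pos (K : ℕ → ℕ → ℕ → ℕ → ℝ)
    (hKpos : ∀ a b c d, 0 < K a b c d)
    (hKsymm : ∀ a b c d, K a b c d = K b a c d ∧ K a b c d = K a c b d ∧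
      K a b c d = K a b d c) (M m : ℝ) (hM : 0 < M) (hm : 0 < m) :
    ∃ ε > 0, ∃ η > 0, ε ≤ 1 ∧ ∀ F : ℕ → ℝ, (∀ k ∈ Finset.Icc 1 5, 0 < F k ∧ F k ≤ M) →
      m ≤ F 2 → F 1 < η →
      0 < C13 5 K F 1 + C13 5 K F 3 + C13 5 K F 4 + (1 + ε) * C13 5 K F 5 := by
  set A := K 3 1 1 1
  set B := K 4 1 1 2
  set P := K 5 1 2 2
  set R := K 5 1 1 3
  have hA : 0 < A := hKpos _ _ _ _
  have hB : 0 < B := hKpos _ _ _ _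
  have hP : 0 < P := hKpos _ _ _ _
  have hR : 0 < R := hKpos _ _ _ _
  set ε := min 1 (R / (P * (1 + M)^3)) with hε
  have e0 : 0 < ε := lt_min one_pos (by positivity)
  have e1 : ε ≤ 1 := min_le_left _ _
  have e2 : ε * (P * (1 + M)^3) ≤ R := by
    rw [← le_div_iff₀ (by positivity)]; exact min_le_right _ _
  set C := 2 * A * (1 + M)^2 + 3 * B * (1 + M)^2 + 6 * R * (1 + M)^2 with hC
  have C0 : 0 < C := by positivity
  refine ⟨ε, e0, 3 * ε * P * m^2 / C, by positivity, e1, fun F hF hm2 h1 => ?_⟩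
  rw [five_expand K hKsymm]
  rw [lt_div_iff₀ C0] at h1
  obtain ⟨f1, g1⟩ := hF 1 (by simp)
  obtain ⟨f2, g2⟩ := hF 2 (by simp)
  obtain ⟨f3, g3⟩ := hF 3 (by simp)
  obtain ⟨f4, g4⟩ := hF 4 (by simp)
  obtain ⟨f5, g5⟩ := hF 5 (by simp)
  have t1 : qq K F 3 1 1 1 ≤ A * (1 + M)^2 * F 1 ^ 2 := by
    have : 0 ≤ A * (F 3 * (F 1 + 1) * (F 1 + 1) * (F 1 + 1)) := by positivity
    calc qq K F 3 1 1 1 = A * ((F 3 + 1) * F 1 * F 1 * F 1)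
          - A * (F 3 * (F 1 + 1) * (F 1 + 1) * (F 1 + 1)) := by unfold qq; ring
      _ ≤ A * ((F 3 + 1) * F 1 * F 1 * F 1) := by linarith
      _ ≤ A * ((M + 1) * F 1 * F 1 * (M + 1)) := by gcongr; linarith
      _ = _ := by ring
  have t2 : qq K F 4 1 1 2 ≤ B * (1 + M)^2 * F 1 ^ 2 := by
    have : 0 ≤ B * (F 4 * (F 1 + 1) * (F 1 + 1) * (F 2 + 1)) := by positivity
    calc qq K F 4 1 1 2 = B * ((F 4 + 1) * F 1 * F 1 * F 2)
          - B * (F 4 * (F 1 + 1) * (F 1 + 1) * (F 2 + 1)) := by unfold qq; ring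
      _ ≤ B * ((F 4 + 1) * F 1 * F 1 * F 2) := by linarith
      _ ≤ B * ((M + 1) * F 1 * F 1 * (M + 1)) := by gcongr; linarith
      _ = _ := by ring
  have t3 : qq K F 5 1 1 3 ≤ R * (1 + M)^2 * F 1 ^ 2 - R * F 5 := by
    have h0 : R * (F 5 * 1 * 1 * 1) ≤ R * (F 5 * (F 1 + 1) * (F 1 + 1) * (F 3 + 1)) := by
      gcongr <;> linarith
    calc qq K F 5 1 1 3 = R * ((F 5 + 1) * F 1 * F 1 * F 3)
          - R * (F 5 * (F 1 + 1) * (F 1 + 1) * (F 3 + 1)) := by unfold qq; ring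
      _ ≤ R * ((F 5 + 1) * F 1 * F 1 * F 3) - R * F 5 := by linarith
      _ ≤ R * ((M + 1) * F 1 * F 1 * (M + 1)) - R * F 5 := by gcongr; linarith
      _ = _ := by ring
  have t4 : P * m^2 * F 1 - P * (1 + M)^3 * F 5 ≤ qq K F 5 1 2 2 := by
    have h0 : P * (1 * F 1 * m * m) ≤ P * ((F 5 + 1) * F 1 * F 2 * F 2) := by
      gcongr; linarith
    have h1 : P * (F 5 * (F 1 + 1) * (F 2 + 1) * (F 2 + 1)) ≤
        P * (F 5 * (M + 1) * (M + 1) * (M + 1)) := by gcongr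
    calc _ ≤ P * ((F 5 + 1) * F 1 * F 2 * F 2)
          - P * (F 5 * (F 1 + 1) * (F 2 + 1) * (F 2 + 1)) := by nlinarith
      _ = _ := by unfold qq; ring
  have u4 := mul_le_mul_of_nonneg_left t4 (show 0 ≤ 3 * ε by positivity)
  have u3 := mul_le_mul_of_nonneg_left t3 (show 0 ≤ 3 * (2 - ε) by linarith)
  have v1 : 3 * (2 - ε) * (R * (1 + M)^2 * F 1 ^ 2) ≤ 6 * (R * (1 + M)^2 * F 1 ^ 2) := by
    have : 0 ≤ R * (1 + M)^2 * F 1 ^ 2 := by positivity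
    nlinarith
  have v2 : 3 * ε * (P * (1 + M)^3 * F 5) ≤ 3 * (2 - ε) * (R * F 5) := by
    have := mul_le_mul_of_nonneg_right e2 f5.le
    have : 0 ≤ (1 - ε) * (R * F 5) := mul_nonneg (by linarith) (by positivity)
    linarith
  have v3 : C * F 1 ^ 2 < 3 * ε * (P * m^2 * F 1) := by
    have := mul_lt_mul_of_pos_right h1 f1
    linarith
  have v4 : C * F 1 ^ 2 = 2 * (A * (1 + M)^2 * F 1 ^ 2) + 3 * (B * (1 + M)^2 * F 1 ^ 2)
    + 6 * (R * (1 + M)^2 * F 1 ^ 2) := by rw [hC]; ring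
  linarith

theorem K_bounds (I : ℕ) (hI : 5 ≤ I) (K : ℕ → ℕ → ℕ → ℕ → ℝ)
    (hKpos : ∀ a b c d, 0 < K a b c d) : ∃ κ > 0, ∃ Λ > 0,
    ∀ a ∈ Finset.Icc 1 I, ∀ b ∈ Finset.Icc 1 I, ∀ c ∈ Finset.Icc 1 I,
      ∀ d ∈ Finset.Icc 1 I, κ ≤ K a b c d ∧ K a b c d ≤ Λ := by
  set J := Finset.Icc 1 I
  have h1 : 1 ∈ J := by simp [J]; omega
  have hne : (J ×ˢ J ×ˢ J ×ˢ J).Nonempty := ⟨(1,1,1,1), by simp [h1]⟩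
  obtain ⟨p, -, hp⟩ := Finset.exists_min_image (J ×ˢ J ×ˢ J ×ˢ J)
    (fun p => K p.1 p.2.1 p.2.2.1 p.2.2.2) hne
  obtain ⟨r, -, hr⟩ := Finset.exists_max_image (J ×ˢ J ×ˢ J ×ˢ J)
    (fun p => K p.1 p.2.1 p.2.2.1 p.2.2.2) hne
  refine ⟨_, hKpos p.1 p.2.1 p.2.2.1 p.2.2.2, _, hKpos r.1 r.2.1 r.2.2.1 r.2.2.2,
    fun a ha b hb c hc d hd => ?_⟩
  have hm : (a,b,c,d) ∈ J ×ˢ J ×ˢ J ×ˢ J := by simp [ha, hb, hc, hd]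
  exact ⟨hp _ hm, hr _ hm⟩

theorem persistence (I : ℕ) (hI : 5 ≤ I) (K : ℕ → ℕ → ℕ → ℕ → ℝ)
    (hKpos : ∀ a b c d, 0 < K a b c d)
    (hKsymm : ∀ a b c d, K a b c d = K b a c d ∧ K a b c d = K a c b d ∧
      K a b c d = K a b d c)
    (F : ℝ → ℕ → ℝ) (κ Λ E : ℝ) (hκ : 0 < κ) (hΛ : 0 < Λ) (hE : 0 < E)
    (hK : ∀ a ∈ Finset.Icc 1 I, ∀ b ∈ Finset.Icc 1 I, ∀ c ∈ Finset.Icc 1 I,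
      ∀ d ∈ Finset.Icc 1 I, κ ≤ K a b c d ∧ K a b c d ≤ Λ)
    (hFpos : ∀ t ∈ Set.Ici (0 : ℝ), ∀ k ∈ Finset.Icc 1 I, 0 < F t k ∧ F t k ≤ E)
    (hcons : ∀ t ∈ Set.Ici (0 : ℝ), ∑ k ∈ Finset.Icc 1 I, (k : ℝ) * F t k = E)
    (hF : ∀ t ∈ Set.Ici (0 : ℝ), ∀ k₁ ∈ Finset.Icc 1 I,
      HasDerivWithinAt (fun s => F s k₁) (C13 I K (F t) k₁) (Set.Ici 0) t) :
    ∀ k ∈ Finset.Icc 1 I, ∃ m > 0, ∀ t ∈ Set.Ici (0 : ℝ), m ≤ F t k := by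
  have z0 : (0:ℝ) ∈ Set.Ici (0:ℝ) := le_refl (0:ℝ)
  have hI' : (5:ℝ) ≤ I := by exact_mod_cast hI
  have hI0 : (0:ℝ) < I := by linarith
  set C := 4 * (I:ℝ)^3 * Λ * (1+E)^3 with hC
  have C0 : 0 < C := by positivity
  have low := fun t (ht : t ∈ Set.Ici (0:ℝ)) k hk =>
    C13_lower I K (F t) κ Λ E hκ hK (hFpos t ht) k hk
  rw [← hC] at low
  have mem : ∀ k, 1 ≤ k → k ≤ I → k ∈ Finset.Icc 1 I := fun k h1 h2 => Finset.mem_Icc.2 ⟨h1, h2⟩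
  have m1 := mem 1 le_rfl (by omega)
  have m2 := mem 2 (by omega) (by omega)
  have m3 := mem 3 (by omega) (by omega)
  have m4 := mem 4 (by omega) (by omega)
  have m5 := mem 5 (by omega) (by omega)
  -- the non-two mass
  have hL : ∃ η > 0, ∀ t ∈ Set.Ici (0:ℝ), η ≤ ∑ k ∈ (Finset.Icc 1 I).erase 2, F t k := by
    rcases Nat.lt_or_ge 5 I with h6 | h6
    · have m6 := mem 6 (by omega) (by omega)
      have m6' : 6 ∈ (Finset.Icc 1 I).erase 2 := by simp; omega
      have hY : 0 < κ * (E/(2*I))^3 / C := by positivity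
      have hX : 0 < E / (2*I) := by positivity
      refine persist (fun t => ∑ k ∈ (Finset.Icc 1 I).erase 2, F t k)
        (fun t => ∑ k ∈ (Finset.Icc 1 I).erase 2, C13 I K (F t) k)
        (min (E/(2*I)) (κ * (E/(2*I))^3 / C)) (lt_min hX hY) ?_ ?_ ?_
      · exact Finset.sum_pos (fun k hk => (hFpos 0 z0 k (Finset.mem_of_mem_erase hk)).1) ⟨6, m6'⟩
      · intro t ht
        exact HasDerivWithinAt.fun_sum fun k hk => hF t ht k (Finset.mem_of_mem_erase hk)
      · intro t ht hlt
        obtain ⟨l1, l2⟩ := lt_min_iff.1 hlt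
        rw [lt_div_iff₀ C0] at l2
        have a1 : E ≤ I * ∑ k ∈ Finset.Icc 1 I, F t k := by
          rw [← hcons t ht, Finset.mul_sum]
          refine Finset.sum_le_sum fun k hk => ?_
          have := (hFpos t ht k hk).1
          have : (k:ℝ) ≤ I := by exact_mod_cast (Finset.mem_Icc.1 hk).2
          gcongr
        rw [← Finset.add_sum_erase _ _ m2] at a1
        have a2 : E/(2*I) ≤ F t 2 := by
          have e1 : E = I * (E/(2*I) + E/(2*I)) := by field_simp; ring
          rw [e1] at a1
          have := le_of_mul_le_mul_left a1 hI0
          linarith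
        have a3 : κ * (E/(2*I))^3 - C * F t 6 ≤ C13 I K (F t) 6 := by
          have := (low t ht 6 m6).1 2 m2 2 m2 2 m2 rfl
          have f20 : 0 ≤ F t 2 := (hFpos t ht 2 m2).1.le
          have h3 : κ * (E/(2*I))^3 ≤ κ * (F t 2 * F t 2 * F t 2) := by
            calc _ = κ * ((E/(2*I)) * (E/(2*I)) * (E/(2*I))) := by ring
              _ ≤ _ := by gcongr
          linarith
        have a4 : -(C * ∑ k ∈ ((Finset.Icc 1 I).erase 2).erase 6, F t k) ≤
            ∑ k ∈ ((Finset.Icc 1 I).erase 2).erase 6, C13 I K (F t) k := by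
          rw [Finset.mul_sum, ← Finset.sum_neg_distrib]
          exact Finset.sum_le_sum fun k hk =>
            (low t ht k (Finset.mem_of_mem_erase (Finset.mem_of_mem_erase hk))).2.2
        rw [← Finset.add_sum_erase _ _ m6'] at l2 ⊢
        linarith
    · have hI5 : I = 5 := by omega
      subst hI5
      have ex : ∀ t, ∑ k ∈ (Finset.Icc 1 5).erase 2, F t k = F t 1 + F t 3 + F t 4 + F t 5 := by
        intro t
        have : (Finset.Icc 1 5).erase 2 = ({1,3,4,5} : Finset ℕ) := by decide
        rw [this]; simp; ring
      obtain ⟨ε, e0, η, η0, e1, hp⟩ := five_pos K hKpos hKsymm E (E/4) hE (by positivity)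
      obtain ⟨m, m0, hm⟩ := persist (fun t => F t 1 + F t 3 + F t 4 + (1 + ε) * F t 5)
        (fun t => C13 5 K (F t) 1 + C13 5 K (F t) 3 + C13 5 K (F t) 4 + (1 + ε) * C13 5 K (F t) 5)
        (min η (E/10)) (lt_min η0 (by positivity))
        (by
          have := (hFpos 0 z0 1 m1).1
          have := (hFpos 0 z0 3 m3).1
          have := (hFpos 0 z0 4 m4).1
          have := (hFpos 0 z0 5 m5).1
          positivity)
        (fun t ht => (((hF t ht 1 m1).add (hF t ht 3 m3)).add (hF t ht 4 m4)).add
          ((hF t ht 5 m5).const_mul (1 + ε)))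
        (by
          intro t ht hlt
          obtain ⟨l1, l2⟩ := lt_min_iff.1 hlt
          have f1 := (hFpos t ht 1 m1).1
          have f3 := (hFpos t ht 3 m3).1
          have f4 := (hFpos t ht 4 m4).1
          have f5 := (hFpos t ht 5 m5).1
          have ef := mul_pos e0 f5
          have hc := hcons t ht
          simp [Finset.sum_Icc_succ_top] at hc
          exact hp (F t) (hFpos t ht) (by linarith) (by linarith))
      refine ⟨m / 2, by positivity, fun t ht => ?_⟩
      rw [ex]
      have := hm t ht
      have f1 := (hFpos t ht 1 m1).1
      have f3 := (hFpos t ht 3 m3).1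
      have f4 := (hFpos t ht 4 m4).1
      have f5 := (hFpos t ht 5 m5).1
      nlinarith
  have p1 : ∃ m > 0, ∀ t ∈ Set.Ici (0 : ℝ), m ≤ F t 1 := by
    obtain ⟨η, η0, hη⟩ := hL
    have hX : 0 < η / I := by positivity
    have hY : 0 < κ * (η / I) / C := by positivity
    refine persist (fun t => F t 1) (fun t => C13 I K (F t) 1)
      (min (η / I) (κ * (η / I) / C)) (lt_min hX hY) (hFpos 0 z0 1 m1).1
      (fun t ht => hF t ht 1 m1) ?_
    intro t ht hlt
    obtain ⟨l1, l2⟩ := lt_min_iff.1 hlt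
    rw [lt_div_iff₀ C0] at l2
    obtain ⟨k, hk, hkk⟩ : ∃ k ∈ (Finset.Icc 1 I).erase 2, η / I ≤ F t k := by
      by_contra hn
      push Not at hn
      have h1 : ∑ k ∈ (Finset.Icc 1 I).erase 2, F t k <
          ∑ k ∈ (Finset.Icc 1 I).erase 2, η / I :=
        Finset.sum_lt_sum_of_nonempty ⟨1, by simp; omega⟩ hn
      have h2 : ∑ k ∈ (Finset.Icc 1 I).erase 2, η / (I:ℝ) ≤ ∑ k ∈ Finset.Icc 1 I, η / (I:ℝ) :=
        Finset.sum_le_sum_of_subset_of_nonneg (Finset.erase_subset _ _) fun _ _ _ => hX.le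
      have h3 : ∑ k ∈ Finset.Icc 1 I, η / (I:ℝ) = η := by simp; field_simp
      have := hη t ht
      linarith
    have hk' := Finset.mem_Icc.1 (Finset.mem_of_mem_erase hk)
    have hk2 : k ≠ 2 := Finset.ne_of_mem_erase hk
    have hk1 : k ≠ 1 := by rintro rfl; linarith
    have := (low t ht 1 m1).2.1 k (mem k hk'.1 hk'.2) 1 m1 (k-2) (mem _ (by omega) (by omega))
      (by omega)
    have : κ * (η / I) ≤ κ * F t k := by gcongr
    linarith
  have gain1 : ∀ b ∈ Finset.Icc 1 I, ∀ c ∈ Finset.Icc 1 I, ∀ d ∈ Finset.Icc 1 I,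
      ∀ k ∈ Finset.Icc 1 I, b + c + d = k →
      (∃ m > 0, ∀ t ∈ Set.Ici (0 : ℝ), m ≤ F t b) →
      (∃ m > 0, ∀ t ∈ Set.Ici (0 : ℝ), m ≤ F t c) →
      (∃ m > 0, ∀ t ∈ Set.Ici (0 : ℝ), m ≤ F t d) →
      ∃ m > 0, ∀ t ∈ Set.Ici (0 : ℝ), m ≤ F t k := by
    rintro b hb c hc d hd k hk h ⟨mb, pb, hb'⟩ ⟨mc, pc, hc'⟩ ⟨md, pd, hd'⟩
    refine persist' (fun t => F t k) (fun t => C13 I K (F t) k) C (κ * (mb * mc * md)) C0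
      (by positivity) (hFpos 0 z0 k hk).1 (fun t ht => hF t ht k hk) fun t ht => ?_
    have := (low t ht k hk).1 b hb c hc d hd h
    have b1 := hb' t ht
    have c1 := hc' t ht
    have d1 := hd' t ht
    have : κ * (mb * mc * md) ≤ κ * (F t b * F t c * F t d) := by
      have : 0 ≤ F t b := by linarith
      have : 0 ≤ F t c := by linarith
      gcongr
    linarith
  have p3 := gain1 1 m1 1 m1 1 m1 3 m3 rfl p1 p1 p1
  have p5 := gain1 1 m1 1 m1 3 m3 5 m5 rfl p1 p1 p3
  have p2 : ∃ m > 0, ∀ t ∈ Set.Ici (0 : ℝ), m ≤ F t 2 := by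
    obtain ⟨m, pm, hm⟩ := p5
    refine persist' (fun t => F t 2) (fun t => C13 I K (F t) 2) C (κ * m) C0
      (by positivity) (hFpos 0 z0 2 m2).1 (fun t ht => hF t ht 2 m2) fun t ht => ?_
    have := (low t ht 2 m2).2.1 5 m5 1 m1 2 m2 rfl
    have : κ * m ≤ κ * F t 5 := by have := hm t ht; gcongr
    linarith
  intro k
  induction k using Nat.strong_induction_on with
  | _ k ih =>
    intro hk
    have hk' := Finset.mem_Icc.1 hk
    rcases Nat.lt_or_ge k 3 with h | h
    · obtain rfl | rfl : k = 1 ∨ k = 2 := by omega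
      · exact p1
      · exact p2
    · have hm := mem (k-2) (by omega) (by omega)
      exact gain1 1 m1 1 m1 (k-2) hm k hk (by omega) p1 p1 (ih (k-2) (by omega) hm)

/-- Exponential convergence to the Bose–Einstein equilibrium for the discrete
`C₁₃` system. -/
theorem C13_convergence_to_equilibrium (I : ℕ) (hI : 5 ≤ I) (K : ℕ → ℕ → ℕ → ℕ → ℝ)
    (hKpos : ∀ a b c d, 0 < K a b c d)
    (hKsymm : ∀ a b c d, K a b c d = K b a c d ∧ K a b c d = K a c b d ∧
      K a b c d = K a b d c)
    (F : ℝ → ℕ → ℝ)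
    (hFpos : ∀ t ∈ Set.Ici (0 : ℝ), ∀ k ∈ Finset.Icc 1 I, 0 < F t k)
    (hF : ∀ t ∈ Set.Ici (0 : ℝ), ∀ k₁ ∈ Finset.Icc 1 I,
      HasDerivWithinAt (fun s => F s k₁) (C13 I K (F t) k₁) (Set.Ici 0) t) :
    ∃ ρ > (0 : ℝ), ∃ C₁ > (0 : ℝ), ∃ C₂ > (0 : ℝ),
      (∑ k ∈ Finset.Icc 1 I, (k : ℝ) / (Real.exp (ρ * k) - 1)
        = ∑ k ∈ Finset.Icc 1 I, (k : ℝ) * F 0 k) ∧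
      ∀ t ∈ Set.Ici (0 : ℝ), ∀ k ∈ Finset.Icc 1 I,
        |F t k - 1 / (Real.exp (ρ * k) - 1)| ≤ C₁ * Real.exp (-C₂ * t) := by
  have z0 : (0:ℝ) ∈ Set.Ici (0:ℝ) := le_refl (0:ℝ)
  have hI' : (5:ℝ) ≤ I := by exact_mod_cast hI
  have hI0 : (0:ℝ) < I := by linarith
  have m1 : 1 ∈ Finset.Icc 1 I := by simp; omega
  have k1 : ∀ k ∈ Finset.Icc 1 I, (1:ℝ) ≤ k := by
    intro k hk; exact_mod_cast (Finset.mem_Icc.1 hk).1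
  set E := ∑ k ∈ Finset.Icc 1 I, (k : ℝ) * F 0 k with hEdef
  have hE : 0 < E := Finset.sum_pos (fun k hk =>
    mul_pos (by linarith [k1 k hk]) (hFpos 0 z0 k hk)) ⟨1, m1⟩
  have hcons : ∀ t ∈ Set.Ici (0 : ℝ), ∑ k ∈ Finset.Icc 1 I, (k : ℝ) * F t k = E := by
    have hd : ∀ t ∈ Set.Ici (0:ℝ), HasDerivWithinAt
        (fun s => ∑ k ∈ Finset.Icc 1 I, (k : ℝ) * F s k) 0 (Set.Ici 0) t := by
      intro t ht
      have h1 : HasDerivWithinAt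
        (fun s => ∑ k ∈ Finset.Icc 1 I, (k : ℝ) * F s k)
        (∑ k ∈ Finset.Icc 1 I, (k : ℝ) * C13 I K (F t) k) (Set.Ici 0) t :=
        HasDerivWithinAt.fun_sum fun k hk => (hF t ht k hk).const_mul _
      refine h1.congr_deriv ?_
      rw [weak_form I K hKsymm (F t) (fun k => (k:ℝ))]
      refine Finset.sum_eq_zero fun a _ => Finset.sum_eq_zero fun b _ =>
        Finset.sum_eq_zero fun c _ => Finset.sum_eq_zero fun d _ => ?_
      split_ifs with h
      · rw [← h]; push_cast; ring
      · rfl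
    intro t ht
    exact constant_of_has_deriv_right_zero (a := 0) (b := t)
      (fun s hs => ((hd s hs.1).continuousWithinAt).mono Set.Icc_subset_Ici_self)
      (fun s hs => (hd s hs.1).mono (Set.Ici_subset_Ici.2 hs.1)) t ⟨ht, le_rfl⟩
  have hFE : ∀ t ∈ Set.Ici (0 : ℝ), ∀ k ∈ Finset.Icc 1 I, 0 < F t k ∧ F t k ≤ E := by
    intro t ht k hk
    refine ⟨hFpos t ht k hk, ?_⟩
    rw [← hcons t ht]
    have h1 := Finset.single_le_sum (f := fun k : ℕ => (k:ℝ) * F t k)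
      (fun k hk => mul_nonneg (by linarith [k1 k hk]) (hFpos t ht k hk).le) hk
    have := hFpos t ht k hk
    have := k1 k hk
    nlinarith
  obtain ⟨κ, hκ, Λ, hΛ, hK⟩ := K_bounds I hI K hKpos
  have hP := persistence I hI K hKpos hKsymm F κ Λ E hκ hΛ hE hK hFE hcons hF
  obtain ⟨δ, hδ, hFδ⟩ : ∃ δ > 0, ∀ k ∈ Finset.Icc 1 I, ∀ t ∈ Set.Ici (0:ℝ), δ ≤ F t k := by
    choose! m hm0 hm using hP
    obtain ⟨k0, hk0, hmin⟩ := Finset.exists_min_image (Finset.Icc 1 I) m ⟨1, m1⟩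
    exact ⟨m k0, hm0 k0 hk0, fun k hk t ht => le_trans (hmin k hk) (hm k hk t ht)⟩
  obtain ⟨ρ, hρ, hρE⟩ := exists_rho I hI E hE
  set G : ℕ → ℝ := fun k => 1 / (Real.exp (ρ * k) - 1) with hG
  have ex1 : ∀ k ∈ Finset.Icc 1 I, 0 < Real.exp (ρ * k) - 1 := by
    intro k hk
    have := Real.add_one_le_exp (ρ * k)
    have := mul_pos hρ (show (0:ℝ) < k by linarith [k1 k hk])
    linarith
  have G0 : ∀ k ∈ Finset.Icc 1 I, 0 < G k := fun k hk => one_div_pos.2 (ex1 k hk)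
  have GE : ∑ k ∈ Finset.Icc 1 I, (k:ℝ) * G k = E := by
    rw [← hρE]
    refine Finset.sum_congr rfl fun k _ => ?_
    simp only [hG]; ring
  have GM : ∀ k ∈ Finset.Icc 1 I, G k ≤ E := by
    intro k hk
    rw [← GE]
    have h1 := Finset.single_le_sum (f := fun k : ℕ => (k:ℝ) * G k)
      (fun k hk => mul_nonneg (by linarith [k1 k hk]) (G0 k hk).le) hk
    have := G0 k hk
    have := k1 k hk
    nlinarith
  have Glog : ∀ k ∈ Finset.Icc 1 I, Real.log (G k) - Real.log (1 + G k) = -(ρ * k) := by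
    intro k hk
    have h0 := G0 k hk
    have h1 := ex1 k hk
    rw [← Real.log_div h0.ne' (by positivity)]
    have : G k / (1 + G k) = Real.exp (-(ρ * k)) := by
      rw [Real.exp_neg]
      have := Real.exp_pos (ρ * k)
      simp only [hG]
      field_simp
      ring
    rw [this, Real.log_exp]
  set H : ℝ → ℝ := fun t => ∑ k ∈ Finset.Icc 1 I, hh (F t k) (G k) with hH
  set H' : ℝ → ℝ := fun t => ∑ k ∈ Finset.Icc 1 I, zz (F t k) (G k) * C13 I K (F t) k with hH'
  have Hd : ∀ t ∈ Set.Ici (0:ℝ), HasDerivWithinAt H (H' t) (Set.Ici 0) t := by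
    intro t ht
    refine HasDerivWithinAt.fun_sum fun k hk => ?_
    exact (hh_deriv (F t k) (G k) (hFpos t ht k hk)).comp_hasDerivWithinAt t (hF t ht k hk)
  set c := κ * δ^3 with hc
  have c0 : 0 < c := by positivity
  set B := I * (E * (1 + E) * (16 * (I:ℝ)^2)) with hB
  have B0 : 0 < B := by positivity
  set l := c / B with hl
  have l0 : 0 < l := by positivity
  have key : ∀ t ∈ Set.Ici (0:ℝ), H' t ≤ - (l * H t) := by
    intro t ht
    have hd := diss I K hKsymm (F t) κ δ ρ hκ hδ
      (fun a ha b hb c hc d hd => (hK a ha b hb c hc d hd).1) (fun k hk => hFδ k hk t ht)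
      (fun k => zz (F t k) (G k)) (fun k hk => by
        have := Glog k hk
        simp only [zz]; linarith)
    rw [← hc] at hd
    have sgn1 : ∀ k ∈ Finset.Icc 1 I, zz (F t k) (G k) < 0 → F t k < G k := by
      intro k hk hz
      by_contra hn
      push Not at hn
      have := zz_lower (F t k) (G k) E (hFpos t ht k hk) (G0 k hk) (hFE t ht k hk).2 (GM k hk) hn
      have : 0 < E * (1 + E) := by positivity
      nlinarith
    have sgn2 : ∀ k ∈ Finset.Icc 1 I, 0 < zz (F t k) (G k) → G k < F t k := by
      intro k hk hz
      by_contra hn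
      push Not at hn
      have := zz_lower (G k) (F t k) E (G0 k hk) (hFpos t ht k hk) (GM k hk) (hFE t ht k hk).2 hn
      rw [zz_neg] at this
      have : 0 < E * (1 + E) := by positivity
      nlinarith
    obtain ⟨i, hi, zi⟩ : ∃ i ∈ Finset.Icc 1 I, 0 ≤ zz (F t i) (G i) := by
      by_contra hn
      push Not at hn
      have : ∑ k ∈ Finset.Icc 1 I, (k:ℝ) * F t k < ∑ k ∈ Finset.Icc 1 I, (k:ℝ) * G k :=
        Finset.sum_lt_sum_of_nonempty ⟨1, m1⟩ fun k hk =>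
          mul_lt_mul_of_pos_left (sgn1 k hk (hn k hk)) (by linarith [k1 k hk])
      rw [GE, hcons t ht] at this
      exact lt_irrefl _ this
    obtain ⟨j, hj, zj⟩ : ∃ i ∈ Finset.Icc 1 I, zz (F t i) (G i) ≤ 0 := by
      by_contra hn
      push Not at hn
      have : ∑ k ∈ Finset.Icc 1 I, (k:ℝ) * G k < ∑ k ∈ Finset.Icc 1 I, (k:ℝ) * F t k :=
        Finset.sum_lt_sum_of_nonempty ⟨1, m1⟩ fun k hk =>
          mul_lt_mul_of_pos_left (sgn2 k hk (hn k hk)) (by linarith [k1 k hk])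
      rw [GE, hcons t ht] at this
      exact lt_irrefl _ this
    have hco := coer I hI (fun k => zz (F t k) (G k)) i j hi hj zi zj
    set S := ∑ a ∈ Finset.Icc 1 I, ∑ b ∈ Finset.Icc 1 I,
      ∑ c ∈ Finset.Icc 1 I, ∑ d ∈ Finset.Icc 1 I,
      if b + c + d = a then (zz (F t a) (G a) - zz (F t b) (G b) - zz (F t c) (G c)
        - zz (F t d) (G d))^2 else 0 with hS
    have HB : H t ≤ B * S := by
      calc H t ≤ ∑ k ∈ Finset.Icc 1 I, E * (1 + E) * (16 * (I:ℝ)^2 * S) := by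
            refine Finset.sum_le_sum fun k hk => ?_
            refine (hh_upper (F t k) (G k) E (hFpos t ht k hk) (G0 k hk) (hFE t ht k hk).2
              (GM k hk)).trans ?_
            have := hco k hk
            gcongr
        _ = B * S := by simp [hB]; ring
    have : l * H t ≤ c * S := by
      calc l * H t ≤ l * (B * S) := by gcongr
        _ = c * S := by rw [hl]; field_simp
    calc H' t ≤ -(c * S) := hd
      _ ≤ _ := by linarith
  have anti : AntitoneOn (fun t => H t * Real.exp (l * t)) (Set.Ici 0) := by
    have hd : ∀ t ∈ Set.Ici (0:ℝ), HasDerivWithinAt (fun t => H t * Real.exp (l * t))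
        ((H' t + l * H t) * Real.exp (l * t)) (Set.Ici 0) t := by
      intro t ht
      have he : HasDerivAt (fun t : ℝ => Real.exp (l * t)) (Real.exp (l * t) * (l * 1)) t :=
        ((hasDerivAt_id t).const_mul l).exp
      refine ((Hd t ht).mul he.hasDerivWithinAt).congr_deriv ?_
      ring
    refine antitoneOn_of_hasDerivWithinAt_nonpos (convex_Ici 0)
      (f' := fun t => (H' t + l * H t) * Real.exp (l * t))
      (fun t ht => (hd t ht).continuousWithinAt)
      (fun t ht => (hd t (interior_subset ht)).mono interior_subset) fun t ht => ?_
    have := key t (interior_subset ht)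
    exact mul_nonpos_of_nonpos_of_nonneg (by linarith) (Real.exp_pos _).le
  have hh0 : ∀ t ∈ Set.Ici (0:ℝ), ∀ k ∈ Finset.Icc 1 I,
      (F t k - G k)^2 / (2 * (E * (1 + E))) ≤ hh (F t k) (G k) := fun t ht k hk =>
    hh_lower (F t k) (G k) E (hFpos t ht k hk) (G0 k hk) (hFE t ht k hk).2 (GM k hk)
  have hhnn : ∀ t ∈ Set.Ici (0:ℝ), ∀ k ∈ Finset.Icc 1 I, 0 ≤ hh (F t k) (G k) :=
    fun t ht k hk => le_trans (by positivity) (hh0 t ht k hk)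
  have H0 : 0 ≤ H 0 := Finset.sum_nonneg fun k hk => hhnn 0 z0 k hk
  refine ⟨ρ, hρ, √(2 * (E * (1 + E)) * (H 0 + 1)), by positivity, l / 2, by positivity,
    hρE, fun t ht k hk => ?_⟩
  have h1 : H t * Real.exp (l * t) ≤ H 0 := by
    have := anti z0 ht ht
    simpa using this
  have h2 : hh (F t k) (G k) ≤ H t :=
    Finset.single_le_sum (f := fun k => hh (F t k) (G k)) (fun k hk => hhnn t ht k hk) hk
  have h3 : H t ≤ (H 0 + 1) * Real.exp (-(l * t)) := by
    rw [Real.exp_neg, ← div_eq_mul_inv, le_div_iff₀ (Real.exp_pos _)]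
    linarith
  have h4 := hh0 t ht k hk
  rw [div_le_iff₀ (by positivity)] at h4
  have h5 : (F t k - G k)^2 ≤ 2 * (E * (1 + E)) * (H 0 + 1) * Real.exp (-(l * t)) := by
    have : hh (F t k) (G k) * (2 * (E * (1 + E))) ≤
      ((H 0 + 1) * Real.exp (-(l * t))) * (2 * (E * (1 + E))) := by
      gcongr
      linarith
    linarith
  have h6 := Real.abs_le_sqrt h5
  rw [Real.sqrt_mul (by positivity), ← Real.exp_half] at h6
  have e : -(l * t) / 2 = -(l / 2) * t := by ring
  rw [e] at h6
  exact h6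
end

section
/- Every differentiable solution F : [0,∞) → ℝ^I of the discrete C₂₂ system satisfies both conservation of mass and conservation of energy: Σ_{k=1}^I F_k(t) = Σ_{k=1}^I F_k(0) and Σ_{k=1}^I k·F_k(t) = Σ_{k=1}^I k·F_k(0) for all t ≥ 0; equivalently, Σ_{k=1}^I (dF_k/dt)(t) = 0 and Σ_{k=1}^I k·(dF_k/dt)(t) = 0 for all t ≥ 0. -/
/-- The right-hand side of the discrete `C₂₂` system for `k₁ ∈ {1,…,I}`. -/
noncomputable def C22 (I : ℕ) (K : ℕ → ℕ → ℕ → ℕ → ℝ) (F : ℕ → ℝ) (k₁ : ℕ) : ℝ :=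
  ∑ k₂ ∈ Finset.Icc 1 I, ∑ k₃ ∈ Finset.Icc 1 I, ∑ k₄ ∈ Finset.Icc 1 I,
    if k₁ + k₂ = k₃ + k₄ then
      K k₁ k₂ k₃ k₄ * ((F k₁ + 1) * (F k₂ + 1) * F k₃ * F k₄
        - F k₁ * F k₂ * (F k₃ + 1) * (F k₄ + 1))
    else 0

theorem C22_sum_weight (I : ℕ) (K : ℕ → ℕ → ℕ → ℕ → ℝ)
    (hKsymm : ∀ a b c d, K a b c d = K b a c d ∧ K a b c d = K a c b d ∧
      K a b c d = K a b d c) (F : ℕ → ℝ) (φ : ℕ → ℝ)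
    (hφ : ∀ a b c d : ℕ, a + b = c + d → φ a + φ b = φ c + φ d) :
    ∑ k ∈ Finset.Icc 1 I, φ k * C22 I K F k = 0 := by
  obtain ⟨T, hT⟩ : ∃ T : ℕ → ℕ → ℕ → ℕ → ℝ, ∀ a b c d, T a b c d =
    if a + b = c + d then
      K a b c d * ((F a + 1) * (F b + 1) * F c * F d
        - F a * F b * (F c + 1) * (F d + 1)) else 0 := ⟨_, fun _ _ _ _ => rfl⟩
  have hab : ∀ a b c d, T a b c d = T b a c d := by
    intro a b c d
    rw [hT, hT, (hKsymm a b c d).1, add_comm a b]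
    split_ifs <;> ring
  have hcd : ∀ a b c d, T a b c d = T a b d c := by
    intro a b c d
    rw [hT, hT, (hKsymm a b c d).2.2, add_comm c d]
    split_ifs <;> ring
  have hK : ∀ a b c d, K c d a b = K a b c d := by
    intro a b c d
    rw [(hKsymm c d a b).2.1, (hKsymm c a d b).1, (hKsymm a c d b).2.2, (hKsymm a c b d).2.1]
  have hsw : ∀ a b c d, T c d a b = - T a b c d := by
    intro a b c d
    rw [hT, hT, hK]
    by_cases h : a + b = c + d
    · rw [if_pos h, if_pos h.symm]; ring
    · rw [if_neg h, if_neg (Ne.symm h)]; ring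
  have hz : ∀ a b c d, (φ a + φ b - φ c - φ d) * T a b c d = 0 := by
    intro a b c d
    by_cases h : a + b = c + d
    · have : φ a + φ b - φ c - φ d = 0 := by linarith [hφ a b c d h]
      rw [this, zero_mul]
    · rw [hT, if_neg h, mul_zero]
  set s := Finset.Icc 1 I
  have e1 : ∑ k ∈ s, φ k * C22 I K F k
      = ∑ a ∈ s, ∑ b ∈ s, ∑ c ∈ s, ∑ d ∈ s, φ a * T a b c d := by
    simp only [C22, Finset.mul_sum, hT]
    rfl
  have e2 : ∑ a ∈ s, ∑ b ∈ s, ∑ c ∈ s, ∑ d ∈ s, φ b * T a b c d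
      = ∑ a ∈ s, ∑ b ∈ s, ∑ c ∈ s, ∑ d ∈ s, φ a * T a b c d := by
    rw [Finset.sum_comm]
    refine Finset.sum_congr rfl fun a _ => Finset.sum_congr rfl fun b _ =>
      Finset.sum_congr rfl fun c _ => Finset.sum_congr rfl fun d _ => ?_
    rw [hab]
  have e3 : ∑ a ∈ s, ∑ b ∈ s, ∑ c ∈ s, ∑ d ∈ s, φ c * T a b c d
      = - ∑ a ∈ s, ∑ b ∈ s, ∑ c ∈ s, ∑ d ∈ s, φ a * T a b c d := by
    have : ∀ g : ℕ → ℕ → ℕ → ℕ → ℝ, ∑ a ∈ s, ∑ b ∈ s, ∑ c ∈ s, ∑ d ∈ s, g a b c d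
        = ∑ c ∈ s, ∑ d ∈ s, ∑ a ∈ s, ∑ b ∈ s, g a b c d := by
      intro g
      have := Finset.sum_comm (s := s ×ˢ s) (t := s ×ˢ s)
        (f := fun p q => g p.1 p.2 q.1 q.2)
      simpa only [Finset.sum_product] using this
    rw [this]
    simp only [← Finset.sum_neg_distrib]
    refine Finset.sum_congr rfl fun a _ => Finset.sum_congr rfl fun b _ =>
      Finset.sum_congr rfl fun c _ => Finset.sum_congr rfl fun d _ => ?_
    rw [hsw]; ring
  have e4 : ∑ a ∈ s, ∑ b ∈ s, ∑ c ∈ s, ∑ d ∈ s, φ d * T a b c d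
      = ∑ a ∈ s, ∑ b ∈ s, ∑ c ∈ s, ∑ d ∈ s, φ c * T a b c d := by
    refine Finset.sum_congr rfl fun a _ => Finset.sum_congr rfl fun b _ => ?_
    rw [Finset.sum_comm]
    refine Finset.sum_congr rfl fun c _ => Finset.sum_congr rfl fun d _ => ?_
    rw [hcd]
  have e5 : ∑ a ∈ s, ∑ b ∈ s, ∑ c ∈ s, ∑ d ∈ s, (φ a + φ b - φ c - φ d) * T a b c d = 0 := by
    simp only [hz, Finset.sum_const_zero]
  simp only [add_mul, sub_mul, Finset.sum_add_distrib, Finset.sum_sub_distrib] at e5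
  rw [e1]
  linarith

theorem C22_const (f : ℝ → ℝ)
    (hf : ∀ t ∈ Set.Ici (0 : ℝ), HasDerivWithinAt f 0 (Set.Ici 0) t) :
    ∀ t ∈ Set.Ici (0 : ℝ), f t = f 0 := by
  intro t ht
  refine constant_of_has_deriv_right_zero (a := 0) (b := t) ?_ ?_ t ⟨ht, le_rfl⟩
  · intro x hx
    exact ((hf x hx.1).continuousWithinAt).mono fun y hy => hy.1
  · intro x hx
    exact (hf x hx.1).mono (Set.Ici_subset_Ici.2 hx.1)

/-- Conservation of mass and energy for the discrete `C₂₂` system. -/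
theorem C22_mass_energy_conservation (I : ℕ) (hI : 3 ≤ I) (K : ℕ → ℕ → ℕ → ℕ → ℝ)
    (hKpos : ∀ a b c d, 0 < K a b c d)
    (hKsymm : ∀ a b c d, K a b c d = K b a c d ∧ K a b c d = K a c b d ∧
      K a b c d = K a b d c)
    (F : ℝ → ℕ → ℝ)
    (hF : ∀ t ∈ Set.Ici (0 : ℝ), ∀ k₁ ∈ Finset.Icc 1 I,
      HasDerivWithinAt (fun s => F s k₁) (C22 I K (F t) k₁) (Set.Ici 0) t) :
    (∀ t ∈ Set.Ici (0 : ℝ),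
      ∑ k ∈ Finset.Icc 1 I, F t k = ∑ k ∈ Finset.Icc 1 I, F 0 k) ∧
    (∀ t ∈ Set.Ici (0 : ℝ),
      ∑ k ∈ Finset.Icc 1 I, (k : ℝ) * F t k = ∑ k ∈ Finset.Icc 1 I, (k : ℝ) * F 0 k) ∧
    (∀ t ∈ Set.Ici (0 : ℝ),
      HasDerivWithinAt (fun s => ∑ k ∈ Finset.Icc 1 I, F s k) 0 (Set.Ici 0) t) ∧
    (∀ t ∈ Set.Ici (0 : ℝ),
      HasDerivWithinAt (fun s => ∑ k ∈ Finset.Icc 1 I, (k : ℝ) * F s k) 0 (Set.Ici 0) t) := by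
  have key : ∀ φ : ℕ → ℝ, (∀ a b c d : ℕ, a + b = c + d → φ a + φ b = φ c + φ d) →
      ∀ t ∈ Set.Ici (0 : ℝ),
      HasDerivWithinAt (fun s => ∑ k ∈ Finset.Icc 1 I, φ k * F s k) 0 (Set.Ici 0) t := by
    intro φ hφ t ht
    have h := HasDerivWithinAt.fun_sum fun k hk => (hF t ht k hk).const_mul (φ k)
    rwa [C22_sum_weight I K hKsymm (F t) φ hφ] at h
  have h1 := key (fun _ => 1) (fun _ _ _ _ _ => rfl)
  have h2 := key (fun k => (k : ℝ)) (fun a b c d h => by exact_mod_cast h)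
  simp only [one_mul] at h1
  exact ⟨C22_const _ h1, C22_const _ h2, h1, h2⟩
end

section
/- Let F : [0,∞) → (0,∞)^I be a solution of the discrete C₂₂ system with I ≥ 3. Then there exist real constants ρ₁, ρ₂ with ρ₂(k−1) − ρ₁(k−2) > 0 for every k ∈ {1,…,I}, and constants C₁, C₂ > 0, such that the equilibrium F* defined by F*_k = 1/(e^{ρ₂(k−1) − ρ₁(k−2)} − 1) satisfies Σ_{k=1}^I F*_k = Σ_{k=1}^I F_k(0) and Σ_{k=1}^I k·F*_k = Σ_{k=1}^I k·F_k(0), and max_{1≤k≤I} |F_k(t) − F*_k| ≤ C₁ e^{−C₂ t} for all t ≥ 0. -/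
open Finset in
lemma c22_weak_abs (s : Finset ℕ) (T : ℕ → ℕ → ℕ → ℕ → ℝ)
    (h1 : ∀ a b c d, T a b c d = T b a c d) (h2 : ∀ a b c d, T a b c d = - T c d a b)
    (g : ℕ → ℝ) :
    ∑ a ∈ s, g a * ∑ b ∈ s, ∑ c ∈ s, ∑ d ∈ s, T a b c d =
      (1/4) * ∑ a ∈ s, ∑ b ∈ s, ∑ c ∈ s, ∑ d ∈ s, T a b c d * (g a + g b - g c - g d) := by
  have swap : ∀ G : ℕ → ℕ → ℕ → ℕ → ℝ, ∑ a ∈ s, ∑ b ∈ s, ∑ c ∈ s, ∑ d ∈ s, G c d a b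
      = ∑ a ∈ s, ∑ b ∈ s, ∑ c ∈ s, ∑ d ∈ s, G a b c d := by
    intro G
    calc _ = ∑ a ∈ s, ∑ c ∈ s, ∑ b ∈ s, ∑ d ∈ s, G c d a b :=
          sum_congr rfl fun a _ => sum_comm
      _ = ∑ c ∈ s, ∑ a ∈ s, ∑ b ∈ s, ∑ d ∈ s, G c d a b := sum_comm
      _ = ∑ c ∈ s, ∑ a ∈ s, ∑ d ∈ s, ∑ b ∈ s, G c d a b :=
          sum_congr rfl fun a _ => sum_congr rfl fun b _ => sum_comm
      _ = ∑ c ∈ s, ∑ d ∈ s, ∑ a ∈ s, ∑ b ∈ s, G c d a b :=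
          sum_congr rfl fun a _ => sum_comm
  set A := ∑ a ∈ s, ∑ b ∈ s, ∑ c ∈ s, ∑ d ∈ s, T a b c d * g a with hA
  have e0 : ∑ a ∈ s, g a * ∑ b ∈ s, ∑ c ∈ s, ∑ d ∈ s, T a b c d = A := by
    simp only [hA, ← sum_mul]
    exact sum_congr rfl fun a _ => mul_comm _ _
  have eb : ∑ a ∈ s, ∑ b ∈ s, ∑ c ∈ s, ∑ d ∈ s, T a b c d * g b = A := by
    rw [sum_comm, hA]
    refine sum_congr rfl fun a _ => sum_congr rfl fun b _ => sum_congr rfl fun c _ =>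
      sum_congr rfl fun d _ => ?_
    rw [h1]
  have ec : ∑ a ∈ s, ∑ b ∈ s, ∑ c ∈ s, ∑ d ∈ s, T a b c d * g c = -A := by
    rw [hA, ← swap (fun a b c d => T a b c d * g a)]
    simp only [← sum_neg_distrib]
    refine sum_congr rfl fun a _ => sum_congr rfl fun b _ => sum_congr rfl fun c _ =>
      sum_congr rfl fun d _ => ?_
    rw [h2]; ring
  have ed : ∑ a ∈ s, ∑ b ∈ s, ∑ c ∈ s, ∑ d ∈ s, T a b c d * g d = -A := by
    rw [← eb, ← swap (fun a b c d => T a b c d * g b)]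
    simp only [← sum_neg_distrib]
    refine sum_congr rfl fun a _ => sum_congr rfl fun b _ => sum_congr rfl fun c _ =>
      sum_congr rfl fun d _ => ?_
    rw [h2]; ring
  rw [e0]
  simp only [mul_add, mul_sub, sum_add_distrib, sum_sub_distrib]
  rw [eb, ec, ed, ← hA]; ring

def cR (F : ℕ → ℝ) (a b c d : ℕ) : ℝ :=
  (F a + 1) * (F b + 1) * F c * F d - F a * F b * (F c + 1) * (F d + 1)

noncomputable def cP (I : ℕ) (F : ℕ → ℝ) : ℝ :=
  ∑ a ∈ Finset.Icc 1 I, ∑ b ∈ Finset.Icc 1 I, ∑ c ∈ Finset.Icc 1 I, ∑ d ∈ Finset.Icc 1 I,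
    if a + b = c + d then (cR F a b c d)^2 else 0

noncomputable def cpsi (x : ℝ) : ℝ := Real.log (1 + x) - Real.log x

lemma c22_weak (I : ℕ) (K : ℕ → ℕ → ℕ → ℕ → ℝ)
    (hKsymm : ∀ a b c d, K a b c d = K b a c d ∧ K a b c d = K a c b d ∧
      K a b c d = K a b d c) (F : ℕ → ℝ) (g : ℕ → ℝ) :
    ∑ a ∈ Finset.Icc 1 I, g a * C22 I K F a =
      (1/4) * ∑ a ∈ Finset.Icc 1 I, ∑ b ∈ Finset.Icc 1 I, ∑ c ∈ Finset.Icc 1 I,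
        ∑ d ∈ Finset.Icc 1 I,
        (if a + b = c + d then K a b c d * cR F a b c d else 0) * (g a + g b - g c - g d) := by
  rw [← c22_weak_abs]
  · rfl
  · intro a b c d
    rw [(hKsymm a b c d).1, add_comm a b]
    unfold cR
    split_ifs
    · ring
    · rfl
  · intro a b c d
    have : K a b c d = K c d a b := by
      rw [(hKsymm a b c d).2.1, (hKsymm a c b d).1, (hKsymm c a b d).2.2,
        (hKsymm c a d b).2.1]
    rw [this]
    unfold cR
    by_cases h : a + b = c + d
    · rw [if_pos h, if_pos h.symm]; ring
    · rw [if_neg h, if_neg (fun h' => h h'.symm)]; simp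

lemma c22_lin (I : ℕ) (K : ℕ → ℕ → ℕ → ℕ → ℝ)
    (hKsymm : ∀ a b c d, K a b c d = K b a c d ∧ K a b c d = K a c b d ∧
      K a b c d = K a b d c) (F : ℕ → ℝ) (p q : ℝ) :
    ∑ a ∈ Finset.Icc 1 I, (p + q * (a : ℝ)) * C22 I K F a = 0 := by
  rw [c22_weak I K hKsymm F (fun a => p + q * (a:ℝ))]
  rw [Finset.sum_eq_zero, mul_zero]
  intro a _
  refine Finset.sum_eq_zero fun b _ => Finset.sum_eq_zero fun c _ => Finset.sum_eq_zero fun d _ => ?_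
  split_ifs with h
  · have : (a:ℝ) + b = c + d := by exact_mod_cast h
    have h2 : (a:ℝ) = c + d - b := by linarith
    rw [h2]; ring
  · simp

lemma log_ineq_s16 {X Y B : ℝ} (hX : 0 < X) (hY : 0 < Y) (hXB : X ≤ B) (hYB : Y ≤ B) :
    (X - Y)^2 / B ≤ (X - Y) * (Real.log X - Real.log Y) := by
  wlog h : Y ≤ X generalizing X Y with H
  · have := H hY hX hYB hXB (le_of_not_ge h)
    nlinarith [this, show (X-Y)^2 / B = (Y-X)^2/B by ring]
  have h1 : (X - Y) / X ≤ Real.log X - Real.log Y := by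
    have := Real.one_sub_inv_le_log_of_pos (div_pos hX hY)
    rw [Real.log_div hX.ne' hY.ne'] at this
    calc _ = 1 - (X/Y)⁻¹ := by field_simp
      _ ≤ _ := this
  calc (X - Y)^2 / B ≤ (X-Y)^2 / X := by gcongr
    _ = (X - Y) * ((X-Y)/X) := by ring
    _ ≤ _ := mul_le_mul_of_nonneg_left h1 (by linarith)

lemma log_ineq' {X Y D : ℝ} (hD : 0 < D) (hXB : D ≤ X) (hYB : D ≤ Y) :
    |Real.log X - Real.log Y| ≤ |X - Y| / D := by
  wlog h : Y ≤ X generalizing X Y with H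
  · have := H hYB hXB (le_of_not_ge h)
    rwa [abs_sub_comm, abs_sub_comm X]
  have hY : 0 < Y := by linarith
  have hX : 0 < X := by linarith
  rw [abs_of_nonneg (sub_nonneg.2 (Real.log_le_log hY h)), abs_of_nonneg (sub_nonneg.2 h)]
  have := Real.log_le_sub_one_of_pos (div_pos hX hY)
  rw [Real.log_div hX.ne' hY.ne'] at this
  calc _ ≤ X / Y - 1 := this
    _ = (X - Y)/Y := by field_simp
    _ ≤ _ := by
      have : 0 ≤ X - Y := by linarith
      gcongr

lemma cpsi_comb (F : ℕ → ℝ) {a b c d : ℕ} (ha : 0 < F a) (hb : 0 < F b) (hc : 0 < F c)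
    (hd : 0 < F d) : cpsi (F a) + cpsi (F b) - cpsi (F c) - cpsi (F d) =
      Real.log ((F a + 1) * (F b + 1) * F c * F d) -
      Real.log (F a * F b * (F c + 1) * (F d + 1)) := by
  unfold cpsi
  rw [Real.log_mul (by positivity) (by positivity), Real.log_mul (by positivity) (by positivity),
    Real.log_mul (by positivity) (by positivity), Real.log_mul (by positivity) (by positivity),
    Real.log_mul (by positivity) (by positivity), Real.log_mul (by positivity) (by positivity)]
  simp only [add_comm (1:ℝ)]
  ring

lemma K_lower (I : ℕ) (K : ℕ → ℕ → ℕ → ℕ → ℝ) (hKpos : ∀ a b c d, 0 < K a b c d) :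
    ∃ κ > 0, ∀ a ∈ Finset.Icc 1 I, ∀ b ∈ Finset.Icc 1 I, ∀ c ∈ Finset.Icc 1 I,
      ∀ d ∈ Finset.Icc 1 I, κ ≤ K a b c d := by
  rcases (Finset.Icc 1 I).eq_empty_or_nonempty with h | h
  · exact ⟨1, one_pos, by simp [h]⟩
  obtain ⟨x, -, hx⟩ := Finset.exists_min_image
    (Finset.Icc 1 I ×ˢ Finset.Icc 1 I ×ˢ Finset.Icc 1 I ×ˢ Finset.Icc 1 I)
    (fun p => K p.1 p.2.1 p.2.2.1 p.2.2.2) (h.product (h.product (h.product h)))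
  refine ⟨_, hKpos x.1 x.2.1 x.2.2.1 x.2.2.2, fun a ha b hb c hc d hd => ?_⟩
  exact hx (a, b, c, d) (by simp only [Finset.mem_product]; exact ⟨ha, hb, hc, hd⟩)

lemma diss_lower (I : ℕ) (K : ℕ → ℕ → ℕ → ℕ → ℝ) (hKpos : ∀ a b c d, 0 < K a b c d)
    (hKsymm : ∀ a b c d, K a b c d = K b a c d ∧ K a b c d = K a c b d ∧
      K a b c d = K a b d c) (M : ℝ) (hM : 0 < M) :
    ∃ C > 0, ∀ F : ℕ → ℝ, (∀ k ∈ Finset.Icc 1 I, 0 < F k ∧ F k ≤ M) →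
      C * cP I F ≤ ∑ k ∈ Finset.Icc 1 I, cpsi (F k) * C22 I K F k := by
  obtain ⟨κ, hκ, hK⟩ := K_lower I K hKpos
  set B := (M+1)*(M+1)*(M+1)*(M+1) with hB
  have hBpos : 0 < B := by positivity
  refine ⟨(1/4) * (κ / B), by positivity, fun F hF => ?_⟩
  rw [c22_weak I K hKsymm F (fun k => cpsi (F k)), mul_assoc]
  refine mul_le_mul_of_nonneg_left ?_ (by norm_num)
  unfold cP
  simp only [Finset.mul_sum]
  refine Finset.sum_le_sum fun a ha => Finset.sum_le_sum fun b hb => Finset.sum_le_sum fun c hc =>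
    Finset.sum_le_sum fun d hd => ?_
  split_ifs with h
  swap
  · simp
  obtain ⟨ha0, ha1⟩ := hF a ha
  obtain ⟨hb0, hb1⟩ := hF b hb
  obtain ⟨hc0, hc1⟩ := hF c hc
  obtain ⟨hd0, hd1⟩ := hF d hd
  rw [cpsi_comb F ha0 hb0 hc0 hd0]
  have hX : (F a + 1) * (F b + 1) * F c * F d ≤ B := by
    rw [hB]; gcongr <;> linarith
  have hY : F a * F b * (F c + 1) * (F d + 1) ≤ B := by
    rw [hB]; gcongr <;> linarith
  have := log_ineq_s16 (by positivity) (by positivity) hX hY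
  have h0 : 0 ≤ cR F a b c d ^ 2 / B := by positivity
  calc κ / B * cR F a b c d ^ 2 = κ * (cR F a b c d ^ 2 / B) := by ring
    _ ≤ K a b c d * (cR F a b c d ^ 2 / B) := by gcongr; exact hK a ha b hb c hc d hd
    _ ≤ _ := by
      rw [mul_assoc]
      exact mul_le_mul_of_nonneg_left this (hKpos a b c d).le

lemma cP_nonneg (I : ℕ) (F : ℕ → ℝ) : 0 ≤ cP I F := by
  unfold cP
  refine Finset.sum_nonneg fun a _ => Finset.sum_nonneg fun b _ => Finset.sum_nonneg fun c _ =>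
    Finset.sum_nonneg fun d _ => ?_
  split_ifs <;> positivity

lemma cR_le_cP (I : ℕ) (F : ℕ → ℝ) {a b c d : ℕ} (ha : a ∈ Finset.Icc 1 I)
    (hb : b ∈ Finset.Icc 1 I) (hc : c ∈ Finset.Icc 1 I) (hd : d ∈ Finset.Icc 1 I)
    (h : a + b = c + d) : cR F a b c d ^ 2 ≤ cP I F := by
  have n4 : ∀ a b c d : ℕ, 0 ≤ if a + b = c + d then (cR F a b c d)^2 else 0 := by
    intro a b c d
    split_ifs <;> positivity
  have e : cR F a b c d ^ 2 = if a + b = c + d then (cR F a b c d)^2 else 0 := by rw [if_pos h]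
  rw [e]
  unfold cP
  refine le_trans ?_ (Finset.single_le_sum (f := fun a => ∑ b ∈ Finset.Icc 1 I, ∑ c ∈ Finset.Icc 1 I,
    ∑ d ∈ Finset.Icc 1 I, if a + b = c + d then (cR F a b c d)^2 else 0) (fun a _ => ?_) ha)
  · refine le_trans ?_ (Finset.single_le_sum (f := fun b => ∑ c ∈ Finset.Icc 1 I,
      ∑ d ∈ Finset.Icc 1 I, if a + b = c + d then (cR F a b c d)^2 else 0) (fun b _ => ?_) hb)
    · refine le_trans ?_ (Finset.single_le_sum (f := fun c =>
        ∑ d ∈ Finset.Icc 1 I, if a + b = c + d then (cR F a b c d)^2 else 0) (fun c _ => ?_) hc)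
      · exact Finset.single_le_sum (f := fun d => if a + b = c + d then (cR F a b c d)^2 else 0)
          (fun d _ => n4 a b c d) hd
      · exact Finset.sum_nonneg fun d _ => n4 a b c d
    · exact Finset.sum_nonneg fun c _ => Finset.sum_nonneg fun d _ => n4 a b c d
  · exact Finset.sum_nonneg fun b _ => Finset.sum_nonneg fun c _ =>
      Finset.sum_nonneg fun d _ => n4 a b c d

lemma cP_cont (I : ℕ) : Continuous (cP I) := by
  unfold cP
  refine continuous_finsetSum _ fun a _ => continuous_finsetSum _ fun b _ =>
    continuous_finsetSum _ fun c _ => continuous_finsetSum _ fun d _ => ?_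
  split_ifs
  · unfold cR; fun_prop
  · fun_prop

lemma cP_congr (I : ℕ) (F G : ℕ → ℝ) (h : ∀ k ∈ Finset.Icc 1 I, F k = G k) :
    cP I F = cP I G := by
  unfold cP cR
  refine Finset.sum_congr rfl fun a ha => Finset.sum_congr rfl fun b hb =>
    Finset.sum_congr rfl fun c hc => Finset.sum_congr rfl fun d hd => ?_
  rw [h a ha, h b hb, h c hc, h d hd]

lemma compact_lower (I : ℕ) (m e : ℝ) (Q : (ℕ → ℝ) → ℝ) (hQ : Continuous Q)
    (hcongr : ∀ f g : ℕ → ℝ, (∀ k ∈ Finset.Icc 1 I, f k = g k) → Q f = Q g)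
    (hpos : ∀ f : ℕ → ℝ, (∀ k ∈ Finset.Icc 1 I, 0 ≤ f k) → ∑ k ∈ Finset.Icc 1 I, f k = m →
      ∑ k ∈ Finset.Icc 1 I, (k:ℝ) * f k = e → 0 < Q f) :
    ∃ ε > 0, ∀ f : ℕ → ℝ, (∀ k ∈ Finset.Icc 1 I, 0 ≤ f k) → ∑ k ∈ Finset.Icc 1 I, f k = m →
      ∑ k ∈ Finset.Icc 1 I, (k:ℝ) * f k = e → ε ≤ Q f := by
  set S : Set (ℕ → ℝ) := Set.univ.pi (fun _ => Set.Icc 0 m) ∩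
    ({f | ∑ k ∈ Finset.Icc 1 I, f k = m} ∩ {f | ∑ k ∈ Finset.Icc 1 I, (k:ℝ) * f k = e}) with hS
  have hSc : IsCompact S := by
    refine (isCompact_univ_pi fun _ => isCompact_Icc).inter_right (IsClosed.inter ?_ ?_)
    · exact isClosed_eq (by fun_prop) (by fun_prop)
    · exact isClosed_eq (by fun_prop) (by fun_prop)
  have key : ∀ f : ℕ → ℝ, (∀ k ∈ Finset.Icc 1 I, 0 ≤ f k) → ∑ k ∈ Finset.Icc 1 I, f k = m →
      ∑ k ∈ Finset.Icc 1 I, (k:ℝ) * f k = e → ∃ g ∈ S, Q f = Q g := by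
    intro f h0 h1 h2
    refine ⟨fun k => if k ∈ Finset.Icc 1 I then f k else 0, ⟨?_, ?_, ?_⟩, ?_⟩
    · intro k _
      have hm : 0 ≤ m := h1 ▸ Finset.sum_nonneg h0
      dsimp only
      split_ifs with hk
      · exact ⟨h0 k hk, h1 ▸ Finset.single_le_sum h0 hk⟩
      · exact ⟨le_rfl, hm⟩
    · rw [Set.mem_ofPred_eq, ← h1]
      exact Finset.sum_congr rfl fun k hk => if_pos hk
    · rw [Set.mem_ofPred_eq, ← h2]
      exact Finset.sum_congr rfl fun k hk => by simp only [if_pos hk]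
    · exact hcongr _ _ fun k hk => (if_pos hk).symm
  rcases S.eq_empty_or_nonempty with hE | hE
  · refine ⟨1, one_pos, fun f h0 h1 h2 => ?_⟩
    obtain ⟨g, hg, -⟩ := key f h0 h1 h2
    simp [hE] at hg
  obtain ⟨g, hg, hmin⟩ := hSc.exists_isMinOn hE hQ.continuousOn
  refine ⟨Q g, hpos g (fun k _ => (hg.1 k trivial).1) hg.2.1 hg.2.2, fun f h0 h1 h2 => ?_⟩
  obtain ⟨g', hg', he⟩ := key f h0 h1 h2
  rw [he]
  exact hmin hg'

lemma pos_of_zero (I : ℕ) (hI : 3 ≤ I) (m e : ℝ) (h1 : m < e) (h2 : e < I * m) (f : ℕ → ℝ)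
    (hf : ∀ k ∈ Finset.Icc 1 I, 0 ≤ f k) (hm : ∑ k ∈ Finset.Icc 1 I, f k = m)
    (he : ∑ k ∈ Finset.Icc 1 I, (k:ℝ) * f k = e) (hP : cP I f = 0) :
    ∀ k ∈ Finset.Icc 1 I, 0 < f k := by
  have hR : ∀ a ∈ Finset.Icc 1 I, ∀ b ∈ Finset.Icc 1 I, ∀ c ∈ Finset.Icc 1 I,
      ∀ d ∈ Finset.Icc 1 I, a + b = c + d → 0 < f a → 0 < f b → 0 < f c ∧ 0 < f d := by
    intro a ha b hb c hc d hd h pa pb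
    have := cR_le_cP I f ha hb hc hd h
    rw [hP] at this
    have h0 : cR f a b c d = 0 := by nlinarith
    unfold cR at h0
    have hc0 := hf c hc
    have hd0 := hf d hd
    have : 0 < f a * f b * (f c + 1) * (f d + 1) := by positivity
    constructor
    · refine lt_of_le_of_ne hc0 fun h => ?_
      rw [← h] at h0 this; linarith
    · refine lt_of_le_of_ne hd0 fun h => ?_
      rw [← h] at h0 this; linarith
  have int : ∃ k, 2 ≤ k ∧ k + 1 ≤ I ∧ 0 < f k := by
    obtain ⟨i, hi, hi'⟩ : ∃ i ∈ Finset.Icc 1 I, 0 < ((i:ℝ) - 1) * f i := by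
      by_contra! hcon
      have := Finset.sum_nonpos hcon
      simp only [sub_mul, one_mul, Finset.sum_sub_distrib] at this
      linarith
    obtain ⟨j, hj, hj'⟩ : ∃ i ∈ Finset.Icc 1 I, 0 < ((I:ℝ) - i) * f i := by
      by_contra! hcon
      have := Finset.sum_nonpos hcon
      simp only [sub_mul, Finset.sum_sub_distrib, ← Finset.mul_sum] at this
      rw [hm] at this
      linarith
    have fi : 0 < f i := lt_of_le_of_ne (hf i hi) fun h => by rw [← h] at hi'; simp at hi'
    have fj : 0 < f j := lt_of_le_of_ne (hf j hj) fun h => by rw [← h] at hj'; simp at hj'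
    have i1 : i ≠ 1 := by rintro rfl; simp at hi'
    have j1 : j ≠ I := by rintro rfl; simp at hj'
    rw [Finset.mem_Icc] at hi hj
    by_cases ci : i = I
    · by_cases cj : j = 1
      · subst cj; subst ci
        have := (hR 1 (by simp; omega) i (by simp; omega) 2 (by simp; omega) (i-1)
          (by simp; omega) (by omega) fj fi).1
        exact ⟨2, le_rfl, hI, this⟩
      · exact ⟨j, by omega, by omega, fj⟩
    · exact ⟨i, by omega, by omega, fi⟩
  obtain ⟨k, k2, kI, fk⟩ := int
  have up : ∀ n, k + n ≤ I → 0 < f (k + n) := by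
    intro n
    induction n with
    | zero => intro _; exact fk
    | succ n ih =>
      intro h
      have := ih (by omega)
      exact (hR (k+n) (by simp; omega) (k+n) (by simp; omega) (k+n-1) (by simp; omega) (k+(n+1))
        (by simp; omega) (by omega) this this).2
  have down : ∀ n, n + 1 ≤ k → 0 < f (k - n) := by
    intro n
    induction n with
    | zero => intro _; exact fk
    | succ n ih =>
      intro h
      have := ih (by omega)
      exact (hR (k-n) (by simp; omega) (k-n) (by simp; omega) (k-(n+1)) (by simp; omega) (k-n+1)
        (by simp; omega) (by omega) this this).1
  intro j hj
  rw [Finset.mem_Icc] at hj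
  rcases le_total k j with h | h
  · have := up (j - k) (by omega)
    rwa [show k + (j-k) = j by omega] at this
  · have := down (k - j) (by omega)
    rwa [show k - (k-j) = j by omega] at this

/-- approximate linearity from small second differences -/
lemma second_diff (I : ℕ) (u : ℕ → ℝ) (η : ℝ) (hη : 0 ≤ η)
    (h : ∀ k, 2 ≤ k → k + 1 ≤ I → |u k + u k - u (k-1) - u (k+1)| ≤ η) :
    ∀ k, 1 ≤ k → k ≤ I → |u k - (u 1 + ((k:ℝ) - 1) * (u 2 - u 1))| ≤ (k:ℝ)^2 * η := by
  have hd : ∀ n, n + 2 ≤ I → |(u (n+2) - u (n+1)) - (u 2 - u 1)| ≤ n * η := by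
    intro n
    induction n with
    | zero => intro _; simp
    | succ n ih =>
      intro hn
      have a1 := abs_le.1 (ih (by omega))
      have a2 := abs_le.1 (h (n+2) (by omega) (by omega))
      simp only [show n + 2 - 1 = n + 1 by omega] at a2
      rw [abs_le]
      simp only [show n + 1 + 2 = n + 2 + 1 by omega, show n + 1 + 1 = n + 2 by omega]
      push_cast
      constructor <;> linarith [a1.1, a1.2, a2.1, a2.2]
  have hw : ∀ n, n + 1 ≤ I → |u (n+1) - (u 1 + (n:ℝ) * (u 2 - u 1))| ≤ (n:ℝ)^2 * η := by
    intro n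
    induction n with
    | zero => intro _; simp
    | succ n ih =>
      intro hn
      have a1 := abs_le.1 (ih (by omega))
      have a2 := hd n (by omega)
      have a3 := abs_le.1 a2
      have a4 : 0 ≤ (n:ℝ) * η := le_trans (abs_nonneg _) a2
      rw [abs_le]
      push_cast
      constructor <;> nlinarith [a1.1, a1.2, a3.1, a3.2]
  intro k k1 kI
  have := hw (k-1) (by omega)
  rw [show k - 1 + 1 = k by omega, Nat.cast_sub k1, Nat.cast_one] at this
  refine this.trans (mul_le_mul_of_nonneg_right ?_ hη)
  have : (1:ℝ) ≤ k := by exact_mod_cast k1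
  nlinarith

noncomputable def cphi (a x : ℝ) : ℝ :=
  x * (Real.log x - Real.log a) - (1 + x) * (Real.log (1 + x) - Real.log (1 + a))

lemma cphi_deriv (a : ℝ) {x : ℝ} (hx : 0 < x) :
    HasDerivAt (cphi a) (cpsi a - cpsi x) x := by
  have h1 : HasDerivAt (fun y : ℝ => 1 + y) 1 x := by simpa using (hasDerivAt_id x).const_add 1
  have h2 := (hasDerivAt_id x).mul ((Real.hasDerivAt_log hx.ne').sub_const (Real.log a))
  have h3 := h1.mul ((h1.log (by positivity)).sub_const (Real.log (1 + a)))
  refine (h2.sub h3).congr_deriv ?_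
  unfold cpsi
  simp only [id]
  have : 1 + x ≠ 0 := by positivity
  field_simp
  ring

lemma cpsi_mono {a x M : ℝ} (ha : 0 < a) (hx : 0 < x) (haM : a ≤ M) (hxM : x ≤ M) :
    (x - a)^2 / (M * (1 + M)) ≤ (x - a) * (cpsi a - cpsi x) := by
  have hM : 0 < M := by linarith
  have h := log_ineq_s16 (X := x * (1 + a)) (Y := a * (1 + x)) (B := M * (1 + M)) (by positivity)
    (by positivity) (by gcongr) (by gcongr)
  rw [Real.log_mul (by positivity) (by positivity), Real.log_mul (by positivity) (by positivity)] at h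
  unfold cpsi
  calc _ = (x * (1 + a) - a * (1 + x)) ^ 2 / (M * (1 + M)) := by ring
    _ ≤ _ := h
    _ = _ := by ring

lemma cphi_lower {a x M : ℝ} (ha : 0 < a) (hx : 0 < x) (haM : a ≤ M) (hxM : x ≤ M) :
    (x - a)^2 / (2 * (M * (1 + M))) ≤ cphi a x := by
  have hM : 0 < M := by linarith
  set B := M * (1 + M) with hB
  have hBp : 0 < B := by positivity
  set q : ℝ → ℝ := fun y => cphi a y - (y - a)^2 / (2 * B) with hq
  have hd : ∀ y, 0 < y → HasDerivAt q (cpsi a - cpsi y - (y - a) / B) y := by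
    intro y hy
    have h1 : HasDerivAt (fun y : ℝ => (y - a)^2 / (2 * B)) ((y - a) / B) y := by
      have := (((hasDerivAt_id y).sub_const a).pow 2).div_const (2 * B)
      refine this.congr_deriv ?_
      simp
      field_simp
    exact (cphi_deriv a hy).sub h1
  have hqa : q a = 0 := by simp [hq, cphi]
  have hs : ∀ y, 0 < y → y ≤ M → 0 ≤ (y - a) * (cpsi a - cpsi y - (y - a) / B) := by
    intro y hy hyM
    have := cpsi_mono ha hy haM hyM
    rw [← hB] at this
    calc (0:ℝ) ≤ (y - a) * (cpsi a - cpsi y) - (y-a)^2 / B := by linarith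
      _ = _ := by ring
  suffices 0 ≤ q x by simp only [hq] at this; linarith
  rcases lt_trichotomy a x with h | h | h
  · obtain ⟨c, hc, hc'⟩ := exists_hasDerivAt_eq_slope q _ h
      (fun y hy => (hd y (by linarith [hy.1])).continuousAt.continuousWithinAt)
      (fun y hy => hd y (by linarith [hy.1]))
    have := hs c (by linarith [hc.1]) (by linarith [hc.2])
    rw [hc', hqa, sub_zero] at this
    have h3 : 0 ≤ q x / (x - a) := nonneg_of_mul_nonneg_right this (by linarith [hc.1])
    have := (div_nonneg_iff.1 h3)
    rcases this with h' | h'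
    · exact h'.1
    · linarith [h'.2]
  · rw [← h, hqa]
  · obtain ⟨c, hc, hc'⟩ := exists_hasDerivAt_eq_slope q _ h
      (fun y hy => (hd y (by linarith [hy.1])).continuousAt.continuousWithinAt)
      (fun y hy => hd y (by linarith [hy.1]))
    have := hs c (by linarith [hc.1]) (by linarith [hc.2])
    rw [hc', hqa, zero_sub] at this
    have h4 : 0 ≤ (a - c) * (q x / (a - x)) := by
      calc _ ≤ _ := this
        _ = _ := by ring
    have h3 : 0 ≤ q x / (a - x) := nonneg_of_mul_nonneg_right h4 (by linarith [hc.2])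
    have := (div_nonneg_iff.1 h3)
    rcases this with h' | h'
    · exact h'.1
    · linarith [h'.2]

lemma cphi_nonneg {a x : ℝ} (ha : 0 < a) (hx : 0 < x) : 0 ≤ cphi a x := by
  have := cphi_lower ha hx (le_max_left a x) (le_max_right a x)
  have h : 0 < max a x := lt_max_of_lt_left ha
  exact le_trans (by positivity) this

lemma cphi_upper {a x : ℝ} (ha : 0 < a) (hx : 0 < x) :
    cphi a x ≤ (x - a) * (cpsi a - cpsi x) := by
  have := cphi_nonneg hx ha
  unfold cphi cpsi at *
  linarith

lemma coercive (I : ℕ) (M δ : ℝ) (hδ : 0 < δ) (hM : 0 < M) :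
    ∃ C > 0, ∀ F G : ℕ → ℝ, (∀ k ∈ Finset.Icc 1 I, δ ≤ F k ∧ F k ≤ M) →
      (∀ k ∈ Finset.Icc 1 I, 0 < G k ∧ G k ≤ M) →
      (∀ p q : ℝ, ∑ k ∈ Finset.Icc 1 I, (F k - G k) * (p + q * (k:ℝ)) = 0) →
      (∃ p q : ℝ, ∀ k ∈ Finset.Icc 1 I, cpsi (G k) = p + q * (k:ℝ)) →
      ∑ k ∈ Finset.Icc 1 I, cphi (G k) (F k) ≤ C * cP I F := by
  set B := M * (1 + M) with hB
  have hBp : 0 < B := by positivity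
  refine ⟨B * (∑ k ∈ Finset.Icc 1 I, ((k:ℝ)^2)^2 / δ^4) + 1,
    by have : 0 ≤ ∑ k ∈ Finset.Icc 1 I, ((k:ℝ)^2)^2 / δ^4 := Finset.sum_nonneg fun _ _ => by positivity
       positivity, ?_⟩
  rintro F G hF hG hcons ⟨p, q, hpq⟩
  have hPn := cP_nonneg I F
  set η := Real.sqrt (cP I F) / δ^2 with hη
  have hη0 : 0 ≤ η := by positivity
  have hη2 : η^2 = cP I F / δ^4 := by
    rw [hη, div_pow, Real.sq_sqrt hPn]; ring
  have hsd := second_diff I (fun k => cpsi (F k)) η hη0 (by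
    intro k k2 kI
    have hk : k ∈ Finset.Icc 1 I := by simp; omega
    have hk1 : k - 1 ∈ Finset.Icc 1 I := by simp; omega
    have hk2 : k + 1 ∈ Finset.Icc 1 I := by simp; omega
    have a1 := (hF k hk).1
    have a2 := (hF _ hk1).1
    have a3 := (hF _ hk2).1
    have b1 : 0 < F k := by linarith
    have b2 : 0 < F (k-1) := by linarith
    have b3 : 0 < F (k+1) := by linarith
    rw [cpsi_comb F b1 b1 b2 b3]
    have c1 : δ^2 ≤ (F k + 1) * (F k + 1) * F (k - 1) * F (k + 1) := by
      calc δ^2 = 1 * 1 * δ * δ := by ring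
        _ ≤ _ := by gcongr <;> linarith
    have c2 : δ^2 ≤ F k * F k * (F (k - 1) + 1) * (F (k + 1) + 1) := by
      calc δ^2 = δ * δ * 1 * 1 := by ring
        _ ≤ _ := by gcongr <;> linarith
    refine (log_ineq' (by positivity) c1 c2).trans ?_
    rw [hη]
    gcongr
    refine Real.abs_le_sqrt ?_
    exact cR_le_cP I F hk hk hk1 hk2 (by omega))
  set w : ℕ → ℝ := fun k => cpsi (F k) - (cpsi (F 1) + ((k:ℝ) - 1) * (cpsi (F 2) - cpsi (F 1))) with hw
  have hw2 : ∀ k ∈ Finset.Icc 1 I, (w k)^2 ≤ ((k:ℝ)^2)^2 / δ^4 * cP I F := by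
    intro k hk
    rw [Finset.mem_Icc] at hk
    have := hsd k hk.1 hk.2
    calc (w k)^2 = |w k|^2 := (sq_abs _).symm
      _ ≤ ((k:ℝ)^2 * η)^2 := by gcongr
      _ = ((k:ℝ)^2)^2 * η^2 := by ring
      _ = _ := by rw [hη2]; ring
  set Q := ∑ k ∈ Finset.Icc 1 I, (F k - G k) * (cpsi (G k) - cpsi (F k)) with hQ
  have hQ1 : Q = ∑ k ∈ Finset.Icc 1 I, (F k - G k) * (- w k) := by
    have e1 := hcons (p - cpsi (F 1) + (cpsi (F 2) - cpsi (F 1))) (q - (cpsi (F 2) - cpsi (F 1)))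
    rw [hQ, ← sub_eq_zero, ← Finset.sum_sub_distrib, ← e1]
    refine Finset.sum_congr rfl fun k hk => ?_
    rw [hpq k hk, hw]; ring
  have hQ2 : Q ≤ ∑ k ∈ Finset.Icc 1 I, (((F k - G k) * (cpsi (G k) - cpsi (F k))) / 2
      + B / 2 * (((k:ℝ)^2)^2 / δ^4 * cP I F)) := by
    rw [hQ1]
    refine Finset.sum_le_sum fun k hk => ?_
    have h1 := cpsi_mono (hG k hk).1 (lt_of_lt_of_le hδ (hF k hk).1) (hG k hk).2 (hF k hk).2
    rw [← hB] at h1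
    have h2 := hw2 k hk
    have h3 : (F k - G k) * (- w k) ≤ (F k - G k)^2 / B / 2 + B / 2 * (w k)^2 := by
      have : 0 ≤ ((F k - G k) / B + w k)^2 * (B / 2) := by positivity
      have e : ((F k - G k) / B + w k)^2 * (B / 2) = (F k - G k)^2 / B / 2 + B / 2 * (w k)^2
        - (F k - G k) * (- w k) := by field_simp; ring
      linarith
    have h4 : B / 2 * (w k)^2 ≤ B / 2 * (((k:ℝ)^2)^2 / δ^4 * cP I F) := by gcongr
    linarith
  rw [Finset.sum_add_distrib, ← Finset.sum_div, ← hQ, ← Finset.mul_sum, ← Finset.sum_mul] at hQ2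
  have hQ3 : ∑ k ∈ Finset.Icc 1 I, cphi (G k) (F k) ≤ Q :=
    Finset.sum_le_sum fun k hk => cphi_upper (hG k hk).1 (lt_of_lt_of_le hδ (hF k hk).1)
  nlinarith

lemma mono_Ici {f f' : ℝ → ℝ} (h : ∀ t ∈ Set.Ici (0:ℝ), HasDerivWithinAt f (f' t) (Set.Ici 0) t)
    (h0 : ∀ t ∈ Set.Ici (0:ℝ), 0 ≤ f' t) {t : ℝ} (ht : t ∈ Set.Ici (0:ℝ)) : f 0 ≤ f t := by
  have hm : MonotoneOn f (Set.Ici 0) := by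
    refine monotoneOn_of_hasDerivWithinAt_nonneg (convex_Ici 0)
      (fun t ht => (h t ht).continuousWithinAt) (f' := f')
      (fun t ht => (h t (interior_subset ht)).mono interior_subset)
      (fun t ht => h0 t (interior_subset ht))
  exact hm (Set.mem_Ici.2 le_rfl) ht ht

lemma ch_bound {x : ℝ} (hx : 0 < x) :
    (1 + x) * Real.log (1 + x) - x * Real.log x ≤ x + 1 := by
  have h1 := Real.log_le_sub_one_of_pos (show 0 < 1 + x by positivity)
  have h2 := Real.log_le_sub_one_of_pos (show 0 < (1 + x) / x by positivity)
  rw [Real.log_div (by positivity) (by positivity)] at h2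
  have h3 : x * (Real.log (1 + x) - Real.log x) ≤ x * ((1 + x) / x - 1) := by gcongr
  have h4 : x * ((1 + x) / x - 1) = 1 := by field_simp; ring
  linarith

lemma ch_deriv {x : ℝ} (hx : 0 < x) :
    HasDerivAt (fun x : ℝ => (1 + x) * Real.log (1 + x) - x * Real.log x) (cpsi x) x := by
  have h1 : HasDerivAt (fun y : ℝ => 1 + y) 1 x := by simpa using (hasDerivAt_id x).const_add 1
  have h2 := (hasDerivAt_id x).mul (Real.hasDerivAt_log hx.ne')
  have h3 := h1.mul (h1.log (by positivity))
  refine (h3.sub h2).congr_deriv ?_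
  unfold cpsi
  simp only [id]
  have : 1 + x ≠ 0 := by positivity
  field_simp
  ring

/-- Exponential convergence to equilibrium for the discrete `C₂₂` system: the
equilibrium `F*_k = 1/(e^{ρ₂(k−1) − ρ₁(k−2)} − 1)` has the same mass and energy
as the initial condition, and solutions converge to it exponentially fast. -/
theorem C22_convergence_to_equilibrium (I : ℕ) (hI : 3 ≤ I) (K : ℕ → ℕ → ℕ → ℕ → ℝ)
    (hKpos : ∀ a b c d, 0 < K a b c d)
    (hKsymm : ∀ a b c d, K a b c d = K b a c d ∧ K a b c d = K a c b d ∧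
      K a b c d = K a b d c)
    (F : ℝ → ℕ → ℝ)
    (hFpos : ∀ t ∈ Set.Ici (0 : ℝ), ∀ k ∈ Finset.Icc 1 I, 0 < F t k)
    (hF : ∀ t ∈ Set.Ici (0 : ℝ), ∀ k₁ ∈ Finset.Icc 1 I,
      HasDerivWithinAt (fun s => F s k₁) (C22 I K (F t) k₁) (Set.Ici 0) t) :
    ∃ ρ₁ ρ₂ : ℝ,
      (∀ k ∈ Finset.Icc 1 I, 0 < ρ₂ * ((k : ℝ) - 1) - ρ₁ * ((k : ℝ) - 2)) ∧
      (∑ k ∈ Finset.Icc 1 I,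
          1 / (Real.exp (ρ₂ * ((k : ℝ) - 1) - ρ₁ * ((k : ℝ) - 2)) - 1)
        = ∑ k ∈ Finset.Icc 1 I, F 0 k) ∧
      (∑ k ∈ Finset.Icc 1 I,
          (k : ℝ) / (Real.exp (ρ₂ * ((k : ℝ) - 1) - ρ₁ * ((k : ℝ) - 2)) - 1)
        = ∑ k ∈ Finset.Icc 1 I, (k : ℝ) * F 0 k) ∧
      ∃ C₁ > (0 : ℝ), ∃ C₂ > (0 : ℝ), ∀ t ∈ Set.Ici (0 : ℝ), ∀ k ∈ Finset.Icc 1 I,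
        |F t k - 1 / (Real.exp (ρ₂ * ((k : ℝ) - 1) - ρ₁ * ((k : ℝ) - 2)) - 1)|
          ≤ C₁ * Real.exp (-C₂ * t) := by

  set S := Finset.Icc 1 I with hS
  set m := ∑ k ∈ S, F 0 k with hm
  set e := ∑ k ∈ S, (k:ℝ) * F 0 k with he
  have z0 : (0:ℝ) ∈ Set.Ici (0:ℝ) := Set.mem_Ici.2 le_rfl
  -- conservation
  have hcons : ∀ p q : ℝ, ∀ t ∈ Set.Ici (0:ℝ),
      ∑ k ∈ S, (p + q * (k:ℝ)) * F t k = ∑ k ∈ S, (p + q * (k:ℝ)) * F 0 k := by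
    have half : ∀ p q : ℝ, ∀ t ∈ Set.Ici (0:ℝ),
        ∑ k ∈ S, (p + q * (k:ℝ)) * F 0 k ≤ ∑ k ∈ S, (p + q * (k:ℝ)) * F t k := by
      intro p q t ht
      refine mono_Ici (f := fun t => ∑ k ∈ S, (p + q * (k:ℝ)) * F t k)
        (f' := fun t => ∑ k ∈ S, (p + q * (k:ℝ)) * C22 I K (F t) k) ?_ ?_ ht
      · intro t ht
        exact HasDerivWithinAt.fun_sum fun k hk => (hF t ht k hk).const_mul _
      · intro t _
        exact (c22_lin I K hKsymm (F t) p q).ge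
    intro p q t ht
    refine le_antisymm ?_ (half p q t ht)
    have := half (-p) (-q) t ht
    have e1 : ∀ s, ∑ k ∈ S, (-p + -q * (k:ℝ)) * F s k = - ∑ k ∈ S, (p + q * (k:ℝ)) * F s k := by
      intro s
      rw [← Finset.sum_neg_distrib]
      exact Finset.sum_congr rfl fun k _ => by ring
    rw [e1, e1] at this
    linarith
  have hmass : ∀ t ∈ Set.Ici (0:ℝ), ∑ k ∈ S, F t k = m := by
    intro t ht
    simpa using hcons 1 0 t ht
  have hen : ∀ t ∈ Set.Ici (0:ℝ), ∑ k ∈ S, (k:ℝ) * F t k = e := by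
    intro t ht
    simpa using hcons 0 1 t ht
  have h1S : 1 ∈ S := by simp [hS]; omega
  have hIS : I ∈ S := by simp [hS]; omega
  have hmpos : 0 < m := Finset.sum_pos (hFpos 0 z0) ⟨1, h1S⟩
  have hme : m < e := by
    refine Finset.sum_lt_sum (fun k hk => ?_) ⟨I, hIS, ?_⟩
    · have := hFpos 0 z0 k hk
      have h1 : (1:ℝ) ≤ k := by exact_mod_cast (Finset.mem_Icc.1 hk).1
      nlinarith
    · have := hFpos 0 z0 I hIS
      have h1 : (3:ℝ) ≤ I := by exact_mod_cast hI
      nlinarith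
  have heI : e < I * m := by
    rw [hm, Finset.mul_sum]
    refine Finset.sum_lt_sum (fun k hk => ?_) ⟨1, h1S, ?_⟩
    · have := hFpos 0 z0 k hk
      have h1 : (k:ℝ) ≤ I := by exact_mod_cast (Finset.mem_Icc.1 hk).2
      nlinarith
    · have := hFpos 0 z0 1 h1S
      have h1 : (3:ℝ) ≤ I := by exact_mod_cast hI
      push_cast
      nlinarith
  have hFM : ∀ t ∈ Set.Ici (0:ℝ), ∀ k ∈ S, 0 < F t k ∧ F t k ≤ m := fun t ht k hk =>
    ⟨hFpos t ht k hk, (hmass t ht) ▸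
      Finset.single_le_sum (f := F t) (fun j hj => (hFpos t ht j hj).le) hk⟩
  obtain ⟨C, hC, hdiss⟩ := diss_lower I K hKpos hKsymm m hmpos
  -- existence of an equilibrium
  obtain ⟨G, hG0, hGm, hGe, hGP⟩ : ∃ G : ℕ → ℝ, (∀ k ∈ S, 0 ≤ G k) ∧ ∑ k ∈ S, G k = m ∧
      ∑ k ∈ S, (k:ℝ) * G k = e ∧ cP I G = 0 := by
    by_contra! hcon
    obtain ⟨ε, hε, hlow⟩ := compact_lower I m e (cP I) (cP_cont I) (cP_congr I)
      (fun f h0 h1 h2 => lt_of_le_of_ne (cP_nonneg I f) (hcon f h0 h1 h2).symm)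
    set h : ℝ → ℝ := fun x : ℝ => (1 + x) * Real.log (1 + x) - x * Real.log x with hh
    have hmono : ∀ t ∈ Set.Ici (0:ℝ), ∑ k ∈ S, h (F 0 k) - C * ε * 0 ≤
        ∑ k ∈ S, h (F t k) - C * ε * t := by
      intro t ht
      refine mono_Ici (f := fun t => ∑ k ∈ S, h (F t k) - C * ε * t)
        (f' := fun t => ∑ k ∈ S, cpsi (F t k) * C22 I K (F t) k - C * ε * 1) ?_ ?_ ht
      · intro t ht
        refine HasDerivWithinAt.sub (HasDerivWithinAt.fun_sum fun k hk => ?_)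
          ((hasDerivWithinAt_id _ _).const_mul _)
        exact (ch_deriv (hFpos t ht k hk)).comp_hasDerivWithinAt t (hF t ht k hk)
      · intro t ht
        have h1 := hdiss (F t) (hFM t ht)
        have h2 := hlow (F t) (fun k hk => (hFpos t ht k hk).le) (hmass t ht) (hen t ht)
        have h3 : C * ε ≤ C * cP I (F t) := by gcongr
        linarith
    have hbd : ∀ t ∈ Set.Ici (0:ℝ), ∑ k ∈ S, h (F t k) ≤ m + S.card := by
      intro t ht
      calc _ ≤ ∑ k ∈ S, (F t k + 1) := Finset.sum_le_sum fun k hk => ch_bound (hFpos t ht k hk)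
        _ = _ := by rw [Finset.sum_add_distrib, hmass t ht]; simp
    have hb0 := hbd 0 z0
    set T := (m + S.card - ∑ k ∈ S, h (F 0 k) + 1) / (C * ε) with hT
    have hTm : T ∈ Set.Ici (0:ℝ) := by
      rw [Set.mem_Ici, hT]
      refine div_nonneg (by linarith) (by positivity)
    have a1 := hmono T hTm
    have a2 := hbd T hTm
    have a3 : C * ε * T = m + S.card - ∑ k ∈ S, h (F 0 k) + 1 := by
      rw [hT]; field_simp
    linarith
  have hGpos := pos_of_zero I hI m e hme heI G hG0 hGm hGe hGP
  have hGM : ∀ k ∈ S, 0 < G k ∧ G k ≤ m := fun k hk =>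
    ⟨hGpos k hk, hGm ▸ Finset.single_le_sum (f := G) hG0 hk⟩
  have hlin : ∀ k ∈ S, cpsi (G k) =
      cpsi (G 2) * ((k:ℝ) - 1) - cpsi (G 1) * ((k:ℝ) - 2) := by
    intro k hk
    have := second_diff I (fun k => cpsi (G k)) 0 le_rfl (by
      intro k k2 kI
      have hk : k ∈ Finset.Icc 1 I := by simp; omega
      have hk1 : k - 1 ∈ Finset.Icc 1 I := by simp; omega
      have hk2 : k + 1 ∈ Finset.Icc 1 I := by simp; omega
      have h1 := cR_le_cP I G hk hk hk1 hk2 (by omega)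
      rw [hGP] at h1
      have h0 : cR G k k (k-1) (k+1) = 0 := by nlinarith
      unfold cR at h0
      rw [cpsi_comb G (hGpos _ hk) (hGpos _ hk) (hGpos _ hk1) (hGpos _ hk2), sub_eq_zero.1 h0]
      simp) k (Finset.mem_Icc.1 hk).1 (Finset.mem_Icc.1 hk).2
    rw [mul_zero] at this
    have := abs_eq_zero.1 (le_antisymm this (abs_nonneg _))
    linarith
  have hGval : ∀ k ∈ S, Real.exp (cpsi (G k)) - 1 = 1 / G k := by
    intro k hk
    have := hGpos k hk
    unfold cpsi
    rw [Real.exp_sub, Real.exp_log this, Real.exp_log (by positivity)]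
    field_simp
    ring
  have hGone : ∀ k ∈ S, 1 / (Real.exp (cpsi (G 2) * ((k:ℝ) - 1) - cpsi (G 1) * ((k:ℝ) - 2)) - 1)
      = G k := by
    intro k hk
    rw [← hlin k hk, hGval k hk, one_div_one_div]
  refine ⟨cpsi (G 1), cpsi (G 2), ?_, ?_, ?_, ?_⟩
  · intro k hk
    rw [← hlin k hk]
    have := hGpos k hk
    exact sub_pos.2 (Real.log_lt_log this (by linarith))
  · rw [Finset.sum_congr rfl hGone, hGm]
  · rw [← hGe]
    refine Finset.sum_congr rfl fun k hk => ?_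
    rw [← hGone k hk]
    ring
  -- exponential decay
  have hδ : ∃ δ > 0, ∀ k ∈ S, ∀ f : ℕ → ℝ, (∀ k ∈ S, 0 ≤ f k) → ∑ k ∈ S, f k = m →
      ∑ k ∈ S, (k:ℝ) * f k = e → 2 * δ ≤ cP I f + f k := by
    have hex : ∀ k : ℕ, ∃ ε > 0, k ∈ S → ∀ f : ℕ → ℝ, (∀ k ∈ S, 0 ≤ f k) → ∑ k ∈ S, f k = m →
        ∑ k ∈ S, (k:ℝ) * f k = e → ε ≤ cP I f + f k := by
      intro k
      by_cases hk : k ∈ S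
      · obtain ⟨ε, hε, h⟩ := compact_lower I m e (fun f => cP I f + f k)
          ((cP_cont I).add (continuous_apply k))
          (fun f g h => by rw [cP_congr I f g h, h k hk])
          (fun f h0 h1 h2 => by
            rcases (cP_nonneg I f).eq_or_lt with h | h
            · have := pos_of_zero I hI m e hme heI f h0 h1 h2 h.symm k hk
              linarith
            · have := h0 k hk
              linarith)
        exact ⟨ε, hε, fun _ => h⟩
      · exact ⟨1, one_pos, fun h => absurd h hk⟩
    choose ε hε hb using hex
    obtain ⟨j, hj, hmin⟩ := Finset.exists_min_image S ε ⟨1, h1S⟩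
    refine ⟨ε j / 2, half_pos (hε j), fun k hk f h0 h1 h2 => ?_⟩
    have a1 := hb k hk f h0 h1 h2
    have a2 := hmin k hk
    linarith
  obtain ⟨δ, hδ, hδb⟩ := hδ
  obtain ⟨C2, hC2, hco⟩ := coercive I m δ hδ hmpos
  set E : ℝ → ℝ := fun t => ∑ k ∈ S, cphi (G k) (F t k) with hE
  set E' : ℝ → ℝ := fun t => ∑ k ∈ S, (cpsi (G k) - cpsi (F t k)) * C22 I K (F t) k with hE'
  have hlin2 : ∀ k ∈ S, cpsi (G k) = (2 * cpsi (G 1) - cpsi (G 2)) +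
      (cpsi (G 2) - cpsi (G 1)) * (k:ℝ) := by
    intro k hk
    rw [hlin k hk]; ring
  have hEd : ∀ t ∈ Set.Ici (0:ℝ), HasDerivWithinAt E (E' t) (Set.Ici 0) t := by
    intro t ht
    refine HasDerivWithinAt.fun_sum fun k hk => ?_
    exact (cphi_deriv (G k) (hFpos t ht k hk)).comp_hasDerivWithinAt t (hF t ht k hk)
  have hE'b : ∀ t ∈ Set.Ici (0:ℝ), E' t ≤ - (C * cP I (F t)) := by
    intro t ht
    have h1 := hdiss (F t) (hFM t ht)
    have h2 := c22_lin I K hKsymm (F t) (2 * cpsi (G 1) - cpsi (G 2)) (cpsi (G 2) - cpsi (G 1))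
    have h3 : E' t = 0 - ∑ k ∈ S, cpsi (F t k) * C22 I K (F t) k := by
      rw [← h2, hE']
      rw [← Finset.sum_sub_distrib]
      refine Finset.sum_congr rfl fun k hk => ?_
      rw [← hlin2 k hk]; ring
    linarith
  have hE0 : ∀ t ∈ Set.Ici (0:ℝ), 0 ≤ E t := fun t ht =>
    Finset.sum_nonneg fun k hk => cphi_nonneg (hGpos k hk) (hFpos t ht k hk)
  have hEle : ∀ t ∈ Set.Ici (0:ℝ), E t ≤ E 0 := by
    intro t ht
    have := mono_Ici (f := fun t => - E t) (f' := fun t => - E' t)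
      (fun t ht => (hEd t ht).neg) (fun t ht => by
        have h1 := hE'b t ht
        have h2 : 0 ≤ C * cP I (F t) := mul_nonneg hC.le (cP_nonneg I _)
        linarith) ht
    linarith
  have hE00 := hE0 0 z0
  set A := C2 + E 0 / δ with hA
  have hApos : 0 < A := by positivity
  have hEA : ∀ t ∈ Set.Ici (0:ℝ), E t ≤ A * cP I (F t) := by
    intro t ht
    have hPn := cP_nonneg I (F t)
    by_cases hc : ∀ k ∈ S, δ ≤ F t k
    · have := hco (F t) G (fun k hk => ⟨hc k hk, (hFM t ht k hk).2⟩) hGM (by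
        intro p q
        have e1 : ∀ f : ℕ → ℝ, ∑ k ∈ S, f k * (p + q * (k:ℝ)) =
            p * ∑ k ∈ S, f k + q * ∑ k ∈ S, (k:ℝ) * f k := by
          intro f
          rw [Finset.mul_sum, Finset.mul_sum, ← Finset.sum_add_distrib]
          exact Finset.sum_congr rfl fun k _ => by ring
        simp only [sub_mul, Finset.sum_sub_distrib]
        rw [e1, e1, hGm, hGe, hmass t ht, hen t ht, sub_self]) ⟨_, _, hlin2⟩
      refine this.trans ?_
      gcongr
      rw [hA]
      have : 0 ≤ E 0 / δ := by positivity
      linarith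
    · push Not at hc
      obtain ⟨k, hk, hlt⟩ := hc
      have h1 := hδb k hk (F t) (fun k hk => (hFpos t ht k hk).le) (hmass t ht) (hen t ht)
      have h2 : δ ≤ cP I (F t) := by linarith
      calc E t ≤ E 0 := hEle t ht
        _ = E 0 / δ * δ := by field_simp
        _ ≤ A * cP I (F t) := by
          gcongr
          rw [hA]; linarith
  set l := C / A with hl
  have hlpos : 0 < l := by positivity
  have hdecay : ∀ t ∈ Set.Ici (0:ℝ), E t ≤ E 0 * Real.exp (-l * t) := by
    intro t ht
    have := mono_Ici (f := fun t => - (Real.exp (l * t) * E t))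
      (f' := fun t => - (Real.exp (l * t) * (l * 1) * E t + Real.exp (l * t) * E' t))
      (fun t ht => ((((hasDerivWithinAt_id t _).const_mul l).exp).mul (hEd t ht)).neg)
      (fun t ht => by
        have h1 := hE'b t ht
        have h2 : l * E t ≤ l * (A * cP I (F t)) := by gcongr; exact hEA t ht
        have h3 : l * (A * cP I (F t)) = C * cP I (F t) := by rw [hl]; field_simp
        have h4 : 0 ≤ Real.exp (l * t) * (- (l * E t + E' t)) :=
          mul_nonneg (Real.exp_pos _).le (by linarith)
        linarith) ht
    simp only [mul_zero, Real.exp_zero, one_mul] at this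
    have h1 : Real.exp (l * t) * E t ≤ E 0 := by linarith
    calc E t = (Real.exp (l * t) * E t) * Real.exp (-l * t) := by
          rw [mul_right_comm, ← Real.exp_add]; simp
      _ ≤ _ := by gcongr
  set B := 2 * (m * (1 + m)) with hB
  have hBpos : 0 < B := by positivity
  refine ⟨Real.sqrt (B * E 0) + 1, by positivity, l / 2, by positivity, fun t ht k hk => ?_⟩
  rw [hGone k hk]
  have h1 := cphi_lower (hGM k hk).1 (hFM t ht k hk).1 (hGM k hk).2 (hFM t ht k hk).2
  have h2 : cphi (G k) (F t k) ≤ E t :=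
    Finset.single_le_sum (f := fun k => cphi (G k) (F t k))
      (fun k hk => cphi_nonneg (hGpos k hk) (hFpos t ht k hk)) hk
  have h3 := (h1.trans h2).trans (hdecay t ht)
  rw [← hB, div_le_iff₀ hBpos] at h3
  have h4 : |F t k - G k| ≤ Real.sqrt (B * E 0) * Real.exp (-(l/2) * t) := by
    refine abs_le_of_sq_le_sq ?_ (by positivity)
    rw [mul_pow, Real.sq_sqrt (by positivity), ← Real.exp_nat_mul]
    refine h3.trans (le_of_eq ?_)
    rw [show ((2:ℕ):ℝ) * (-(l/2) * t) = -l * t by push_cast; ring]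
    ring
  refine h4.trans ?_
  gcongr
  linarith
end

section
/- Let F : [0,∞) → (0,∞)^I be a solution of the combined system dF_{k₁}/dt = 𝒞₁₂[F](k₁) + 𝒞₂₂[F](k₁), k₁ ∈ 𝕀, with I ≥ 3. Then there exist a constant ρ > 0 and constants C₁, C₂ > 0 such that Σ_{k=1}^I k/(e^{ρk} − 1) = Σ_{k=1}^I k·F_k(0) and max_{1≤k≤I} |F_k(t) − 1/(e^{ρk} − 1)| ≤ C₁ e^{−C₂ t} for all t ≥ 0; that is, F(t) converges exponentially fast to the equilibrium F*_k = 1/(e^{ρk} − 1) having the same energy as the initial condition. -/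
/-- The right-hand side of the discrete `C₁₂` collision operator for `k₁ ∈ {1,…,I}`. -/
noncomputable def C12 (I : ℕ) (K : ℕ → ℕ → ℕ → ℝ) (F : ℕ → ℝ) (k₁ : ℕ) : ℝ :=
  (∑ k₂ ∈ Finset.Icc 1 I, ∑ k₃ ∈ Finset.Icc 1 I,
    if k₂ + k₃ = k₁ then
      K k₁ k₂ k₃ * ((F k₁ + 1) * F k₂ * F k₃ - F k₁ * (F k₂ + 1) * (F k₃ + 1))
    else 0)
  - 2 * (∑ k₂ ∈ Finset.Icc 1 I, ∑ k₃ ∈ Finset.Icc 1 I,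
    if k₁ + k₃ = k₂ then
      K k₂ k₁ k₃ * ((F k₂ + 1) * F k₁ * F k₃ - F k₂ * (F k₁ + 1) * (F k₃ + 1))
    else 0)

namespace CC

lemma unif_min (s : Finset ℕ) (f : ℕ → ℝ) (h : ∀ k ∈ s, 0 < f k) :
    ∃ m > 0, ∀ k ∈ s, m ≤ f k := by
  induction s using Finset.induction_on with
  | empty => exact ⟨1, one_pos, by simp⟩
  | insert a s ha ih =>
    obtain ⟨m, hm, hm'⟩ := ih (fun k hk => h k (Finset.mem_insert_of_mem hk))
    refine ⟨min m (f a), lt_min hm (h a (Finset.mem_insert_self _ _)), ?_⟩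
    intro k hk
    rcases Finset.mem_insert.1 hk with rfl | hk
    · exact min_le_right _ _
    · exact (min_le_left _ _).trans (hm' k hk)

lemma gronwall (f f' : ℝ → ℝ) (α M : ℝ) (hM : 0 < M)
    (hf : ∀ t ∈ Set.Ici (0 : ℝ), HasDerivWithinAt f (f' t) (Set.Ici 0) t)
    (h : ∀ t ∈ Set.Ici (0 : ℝ), α - M * f t ≤ f' t) :
    ∀ t ∈ Set.Ici (0 : ℝ), (f 0 - α / M) * Real.exp (-M * t) ≤ f t - α / M := by
  have hd : ∀ t ∈ Set.Ici (0 : ℝ), HasDerivWithinAt (fun s => (f s - α / M) * Real.exp (M * s))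
      (f' t * Real.exp (M * t) + (f t - α / M) * (Real.exp (M * t) * M)) (Set.Ici 0) t := by
    intro t ht
    have h1 : HasDerivWithinAt (fun s => Real.exp (M * s)) (Real.exp (M * t) * M) (Set.Ici 0) t := by
      have := ((hasDerivAt_id t).const_mul M).exp
      simpa using this.hasDerivWithinAt
    exact ((hf t ht).sub_const _).mul h1
  have hmono : MonotoneOn (fun s => (f s - α / M) * Real.exp (M * s)) (Set.Ici 0) := by
    apply monotoneOn_of_hasDerivWithinAt_nonneg (convex_Ici 0)
      (f' := fun t => f' t * Real.exp (M * t) + (f t - α / M) * (Real.exp (M * t) * M))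
    · exact fun t ht => (hd t ht).continuousWithinAt
    · intro t ht
      exact (hd t (interior_subset ht)).mono interior_subset
    · intro t ht
      have := h t (interior_subset ht)
      have e : f' t * Real.exp (M * t) + (f t - α / M) * (Real.exp (M * t) * M)
        = Real.exp (M * t) * (f' t - (α - M * f t)) := by field_simp; ring
      rw [e]
      exact mul_nonneg (Real.exp_pos _).le (by linarith)
  intro t ht
  have := hmono (Set.mem_Ici.2 le_rfl) ht ht
  simp only [mul_zero, Real.exp_zero, mul_one] at this
  calc (f 0 - α / M) * Real.exp (-M * t) ≤ ((f t - α / M) * Real.exp (M * t)) * Real.exp (-M * t) :=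
        mul_le_mul_of_nonneg_right this (Real.exp_pos _).le
    _ = f t - α / M := by
        rw [mul_assoc, ← Real.exp_add]; simp

lemma lower (f f' : ℝ → ℝ) (α M : ℝ) (hM : 0 < M) (hα : 0 < α) (h0 : 0 < f 0)
    (hf : ∀ t ∈ Set.Ici (0 : ℝ), HasDerivWithinAt f (f' t) (Set.Ici 0) t)
    (h : ∀ t ∈ Set.Ici (0 : ℝ), α - M * f t ≤ f' t) :
    ∃ m > 0, ∀ t ∈ Set.Ici (0 : ℝ), m ≤ f t := by
  refine ⟨min (f 0) (α / M), lt_min h0 (by positivity), ?_⟩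
  intro t ht
  have h1 := gronwall f f' α M hM hf h t ht
  have h2 : Real.exp (-M * t) ≤ 1 := by
    rw [Real.exp_le_one_iff]
    have : 0 ≤ M * t := mul_nonneg hM.le ht
    linarith
  have h3 := Real.exp_pos (-M * t)
  rcases le_total (f 0) (α / M) with h4 | h4
  · refine (min_le_left _ _).trans ?_
    nlinarith
  · refine (min_le_right _ _).trans ?_
    nlinarith

lemma log_upper {A B : ℝ} (hA : 0 < A) (hB : 0 < B) :
    Real.log A - Real.log B ≤ (A - B) / B := by
  rw [← Real.log_div hA.ne' hB.ne']
  have := Real.log_le_sub_one_of_pos (div_pos hA hB)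
  have e : (A - B) / B = A / B - 1 := by field_simp
  rw [e]; exact this

lemma log_lower {A B : ℝ} (hA : 0 < A) (hB : 0 < B) :
    (A - B) / A ≤ Real.log A - Real.log B := by
  have := log_upper hB hA
  have e : (A - B) / A = - ((B - A) / A) := by ring
  rw [e]; linarith

lemma log_prod_aux {A B : ℝ} (hB : 0 < B) (h : B ≤ A) (μ M : ℝ) (hμ : 0 < μ)
    (hμB : μ ≤ B) (hAM : A ≤ M) :
    μ * (Real.log A - Real.log B) ^ 2 ≤ (A - B) * (Real.log A - Real.log B) ∧
    (A - B) ^ 2 / M ≤ (A - B) * (Real.log A - Real.log B) ∧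
    (A - B) * (Real.log A - Real.log B) ≤ (A - B) ^ 2 / μ := by
  have hA : 0 < A := hB.trans_le h
  have h1 := log_upper hA hB
  have h2 := log_lower hA hB
  have h0 : 0 ≤ A - B := by linarith
  have h3 : (A - B) / B ≤ (A - B) / μ := by gcongr
  have h4 : (A - B) / M ≤ (A - B) / A := by gcongr
  have h5 : 0 ≤ (A - B) / A := by positivity
  set l := Real.log A - Real.log B
  have h6 : μ * l ≤ A - B := by
    have : l ≤ (A - B) / μ := h1.trans h3
    rw [le_div_iff₀ hμ] at this; linarith
  refine ⟨?_, ?_, ?_⟩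
  · nlinarith
  · calc (A - B) ^ 2 / M = (A - B) * ((A - B) / M) := by ring
      _ ≤ _ := by gcongr; linarith
  · calc _ ≤ (A - B) * ((A - B) / μ) := by gcongr; linarith
      _ = _ := by ring

lemma log_prod {A B : ℝ} (μ M : ℝ) (hμ : 0 < μ) (hμA : μ ≤ A)
    (hμB : μ ≤ B) (hAM : A ≤ M) (hBM : B ≤ M) :
    μ * (Real.log A - Real.log B) ^ 2 ≤ (A - B) * (Real.log A - Real.log B) ∧
    (A - B) ^ 2 / M ≤ (A - B) * (Real.log A - Real.log B) ∧
    (A - B) * (Real.log A - Real.log B) ≤ (A - B) ^ 2 / μ := by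
  rcases le_total B A with h | h
  · exact log_prod_aux (hμ.trans_le hμB) h μ M hμ hμB hAM
  · have := log_prod_aux (hμ.trans_le hμA) h μ M hμ hμA hBM
    have e1 : (A - B) * (Real.log A - Real.log B) = (B - A) * (Real.log B - Real.log A) := by ring
    have e2 : (A - B) ^ 2 = (B - A) ^ 2 := by ring
    have e3 : (Real.log A - Real.log B) ^ 2 = (Real.log B - Real.log A) ^ 2 := by ring
    rw [e1, e2, e3]; exact this

lemma log_prod_nonneg {A B : ℝ} (hA : 0 < A) (hB : 0 < B) :
    0 ≤ (A - B) * (Real.log A - Real.log B) := by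
  have := (log_prod (min A B) (max A B) (lt_min hA hB) (min_le_left _ _) (min_le_right _ _)
    (le_max_left _ _) (le_max_right _ _)).1
  refine le_trans ?_ this
  have := (lt_min hA hB).le
  positivity

/-- relative entropy density -/
noncomputable def h (a y : ℝ) : ℝ :=
  y * Real.log y - (1 + y) * Real.log (1 + y) - y * (Real.log a - Real.log (1 + a))
    + Real.log (1 + a)

noncomputable def h' (a y : ℝ) : ℝ :=
  Real.log y - Real.log (1 + y) - (Real.log a - Real.log (1 + a))

lemma h_deriv {a y : ℝ} (hy : 0 < y) : HasDerivAt (h a) (h' a y) y := by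
  have h1 := Real.hasDerivAt_mul_log hy.ne'
  have h2 : HasDerivAt (fun y : ℝ => (1 + y) * Real.log (1 + y)) (Real.log (1 + y) + 1) y := by
    have := (Real.hasDerivAt_mul_log (x := 1 + y) (by positivity)).comp y
      ((hasDerivAt_id y).const_add 1)
    simpa [Function.comp_def] using this
  have h3 := (hasDerivAt_id y).mul_const (Real.log a - Real.log (1 + a))
  have := ((h1.sub h2).sub h3).add_const (Real.log (1 + a))
  refine HasDerivAt.congr_deriv (f := h a) this ?_
  simp only [h']; ring

lemma h_self {a : ℝ} : h a a = 0 := by simp [h]; ring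

lemma h'_bd {a y m E : ℝ} (hm : 0 < m) (ha : m ≤ a) (hy : m ≤ y) (haE : a ≤ E) (hyE : y ≤ E) :
    (y - a) ^ 2 / (E * (1 + E)) ≤ h' a y * (y - a) ∧ h' a y * (y - a) ≤ (y - a) ^ 2 / m := by
  have ha0 : 0 < a := by linarith
  have hy0 : 0 < y := by linarith
  have hE0 : 0 < E := by linarith
  have e : h' a y = Real.log (y * (1 + a)) - Real.log (a * (1 + y)) := by
    rw [Real.log_mul (by positivity) (by positivity), Real.log_mul (by positivity) (by positivity)]
    simp [h']; ring
  have := log_prod (A := y * (1 + a)) (B := a * (1 + y)) m (E * (1 + E)) hm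
    (by nlinarith) (by nlinarith) (by gcongr) (by gcongr)
  rw [← e] at this
  have e2 : y * (1 + a) - a * (1 + y) = y - a := by ring
  rw [e2] at this
  rw [mul_comm (h' a y)]
  exact this.2

lemma mvt_sq (f f' : ℝ → ℝ) (a y : ℝ)
    (hf : ∀ z, min a y ≤ z → z ≤ max a y → HasDerivAt f (f' z) z) :
    ∃ z, min a y ≤ z ∧ z ≤ max a y ∧ 0 ≤ (z - a) * (y - a) ∧ (z - a ≠ 0 ∨ y = a) ∧
      f y - f a = f' z * (y - a) := by
  rcases lt_trichotomy a y with hlt | heq | hlt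
  · rw [min_eq_left hlt.le, max_eq_right hlt.le] at *
    obtain ⟨c, hc, hc'⟩ := exists_hasDerivAt_eq_slope f f' hlt
      (fun z hz => (hf z hz.1 hz.2).continuousAt.continuousWithinAt)
      (fun z hz => hf z hz.1.le hz.2.le)
    refine ⟨c, hc.1.le, hc.2.le, mul_nonneg (by linarith [hc.1]) (by linarith),
      Or.inl (by linarith [hc.1] : 0 < c - a).ne', ?_⟩
    rw [hc', div_mul_cancel₀ _ (by linarith : 0 < y - a).ne']
  · subst heq
    exact ⟨a, by simp, by simp, by simp, Or.inr rfl, by simp⟩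
  · rw [min_eq_right hlt.le, max_eq_left hlt.le] at *
    obtain ⟨c, hc, hc'⟩ := exists_hasDerivAt_eq_slope f f' hlt
      (fun z hz => (hf z hz.1 hz.2).continuousAt.continuousWithinAt)
      (fun z hz => hf z hz.1.le hz.2.le)
    refine ⟨c, hc.1.le, hc.2.le, mul_nonneg_of_nonpos_of_nonpos (by linarith [hc.2]) (by linarith),
      Or.inl (by linarith [hc.2] : c - a < 0).ne, ?_⟩
    have : a - y ≠ 0 := (by linarith : 0 < a - y).ne'
    rw [hc']; field_simp; ring

lemma sq_lower (f f' : ℝ → ℝ) (a y c : ℝ)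
    (hf : ∀ z, min a y ≤ z → z ≤ max a y → HasDerivAt f (f' z) z)
    (hc : ∀ z, min a y ≤ z → z ≤ max a y → c * (z - a) ^ 2 ≤ f' z * (z - a)) :
    c / 2 * (y - a) ^ 2 ≤ f y - f a := by
  obtain ⟨z, hz1, hz2, hz3, hz4, hz5⟩ := mvt_sq (fun z => f z - c / 2 * (z - a) ^ 2)
    (fun z => f' z - c * (z - a)) a y (by
      intro z h1 h2
      have h3 : HasDerivAt (fun z : ℝ => c / 2 * (z - a) ^ 2) (c * (z - a)) z := by
        have := (((hasDerivAt_id z).sub_const a).pow 2).const_mul (c / 2)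
        refine HasDerivAt.congr_deriv (f := fun z : ℝ => c / 2 * (z - a) ^ 2) this ?_
        simp; ring
      exact (hf z h1 h2).sub h3)
  have h6 := hc z hz1 hz2
  have : 0 ≤ (f' z - c * (z - a)) * (y - a) := by
    rcases hz4 with h | h
    · have h7 : 0 < (z - a) ^ 2 := by positivity
      have h8 : 0 ≤ ((f' z - c * (z - a)) * (y - a)) * (z - a) ^ 2 := by
        have : ((f' z - c * (z - a)) * (y - a)) * (z - a) ^ 2
          = (f' z * (z - a) - c * (z - a) ^ 2) * ((z - a) * (y - a)) := by ring
        rw [this]; exact mul_nonneg (by linarith) hz3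
      exact nonneg_of_mul_nonneg_left h8 h7
    · simp [h]
  rw [← hz5] at this
  simp at this
  linarith

lemma h_bd {a y m E : ℝ} (hm : 0 < m) (ha : m ≤ a) (hy : m ≤ y) (haE : a ≤ E) (hyE : y ≤ E) :
    (y - a) ^ 2 / (2 * (E * (1 + E))) ≤ h a y ∧ h a y ≤ (y - a) ^ 2 / (2 * m) := by
  have hd : ∀ z, min a y ≤ z → z ≤ max a y → HasDerivAt (h a) (h' a z) z :=
    fun z h1 _ => h_deriv (hm.trans_le ((le_min ha hy).trans h1))
  have hb : ∀ z, min a y ≤ z → z ≤ max a y → _ := fun z h1 h2 =>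
    h'_bd hm ha ((le_min ha hy).trans h1) haE (h2.trans (max_le haE hyE))
  constructor
  · have := sq_lower (h a) (h' a) a y (1 / (E * (1 + E))) hd (fun z h1 h2 => by
      have := (hb z h1 h2).1
      rw [div_mul_eq_mul_div, one_mul]; exact this)
    rw [h_self, sub_zero] at this
    refine le_trans (le_of_eq ?_) this
    have : 0 < E := by linarith
    field_simp
  · have := sq_lower (fun z => - h a z) (fun z => - h' a z) a y (-(1 / m))
      (fun z h1 h2 => (hd z h1 h2).neg) (fun z h1 h2 => by
      have := (hb z h1 h2).2
      have e : -(1 / m) * (z - a) ^ 2 = - ((z - a) ^ 2 / m) := by ring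
      rw [e]; linarith)
    simp only [h_self] at this
    have e : -(1 / m) / 2 * (y - a) ^ 2 = - ((y - a) ^ 2 / (2 * m)) := by field_simp
    rw [e] at this
    linarith

/-- Bose-Einstein -/
noncomputable def n (x : ℝ) : ℝ := 1 / (Real.exp x - 1)

lemma n_pos {x : ℝ} (hx : 0 < x) : 0 < n x := by
  have := Real.add_one_lt_exp hx.ne'
  unfold n; apply one_div_pos.2; linarith

lemma n_anti {x y : ℝ} (hx : 0 < x) (h : x ≤ y) : n y ≤ n x := by
  have := Real.add_one_lt_exp hx.ne'
  have := Real.exp_le_exp.2 h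
  unfold n; apply one_div_le_one_div_of_le <;> linarith

lemma n_lip_aux {x y : ℝ} (hx : 0 < x) (h : x ≤ y) : n x - n y ≤ n x * (1 + n y) * (y - x) := by
  have h1 := Real.add_one_lt_exp hx.ne'
  have h2 := Real.exp_le_exp.2 h
  have h3 : 0 < Real.exp x - 1 := by linarith
  have h4 : 0 < Real.exp y - 1 := by linarith
  have e : n x - n y = n x * (1 + n y) * (1 - Real.exp (x - y)) := by
    rw [Real.exp_sub]; unfold n
    have := Real.exp_pos y
    field_simp; ring
  rw [e]
  have := Real.add_one_le_exp (x - y)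
  have := n_pos hx
  have := n_pos (hx.trans_le h)
  exact mul_le_mul_of_nonneg_left (by linarith) (by positivity)

lemma n_lip {x y E : ℝ} (hx : 0 < x) (hy : 0 < y) (hxE : n x ≤ E) (hyE : n y ≤ E) :
    |n x - n y| ≤ E * (1 + E) * |x - y| := by
  have := n_pos hx
  have := n_pos hy
  have hE : 0 < E := by linarith
  rcases le_total x y with h | h
  · rw [abs_of_nonneg (by linarith [n_anti hx h]), abs_of_nonpos (by linarith)]
    refine (n_lip_aux hx h).trans ?_
    have : 0 ≤ y - x := by linarith
    rw [neg_sub]; gcongr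
  · rw [abs_of_nonpos (by linarith [n_anti hy h]), abs_of_nonneg (by linarith), neg_sub]
    refine (n_lip_aux hy h).trans ?_
    have : 0 ≤ x - y := by linarith
    gcongr

noncomputable def X (y : ℝ) : ℝ := Real.log (1 + y) - Real.log y

lemma X_pos {y : ℝ} (hy : 0 < y) : 0 < X y := by
  have := Real.log_lt_log hy (by linarith : y < 1 + y)
  unfold X; linarith

lemma n_X {y : ℝ} (hy : 0 < y) : n (X y) = y := by
  unfold n X
  rw [Real.exp_sub, Real.exp_log hy, Real.exp_log (by linarith)]
  field_simp; ring

lemma X_n {x : ℝ} (hx : 0 < x) : X (n x) = x := by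
  have h1 := Real.add_one_lt_exp hx.ne'
  have h3 : 0 < Real.exp x - 1 := by linarith
  unfold X
  rw [← Real.log_div (by have := n_pos hx; positivity) (n_pos hx).ne']
  rw [show (1 + n x) / n x = Real.exp x by unfold n; field_simp; ring, Real.log_exp]

lemma exists_rho (I : ℕ) (hI : 3 ≤ I) (E : ℝ) (hE : 0 < E) :
    ∃ ρ > 0, ∑ k ∈ Finset.Icc 1 I, (k : ℝ) * n (ρ * k) = E := by
  have hI' : (3 : ℝ) ≤ I := by exact_mod_cast hI
  have h0 : 0 < Real.log (1 + 1 / E) := Real.log_pos (by have := one_div_pos.2 hE; linarith)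
  have h1 : Real.log (1 + 1 / E) ≤ I / E := by
    have := Real.log_le_sub_one_of_pos (show 0 < 1 + 1 / E by positivity)
    have : 1 / E ≤ I / E := by gcongr; linarith
    linarith
  have hc : ContinuousOn (fun ρ : ℝ => ∑ k ∈ Finset.Icc 1 I, (k : ℝ) * n (ρ * k))
      (Set.Icc (Real.log (1 + 1 / E)) (I / E)) := by
    apply continuousOn_finsetSum
    intro k hk
    have hk1 : (1 : ℝ) ≤ k := by exact_mod_cast (Finset.mem_Icc.1 hk).1
    unfold n
    refine continuousOn_const.mul (continuousOn_const.div (by fun_prop) ?_)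
    intro ρ hρ
    have : 0 < ρ * k := mul_pos (h0.trans_le hρ.1) (by linarith)
    have := Real.add_one_lt_exp this.ne'
    linarith
  have := intermediate_value_Icc' h1 hc
  suffices hmem : E ∈ Set.Icc (∑ k ∈ Finset.Icc 1 I, (k : ℝ) * n (I / E * k))
      (∑ k ∈ Finset.Icc 1 I, (k : ℝ) * n (Real.log (1 + 1 / E) * k)) by
    obtain ⟨ρ, hρ, hρ'⟩ := this hmem
    exact ⟨ρ, h0.trans_le hρ.1, hρ'⟩
  constructor
  · calc ∑ k ∈ Finset.Icc 1 I, (k : ℝ) * n (I / E * k) ≤ ∑ k ∈ Finset.Icc 1 I, E / I := by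
          apply Finset.sum_le_sum
          intro k hk
          have hk1 : (1 : ℝ) ≤ k := by exact_mod_cast (Finset.mem_Icc.1 hk).1
          have : 0 < I / E * k := by positivity
          have h2 := Real.add_one_le_exp (I / E * k : ℝ)
          calc (k : ℝ) * n (I / E * k) ≤ k * (1 / (I / E * k)) := by
                unfold n; gcongr; linarith
            _ = E / I := by field_simp
      _ = E := by simp; field_simp
  · have h2 : n (Real.log (1 + 1 / E) * (1 : ℕ)) = E := by
      unfold n
      rw [Nat.cast_one, mul_one, Real.exp_log (by positivity)]; simp
    calc E = ((1 : ℕ) : ℝ) * n (Real.log (1 + 1 / E) * (1 : ℕ)) := by rw [h2]; simp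
      _ ≤ _ := by
        apply Finset.single_le_sum (f := fun k : ℕ => (k : ℝ) * n (Real.log (1 + 1 / E) * k))
        · intro k hk
          have hk1 : (1 : ℝ) ≤ k := by exact_mod_cast (Finset.mem_Icc.1 hk).1
          have := n_pos (show 0 < Real.log (1 + 1 / E) * k by positivity)
          positivity
        · simp; omega

/-- Stability: near-equilibrium relations force closeness to the equilibrium. -/
lemma stab (I : ℕ) (hI : 3 ≤ I) (E ρ : ℝ) (hρ : 0 < ρ) (hE : 0 < E)
    (hρE : ∑ k ∈ Finset.Icc 1 I, (k : ℝ) * n (ρ * k) = E) :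
    ∃ C > 0, ∀ (G : ℕ → ℝ), (∀ k ∈ Finset.Icc 1 I, 0 < G k) → (∀ k ∈ Finset.Icc 1 I, G k ≤ E) →
      (∑ k ∈ Finset.Icc 1 I, (k : ℝ) * G k = E) → ∀ δ : ℝ,
      (∀ k, 1 ≤ k → k + 1 ≤ I → |X (G (k + 1)) - X (G 1) - X (G k)| ≤ δ) →
      ∀ k ∈ Finset.Icc 1 I, |G k - n (ρ * k)| ≤ C * δ := by
  have hI' : (3 : ℝ) ≤ I := by exact_mod_cast hI
  set L := E * (1 + E) with hL
  have hLpos : 0 < L := by positivity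
  refine ⟨L * I + ∑ k ∈ Finset.Icc 1 I, (k : ℝ) * (L * I), by positivity, ?_⟩
  intro G hG hGE hGen δ hδ
  have hδ0 : 0 ≤ δ := (abs_nonneg _).trans (hδ 1 le_rfl (by omega))
  have m1 : 1 ∈ Finset.Icc 1 I := by simp; omega
  have hx : ∀ k : ℕ, 1 ≤ k → k ≤ I → |X (G k) - k * X (G 1)| ≤ k * δ := by
    intro k hk
    induction k, hk using Nat.le_induction with
    | base => intro _; simp; exact hδ0
    | succ k hk ih =>
      intro hkI
      have h1 := ih (by omega)
      have h2 := hδ k hk hkI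
      push_cast
      rw [abs_le] at *
      constructor <;> linarith
  have hx1 := X_pos (hG 1 m1)
  have hFG : ∀ k ∈ Finset.Icc 1 I, |G k - n (k * X (G 1))| ≤ L * I * δ := by
    intro k hk
    have hk' := Finset.mem_Icc.1 hk
    have hk1 : (1 : ℝ) ≤ k := by exact_mod_cast hk'.1
    have hkI : (k : ℝ) ≤ I := by exact_mod_cast hk'.2
    have h2 : n (k * X (G 1)) ≤ E := by
      refine (n_anti hx1 (by nlinarith)).trans ?_
      rw [n_X (hG 1 m1)]; exact hGE 1 m1
    have := n_lip (X_pos (hG k hk)) (show 0 < k * X (G 1) by positivity)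
      (by rw [n_X (hG k hk)]; exact hGE k hk) h2
    rw [n_X (hG k hk)] at this
    refine this.trans ?_
    rw [mul_assoc L]
    have := (hx k hk'.1 hk'.2).trans (mul_le_mul_of_nonneg_right hkI hδ0)
    gcongr
  have hsum : |∑ k ∈ Finset.Icc 1 I, (k : ℝ) * (n (k * X (G 1)) - n (ρ * k))|
      ≤ ∑ k ∈ Finset.Icc 1 I, (k : ℝ) * (L * I * δ) := by
    have e : ∑ k ∈ Finset.Icc 1 I, (k : ℝ) * (n (k * X (G 1)) - n (ρ * k))
        = - ∑ k ∈ Finset.Icc 1 I, (k : ℝ) * (G k - n (k * X (G 1))) := by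
      simp only [mul_sub, Finset.sum_sub_distrib]
      rw [hρE, hGen]; ring
    rw [e, abs_neg]
    refine (Finset.abs_sum_le_sum_abs _ _).trans (Finset.sum_le_sum ?_)
    intro k hk
    rw [abs_mul, Nat.abs_cast]
    exact mul_le_mul_of_nonneg_left (hFG k hk) (Nat.cast_nonneg _)
  have hsign : ∀ j ∈ Finset.Icc 1 I, |n (j * X (G 1)) - n (ρ * j)| ≤
      |∑ k ∈ Finset.Icc 1 I, (k : ℝ) * (n (k * X (G 1)) - n (ρ * k))| := by
    intro j hj
    have key : ∀ f : ℕ → ℝ, (∀ k ∈ Finset.Icc 1 I, 0 ≤ f k) →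
        f j ≤ ∑ k ∈ Finset.Icc 1 I, (k : ℝ) * f k := by
      intro f hf
      have hj1 : (1 : ℝ) ≤ j := by exact_mod_cast (Finset.mem_Icc.1 hj).1
      have := Finset.single_le_sum (f := fun k : ℕ => (k : ℝ) * f k)
        (fun k hk => mul_nonneg (Nat.cast_nonneg _) (hf k hk)) hj
      have := hf j hj
      nlinarith
    rcases le_total (X (G 1)) ρ with hle | hle
    · have hp : ∀ k ∈ Finset.Icc 1 I, 0 ≤ n (k * X (G 1)) - n (ρ * k) := by
        intro k hk
        have hk1 : (1 : ℝ) ≤ k := by exact_mod_cast (Finset.mem_Icc.1 hk).1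
        have := n_anti (show 0 < k * X (G 1) by positivity) (show k * X (G 1) ≤ ρ * k by nlinarith)
        linarith
      rw [abs_of_nonneg (hp j hj)]
      exact (key (fun k : ℕ => n (k * X (G 1)) - n (ρ * k)) hp).trans (le_abs_self _)
    · have hp : ∀ k ∈ Finset.Icc 1 I, 0 ≤ n (ρ * k) - n (k * X (G 1)) := by
        intro k hk
        have hk1 : (1 : ℝ) ≤ k := by exact_mod_cast (Finset.mem_Icc.1 hk).1
        have := n_anti (show 0 < ρ * k by positivity) (show ρ * k ≤ k * X (G 1) by nlinarith)
        linarith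
      rw [abs_sub_comm, abs_of_nonneg (hp j hj)]
      refine (key (fun k : ℕ => n (ρ * k) - n (k * X (G 1))) hp).trans ?_
      rw [← abs_neg, ← Finset.sum_neg_distrib]
      refine le_trans (le_of_eq ?_) (le_abs_self _)
      apply Finset.sum_congr rfl; intros; ring
  intro k hk
  have h1 := hFG k hk
  have h2 := (hsign k hk).trans hsum
  have h3 := abs_sub_le (G k) (n (k * X (G 1))) (n (ρ * k))
  refine h3.trans ((add_le_add h1 h2).trans (le_of_eq ?_))
  rw [add_mul, Finset.sum_mul]
  congr 1
  apply Finset.sum_congr rfl; intros; ring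



lemma weak12 (s : Finset ℕ) (T : ℕ → ℕ → ℕ → ℝ) (hT : ∀ a b c, T a b c = T a c b) (φ : ℕ → ℝ) :
    ∑ k ∈ s, φ k * ((∑ b ∈ s, ∑ c ∈ s, if b + c = k then T k b c else 0)
      - 2 * ∑ a ∈ s, ∑ c ∈ s, if k + c = a then T a k c else 0)
    = ∑ a ∈ s, ∑ b ∈ s, ∑ c ∈ s, if b + c = a then T a b c * (φ a - φ b - φ c) else 0 := by
  have e1 : ∑ k ∈ s, φ k * (∑ b ∈ s, ∑ c ∈ s, if b + c = k then T k b c else 0)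
      = ∑ a ∈ s, ∑ b ∈ s, ∑ c ∈ s, if b + c = a then T a b c * φ a else 0 := by
    simp only [Finset.mul_sum]
    refine Finset.sum_congr rfl fun a _ => Finset.sum_congr rfl fun b _ =>
      Finset.sum_congr rfl fun c _ => ?_
    split_ifs <;> ring
  have e2 : ∑ k ∈ s, φ k * (∑ a ∈ s, ∑ c ∈ s, if k + c = a then T a k c else 0)
      = ∑ a ∈ s, ∑ b ∈ s, ∑ c ∈ s, if b + c = a then T a b c * φ b else 0 := by
    simp only [Finset.mul_sum]
    rw [Finset.sum_comm]
    refine Finset.sum_congr rfl fun a _ => Finset.sum_congr rfl fun b _ =>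
      Finset.sum_congr rfl fun c _ => ?_
    split_ifs <;> ring
  have e3 : ∑ a ∈ s, ∑ b ∈ s, ∑ c ∈ s, (if b + c = a then T a b c * φ b else 0)
      = ∑ a ∈ s, ∑ b ∈ s, ∑ c ∈ s, if b + c = a then T a b c * φ c else 0 := by
    refine Finset.sum_congr rfl fun a _ => ?_
    rw [Finset.sum_comm]
    refine Finset.sum_congr rfl fun b _ => Finset.sum_congr rfl fun c _ => ?_
    rw [add_comm c b, hT a c b]
  have e4 : ∑ k ∈ s, φ k * ((∑ b ∈ s, ∑ c ∈ s, if b + c = k then T k b c else 0)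
      - 2 * ∑ a ∈ s, ∑ c ∈ s, if k + c = a then T a k c else 0)
      = ∑ k ∈ s, φ k * (∑ b ∈ s, ∑ c ∈ s, if b + c = k then T k b c else 0)
      - (∑ k ∈ s, φ k * (∑ a ∈ s, ∑ c ∈ s, if k + c = a then T a k c else 0)
      + ∑ k ∈ s, φ k * (∑ a ∈ s, ∑ c ∈ s, if k + c = a then T a k c else 0)) := by
    rw [← Finset.sum_add_distrib, ← Finset.sum_sub_distrib]
    refine Finset.sum_congr rfl fun a _ => ?_
    ring
  rw [e4, e1, e2]
  nth_rewrite 2 [e3]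
  simp only [← Finset.sum_add_distrib, ← Finset.sum_sub_distrib]
  refine Finset.sum_congr rfl fun a _ => Finset.sum_congr rfl fun b _ =>
      Finset.sum_congr rfl fun c _ => ?_
  split_ifs <;> ring

lemma weak22 (s : Finset ℕ) (T : ℕ → ℕ → ℕ → ℕ → ℝ) (hT : ∀ a b c d, T a b c d = T b a c d)
    (hT' : ∀ a b c d, T a b c d = - T c d a b) (φ : ℕ → ℝ) :
    4 * ∑ a ∈ s, φ a * (∑ b ∈ s, ∑ c ∈ s, ∑ d ∈ s, if a + b = c + d then T a b c d else 0)
    = ∑ a ∈ s, ∑ b ∈ s, ∑ c ∈ s, ∑ d ∈ s,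
      if a + b = c + d then T a b c d * (φ a + φ b - φ c - φ d) else 0 := by
  have e1 : ∑ a ∈ s, φ a * (∑ b ∈ s, ∑ c ∈ s, ∑ d ∈ s, if a + b = c + d then T a b c d else 0)
      = ∑ a ∈ s, ∑ b ∈ s, ∑ c ∈ s, ∑ d ∈ s, if a + b = c + d then T a b c d * φ a else 0 := by
    simp only [Finset.mul_sum]
    refine Finset.sum_congr rfl fun a _ => Finset.sum_congr rfl fun b _ =>
      Finset.sum_congr rfl fun c _ => Finset.sum_congr rfl fun d _ => ?_
    split_ifs <;> ring
  have e2 : ∑ a ∈ s, ∑ b ∈ s, ∑ c ∈ s, ∑ d ∈ s, (if a + b = c + d then T a b c d * φ b else 0)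
      = ∑ a ∈ s, ∑ b ∈ s, ∑ c ∈ s, ∑ d ∈ s, if a + b = c + d then T a b c d * φ a else 0 := by
    rw [Finset.sum_comm]
    refine Finset.sum_congr rfl fun a _ => Finset.sum_congr rfl fun b _ =>
      Finset.sum_congr rfl fun c _ => Finset.sum_congr rfl fun d _ => ?_
    rw [add_comm b a, hT b a]
  have sw : ∀ f : ℕ → ℕ → ℕ → ℕ → ℝ, ∑ a ∈ s, ∑ b ∈ s, ∑ c ∈ s, ∑ d ∈ s, f a b c d
      = ∑ a ∈ s, ∑ b ∈ s, ∑ c ∈ s, ∑ d ∈ s, f c d a b := by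
    intro f
    have := Finset.sum_comm (s := s ×ˢ s) (t := s ×ˢ s) (f := fun p q => f p.1 p.2 q.1 q.2)
    simpa only [Finset.sum_product] using this
  have e3 : ∑ a ∈ s, ∑ b ∈ s, ∑ c ∈ s, ∑ d ∈ s, (if a + b = c + d then T a b c d * φ c else 0)
      = - ∑ a ∈ s, ∑ b ∈ s, ∑ c ∈ s, ∑ d ∈ s, if a + b = c + d then T a b c d * φ a else 0 := by
    rw [sw]
    simp only [← Finset.sum_neg_distrib]
    refine Finset.sum_congr rfl fun a _ => Finset.sum_congr rfl fun b _ =>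
      Finset.sum_congr rfl fun c _ => Finset.sum_congr rfl fun d _ => ?_
    rw [hT' a b c d]
    simp only [eq_comm (a := c + d)]
    split_ifs <;> ring
  have e4 : ∑ a ∈ s, ∑ b ∈ s, ∑ c ∈ s, ∑ d ∈ s, (if a + b = c + d then T a b c d * φ d else 0)
      = - ∑ a ∈ s, ∑ b ∈ s, ∑ c ∈ s, ∑ d ∈ s, if a + b = c + d then T a b c d * φ b else 0 := by
    rw [sw]
    simp only [← Finset.sum_neg_distrib]
    refine Finset.sum_congr rfl fun a _ => Finset.sum_congr rfl fun b _ =>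
      Finset.sum_congr rfl fun c _ => Finset.sum_congr rfl fun d _ => ?_
    rw [hT' a b c d]
    simp only [eq_comm (a := c + d)]
    split_ifs <;> ring
  have e5 : ∑ a ∈ s, ∑ b ∈ s, ∑ c ∈ s, ∑ d ∈ s,
      (if a + b = c + d then T a b c d * (φ a + φ b - φ c - φ d) else 0)
    = ∑ a ∈ s, ∑ b ∈ s, ∑ c ∈ s, ∑ d ∈ s, (if a + b = c + d then T a b c d * φ a else 0)
    + ∑ a ∈ s, ∑ b ∈ s, ∑ c ∈ s, ∑ d ∈ s, (if a + b = c + d then T a b c d * φ b else 0)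
    - ∑ a ∈ s, ∑ b ∈ s, ∑ c ∈ s, ∑ d ∈ s, (if a + b = c + d then T a b c d * φ c else 0)
    - ∑ a ∈ s, ∑ b ∈ s, ∑ c ∈ s, ∑ d ∈ s, (if a + b = c + d then T a b c d * φ d else 0) := by
    simp only [← Finset.sum_add_distrib, ← Finset.sum_sub_distrib]
    refine Finset.sum_congr rfl fun a _ => Finset.sum_congr rfl fun b _ =>
      Finset.sum_congr rfl fun c _ => Finset.sum_congr rfl fun d _ => ?_
    split_ifs <;> ring
  rw [e5, e1, e4, e3, e2]
  ring

noncomputable def T12 (K : ℕ → ℕ → ℕ → ℝ) (F : ℕ → ℝ) (a b c : ℕ) : ℝ :=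
  K a b c * ((F a + 1) * F b * F c - F a * (F b + 1) * (F c + 1))

noncomputable def T22 (K : ℕ → ℕ → ℕ → ℕ → ℝ) (F : ℕ → ℝ) (k₁ k₂ k₃ k₄ : ℕ) : ℝ :=
  K k₁ k₂ k₃ k₄ * ((F k₁ + 1) * (F k₂ + 1) * F k₃ * F k₄
        - F k₁ * F k₂ * (F k₃ + 1) * (F k₄ + 1))

lemma sum12 (I : ℕ) (K : ℕ → ℕ → ℕ → ℝ)
    (hK : ∀ a b c, K a b c = K b a c ∧ K a b c = K a c b) (F φ : ℕ → ℝ) :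
    ∑ k ∈ Finset.Icc 1 I, φ k * C12 I K F k
    = ∑ a ∈ Finset.Icc 1 I, ∑ b ∈ Finset.Icc 1 I, ∑ c ∈ Finset.Icc 1 I,
      if b + c = a then T12 K F a b c * (φ a - φ b - φ c) else 0 := by
  refine weak12 (Finset.Icc 1 I) (T12 K F) ?_ φ
  intro a b c
  unfold T12
  rw [(hK a b c).2]; ring

lemma sum22 (I : ℕ) (K : ℕ → ℕ → ℕ → ℕ → ℝ)
    (hK : ∀ a b c d, K a b c d = K b a c d ∧ K a b c d = K a c b d ∧
      K a b c d = K a b d c) (F φ : ℕ → ℝ) :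
    4 * ∑ k ∈ Finset.Icc 1 I, φ k * C22 I K F k
    = ∑ a ∈ Finset.Icc 1 I, ∑ b ∈ Finset.Icc 1 I, ∑ c ∈ Finset.Icc 1 I, ∑ d ∈ Finset.Icc 1 I,
      if a + b = c + d then T22 K F a b c d * (φ a + φ b - φ c - φ d) else 0 := by
  refine weak22 (Finset.Icc 1 I) (T22 K F) ?_ ?_ φ
  · intro a b c d
    unfold T22
    rw [(hK a b c d).1]; ring
  · intro a b c d
    unfold T22
    have : K a b c d = K c d a b := by
      rw [(hK a b c d).2.1, (hK a c b d).1, (hK c a b d).2.2, (hK c a d b).2.1]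
    rw [this]; ring

lemma energy (I : ℕ) (K12 : ℕ → ℕ → ℕ → ℝ) (K22 : ℕ → ℕ → ℕ → ℕ → ℝ)
    (hK12symm : ∀ a b c, K12 a b c = K12 b a c ∧ K12 a b c = K12 a c b)
    (hK22symm : ∀ a b c d, K22 a b c d = K22 b a c d ∧ K22 a b c d = K22 a c b d ∧
      K22 a b c d = K22 a b d c) (F : ℕ → ℝ) :
    ∑ k ∈ Finset.Icc 1 I, (k : ℝ) * (C12 I K12 F k + C22 I K22 F k) = 0 := by
  have h1 := sum12 I K12 hK12symm F (fun k => (k : ℝ))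
  have h2 := sum22 I K22 hK22symm F (fun k => (k : ℝ))
  have h3 : ∑ k ∈ Finset.Icc 1 I, (k : ℝ) * C12 I K12 F k = 0 := by
    rw [h1]
    refine Finset.sum_eq_zero fun a _ => Finset.sum_eq_zero fun b _ => Finset.sum_eq_zero fun c _ => ?_
    split_ifs with h
    · subst h; push_cast; ring
    · rfl
  have h4 : 4 * ∑ k ∈ Finset.Icc 1 I, (k : ℝ) * C22 I K22 F k = 0 := by
    rw [h2]
    refine Finset.sum_eq_zero fun a _ => Finset.sum_eq_zero fun b _ => Finset.sum_eq_zero fun c _ =>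
      Finset.sum_eq_zero fun d _ => ?_
    split_ifs with h
    · have : (a : ℝ) + b = c + d := by exact_mod_cast h
      rw [this]; ring
    · rfl
  simp only [mul_add, Finset.sum_add_distrib]
  linarith

lemma logX3 {a b c : ℝ} (ha : 0 < a) (hb : 0 < b) (hc : 0 < c) :
    X a - X b - X c = Real.log ((a + 1) * b * c) - Real.log (a * (b + 1) * (c + 1)) := by
  rw [Real.log_mul (by positivity) (by positivity), Real.log_mul (by positivity) (by positivity),
    Real.log_mul (by positivity) (by positivity), Real.log_mul (by positivity) (by positivity)]
  unfold X
  rw [add_comm 1 a, add_comm 1 b, add_comm 1 c]; ring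

lemma logX4 {a b c d : ℝ} (ha : 0 < a) (hb : 0 < b) (hc : 0 < c) (hd : 0 < d) :
    X a + X b - X c - X d = Real.log ((a + 1) * (b + 1) * c * d)
      - Real.log (a * b * (c + 1) * (d + 1)) := by
  rw [Real.log_mul (by positivity) (by positivity), Real.log_mul (by positivity) (by positivity),
    Real.log_mul (by positivity) (by positivity), Real.log_mul (by positivity) (by positivity),
    Real.log_mul (by positivity) (by positivity), Real.log_mul (by positivity) (by positivity)]
  unfold X
  rw [add_comm 1 a, add_comm 1 b, add_comm 1 c, add_comm 1 d]; ring

lemma dissip (I : ℕ) (K12 : ℕ → ℕ → ℕ → ℝ) (K22 : ℕ → ℕ → ℕ → ℕ → ℝ)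
    (hK12pos : ∀ a b c, 0 < K12 a b c)
    (hK12symm : ∀ a b c, K12 a b c = K12 b a c ∧ K12 a b c = K12 a c b)
    (hK22pos : ∀ a b c d, 0 < K22 a b c d)
    (hK22symm : ∀ a b c d, K22 a b c d = K22 b a c d ∧ K22 a b c d = K22 a c b d ∧
      K22 a b c d = K22 a b d c) (F : ℕ → ℝ) (m κ : ℝ) (hm : 0 < m) (hκ : 0 < κ)
    (hF : ∀ k ∈ Finset.Icc 1 I, m ≤ F k) (k : ℕ) (hk1 : 1 ≤ k) (hkI : k + 1 ≤ I)
    (hκK : κ ≤ K12 (k + 1) 1 k) :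
    κ * m ^ 3 * (X (F (k + 1)) - X (F 1) - X (F k)) ^ 2 ≤
      ∑ k ∈ Finset.Icc 1 I, X (F k) * (C12 I K12 F k + C22 I K22 F k) := by
  have hpos : ∀ k ∈ Finset.Icc 1 I, 0 < F k := fun k hk => hm.trans_le (hF k hk)
  simp only [mul_add, Finset.sum_add_distrib]
  have h22 : 0 ≤ 4 * ∑ k ∈ Finset.Icc 1 I, X (F k) * C22 I K22 F k := by
    rw [sum22 I K22 hK22symm F (fun k => X (F k))]
    refine Finset.sum_nonneg fun a ha => Finset.sum_nonneg fun b hb => Finset.sum_nonneg fun c hc =>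
      Finset.sum_nonneg fun d hd => ?_
    have h1 := hpos a ha
    have h2 := hpos b hb
    have h3 := hpos c hc
    have h4 := hpos d hd
    split_ifs
    · rw [logX4 h1 h2 h3 h4]
      unfold T22
      rw [mul_assoc]
      exact mul_nonneg (hK22pos _ _ _ _).le (log_prod_nonneg (by positivity) (by positivity))
    · exact le_rfl
  have hterm : ∀ a ∈ Finset.Icc 1 I, ∀ b ∈ Finset.Icc 1 I, ∀ c ∈ Finset.Icc 1 I,
      0 ≤ if b + c = a then T12 K12 F a b c * (X (F a) - X (F b) - X (F c)) else 0 := by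
    intro a ha b hb c hc
    have h1 := hpos a ha
    have h2 := hpos b hb
    have h3 := hpos c hc
    split_ifs
    · rw [logX3 h1 h2 h3]
      unfold T12
      rw [mul_assoc]
      exact mul_nonneg (hK12pos _ _ _).le (log_prod_nonneg (by positivity) (by positivity))
    · exact le_rfl
  have h12 : T12 K12 F (k + 1) 1 k * (X (F (k + 1)) - X (F 1) - X (F k)) ≤
      ∑ k ∈ Finset.Icc 1 I, X (F k) * C12 I K12 F k := by
    rw [sum12 I K12 hK12symm F (fun k => X (F k))]
    have m1 : k + 1 ∈ Finset.Icc 1 I := by simp; omega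
    have m2 : 1 ∈ Finset.Icc 1 I := by simp; omega
    have m3 : k ∈ Finset.Icc 1 I := by simp; omega
    refine le_trans ?_ (Finset.single_le_sum (fun a ha => Finset.sum_nonneg fun b hb =>
      Finset.sum_nonneg fun c hc => hterm a ha b hb c hc) m1)
    refine le_trans ?_ (Finset.single_le_sum (fun b hb =>
      Finset.sum_nonneg fun c hc => hterm _ m1 b hb c hc) m2)
    refine le_trans ?_ (Finset.single_le_sum (fun c hc => hterm _ m1 _ m2 c hc) m3)
    rw [if_pos (add_comm 1 k)]
  have m1 : m ≤ F (k + 1) := hF _ (by simp; omega)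
  have m2 : m ≤ F 1 := hF _ (by simp; omega)
  have m3 : m ≤ F k := hF _ (by simp; omega)
  have p1 : 0 < F (k + 1) := by linarith
  have p2 : 0 < F 1 := by linarith
  have p3 : 0 < F k := by linarith
  have hl : κ * m ^ 3 * (X (F (k + 1)) - X (F 1) - X (F k)) ^ 2 ≤
      T12 K12 F (k + 1) 1 k * (X (F (k + 1)) - X (F 1) - X (F k)) := by
    rw [logX3 p1 p2 p3]
    have hA : m ^ 3 ≤ (F (k + 1) + 1) * F 1 * F k := by
      calc m ^ 3 = m * m * m := by ring
        _ ≤ _ := by gcongr; linarith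
    have hB : m ^ 3 ≤ F (k + 1) * (F 1 + 1) * (F k + 1) := by
      calc m ^ 3 = m * m * m := by ring
        _ ≤ _ := by gcongr <;> linarith
    have := (log_prod (m ^ 3) _ (by positivity) hA hB (le_max_left _ _) (le_max_right _ _)).1
    unfold T12
    rw [mul_assoc κ, mul_assoc (K12 _ _ _)]
    have h0 : 0 ≤ m ^ 3 * (Real.log ((F (k + 1) + 1) * F 1 * F k)
      - Real.log (F (k + 1) * (F 1 + 1) * (F k + 1))) ^ 2 := by positivity
    exact mul_le_mul hκK this h0 (hK12pos _ _ _).le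
  linarith

lemma lossbound (I : ℕ) (K12 : ℕ → ℕ → ℕ → ℝ) (K22 : ℕ → ℕ → ℕ → ℕ → ℝ)
    (hK12pos : ∀ a b c, 0 < K12 a b c)
    (hK22pos : ∀ a b c d, 0 < K22 a b c d) (E : ℝ) (hE : 0 < E) :
    ∃ M > 0, ∀ F : ℕ → ℝ, (∀ k ∈ Finset.Icc 1 I, 0 < F k) → (∀ k ∈ Finset.Icc 1 I, F k ≤ E) →
      ∀ k ∈ Finset.Icc 1 I,
      (∑ b ∈ Finset.Icc 1 I, ∑ c ∈ Finset.Icc 1 I, if b + c = k then K12 k b c * (F b * F c) else 0)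
      + 2 * (∑ a ∈ Finset.Icc 1 I, ∑ c ∈ Finset.Icc 1 I, if k + c = a then K12 a k c * F a else 0)
      - M * F k ≤ C12 I K12 F k + C22 I K22 F k := by
  set S := Finset.Icc 1 I with hS
  obtain ⟨M1, hM1⟩ := ((S ×ˢ S ×ˢ S).image (fun p => K12 p.1 p.2.1 p.2.2)).exists_le
  obtain ⟨M2, hM2⟩ := ((S ×ˢ S ×ˢ S ×ˢ S).image (fun p => K22 p.1 p.2.1 p.2.2.1 p.2.2.2)).exists_le
  have hM1' : ∀ a ∈ S, ∀ b ∈ S, ∀ c ∈ S, K12 a b c ≤ max M1 1 := by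
    intro a ha b hb c hc
    refine (hM1 _ (Finset.mem_image.2 ⟨(a, b, c), ?_, rfl⟩)).trans (le_max_left _ _)
    simp only [Finset.mem_product]; exact ⟨ha, hb, hc⟩
  have hM2' : ∀ a ∈ S, ∀ b ∈ S, ∀ c ∈ S, ∀ d ∈ S, K22 a b c d ≤ max M2 1 := by
    intro a ha b hb c hc d hd
    refine (hM2 _ (Finset.mem_image.2 ⟨(a, b, c, d), ?_, rfl⟩)).trans (le_max_left _ _)
    simp only [Finset.mem_product]; exact ⟨ha, hb, hc, hd⟩
  set N1 := max M1 1
  set N2 := max M2 1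
  have hN1 : 0 < N1 := lt_max_of_lt_right one_pos
  have hN2 : 0 < N2 := lt_max_of_lt_right one_pos
  refine ⟨(∑ b ∈ S, ∑ c ∈ S, N1 * (2 * E + 1)) + 2 * (∑ b ∈ S, ∑ c ∈ S, N1 * E)
    + (∑ b ∈ S, ∑ c ∈ S, ∑ d ∈ S, N2 * (E * (E + 1) * (E + 1))) + 1, ?_, ?_⟩
  · have a1 : 0 ≤ ∑ b ∈ S, ∑ c ∈ S, N1 * (2 * E + 1) :=
      Finset.sum_nonneg fun _ _ => Finset.sum_nonneg fun _ _ => by positivity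
    have a2 : 0 ≤ ∑ b ∈ S, ∑ c ∈ S, N1 * E :=
      Finset.sum_nonneg fun _ _ => Finset.sum_nonneg fun _ _ => by positivity
    have a3 : 0 ≤ ∑ b ∈ S, ∑ c ∈ S, ∑ d ∈ S, N2 * (E * (E + 1) * (E + 1)) :=
      Finset.sum_nonneg fun _ _ => Finset.sum_nonneg fun _ _ => Finset.sum_nonneg fun _ _ => by
        positivity
    linarith
  intro F hF hFE k hk
  have pk := hF k hk
  have s1 : (∑ b ∈ S, ∑ c ∈ S, if b + c = k then K12 k b c * (F b * F c) else 0)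
      - (∑ b ∈ S, ∑ c ∈ S, N1 * (2 * E + 1)) * F k ≤
      ∑ b ∈ S, ∑ c ∈ S, if b + c = k then
        K12 k b c * ((F k + 1) * F b * F c - F k * (F b + 1) * (F c + 1)) else 0 := by
    simp only [Finset.sum_mul, ← Finset.sum_sub_distrib]
    refine Finset.sum_le_sum fun b hb => Finset.sum_le_sum fun c hc => ?_
    have pb := hF b hb
    have pc := hF c hc
    have qb := hFE b hb
    have qc := hFE c hc
    split_ifs
    · have e1 : K12 k b c * ((F k + 1) * F b * F c - F k * (F b + 1) * (F c + 1))
        = K12 k b c * (F b * F c) - K12 k b c * (F b + F c + 1) * F k := by ring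
      rw [e1]
      have := hM1' k hk b hb c hc
      have : K12 k b c * (F b + F c + 1) * F k ≤ N1 * (2 * E + 1) * F k := by
        gcongr; linarith
      linarith
    · have : 0 ≤ N1 * (2 * E + 1) * F k := by positivity
      linarith
  have s2 : (∑ a ∈ S, ∑ c ∈ S, if k + c = a then
        K12 a k c * ((F a + 1) * F k * F c - F a * (F k + 1) * (F c + 1)) else 0) ≤
      (∑ b ∈ S, ∑ c ∈ S, N1 * E) * F k -
      (∑ a ∈ S, ∑ c ∈ S, if k + c = a then K12 a k c * F a else 0) := by
    simp only [Finset.sum_mul, ← Finset.sum_sub_distrib]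
    refine Finset.sum_le_sum fun b hb => Finset.sum_le_sum fun c hc => ?_
    have pb := hF b hb
    have pc := hF c hc
    have qc := hFE c hc
    split_ifs
    · have e1 : K12 b k c * ((F b + 1) * F k * F c - F b * (F k + 1) * (F c + 1))
        = K12 b k c * F c * F k - K12 b k c * F b - K12 b k c * (F b * F c + F b * F k) := by ring
      rw [e1]
      have := hM1' b hb k hk c hc
      have h2 : K12 b k c * F c * F k ≤ N1 * E * F k := by
        gcongr
      have h3 : 0 ≤ K12 b k c * (F b * F c + F b * F k) :=
        mul_nonneg (hK12pos _ _ _).le (by positivity)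
      linarith
    · have : 0 ≤ N1 * E * F k := by positivity
      linarith
  have s3 : - ((∑ b ∈ S, ∑ c ∈ S, ∑ d ∈ S, N2 * (E * (E + 1) * (E + 1))) * F k) ≤
      C22 I K22 F k := by
    unfold C22
    simp only [Finset.sum_mul, ← Finset.sum_neg_distrib]
    refine Finset.sum_le_sum fun b hb => Finset.sum_le_sum fun c hc =>
      Finset.sum_le_sum fun d hd => ?_
    have pb := hF b hb
    have pc := hF c hc
    have pd := hF d hd
    have qb := hFE b hb
    have qc := hFE c hc
    have qd := hFE d hd
    split_ifs
    · have h1 : K22 k b c d * (F b * (F c + 1) * (F d + 1)) * F k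
          ≤ N2 * (E * (E + 1) * (E + 1)) * F k := by
        have := hM2' k hk b hb c hc d hd
        gcongr
      have h2 : 0 ≤ K22 k b c d * ((F k + 1) * (F b + 1) * F c * F d) :=
        mul_nonneg (hK22pos _ _ _ _).le (by positivity)
      have e1 : K22 k b c d * ((F k + 1) * (F b + 1) * F c * F d
        - F k * F b * (F c + 1) * (F d + 1)) = K22 k b c d * ((F k + 1) * (F b + 1) * F c * F d)
        - K22 k b c d * (F b * (F c + 1) * (F d + 1)) * F k := by ring
      rw [e1]; linarith
    · have : 0 ≤ N2 * (E * (E + 1) * (E + 1)) * F k := by positivity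
      linarith
  unfold C12
  rw [← hS]
  linarith

lemma lower_all (I : ℕ) (hI : 3 ≤ I)
    (K12 : ℕ → ℕ → ℕ → ℝ) (K22 : ℕ → ℕ → ℕ → ℕ → ℝ)
    (hK12pos : ∀ a b c, 0 < K12 a b c)
    (hK22pos : ∀ a b c d, 0 < K22 a b c d)
    (F : ℝ → ℕ → ℝ) (E κ : ℝ) (hE : 0 < E) (hκ : 0 < κ)
    (hκK : ∀ k ∈ Finset.Icc 1 I, κ ≤ K12 (k + 1) 1 k)
    (hFpos : ∀ t ∈ Set.Ici (0 : ℝ), ∀ k ∈ Finset.Icc 1 I, 0 < F t k)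
    (hFE : ∀ t ∈ Set.Ici (0 : ℝ), ∀ k ∈ Finset.Icc 1 I, F t k ≤ E)
    (hFen : ∀ t ∈ Set.Ici (0 : ℝ), ∑ k ∈ Finset.Icc 1 I, (k : ℝ) * F t k = E)
    (hF : ∀ t ∈ Set.Ici (0 : ℝ), ∀ k₁ ∈ Finset.Icc 1 I,
      HasDerivWithinAt (fun s => F s k₁)
        (C12 I K12 (F t) k₁ + C22 I K22 (F t) k₁) (Set.Ici 0) t) :
    ∃ m > 0, ∀ k ∈ Finset.Icc 1 I, ∀ t ∈ Set.Ici (0 : ℝ), m ≤ F t k := by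
  obtain ⟨M, hM, hMF⟩ := lossbound I K12 K22 hK12pos hK22pos E hE
  have hI' : (3 : ℝ) ≤ I := by exact_mod_cast hI
  have mem1 : 1 ∈ Finset.Icc 1 I := by simp; omega
  have z : (0 : ℝ) ∈ Set.Ici (0 : ℝ) := Set.mem_Ici.2 le_rfl
  have g1 : ∀ t ∈ Set.Ici (0 : ℝ), ∀ k ∈ Finset.Icc 1 I, ∀ b ∈ Finset.Icc 1 I,
      ∀ c ∈ Finset.Icc 1 I, 0 ≤ if b + c = k then K12 k b c * (F t b * F t c) else 0 := by
    intro t ht k hk b hb c hc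
    have := hFpos t ht b hb
    have := hFpos t ht c hc
    have := hK12pos k b c
    split_ifs <;> positivity
  have g2 : ∀ t ∈ Set.Ici (0 : ℝ), ∀ k ∈ Finset.Icc 1 I, ∀ a ∈ Finset.Icc 1 I,
      ∀ c ∈ Finset.Icc 1 I, 0 ≤ if k + c = a then K12 a k c * F t a else 0 := by
    intro t ht k hk a ha c hc
    have := hFpos t ht a ha
    have := hK12pos a k c
    split_ifs <;> positivity
  have base : ∃ m > 0, ∀ t ∈ Set.Ici (0 : ℝ), m ≤ F t 1 := by
    refine lower (fun s => F s 1) _ (2 * (κ / I * E)) (M + 2 * (I * κ)) (by positivity)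
      (by positivity) (hFpos 0 z 1 mem1) (fun t ht => hF t ht 1 mem1) ?_
    intro t ht
    have h1 := hMF (F t) (hFpos t ht) (hFE t ht) 1 mem1
    have h2 := Finset.sum_nonneg fun b hb => Finset.sum_nonneg fun c hc => g1 t ht 1 mem1 b hb c hc
    have p1 := hFpos t ht 1 mem1
    have h3 : κ / I * E - I * κ * F t 1 ≤ ∑ a ∈ Finset.Icc 1 I, ∑ c ∈ Finset.Icc 1 I,
        if 1 + c = a then K12 a 1 c * F t a else 0 := by
      have e : κ / I * E - I * κ * F t 1
          = ∑ a ∈ Finset.Icc 1 I, (κ / I * (a * F t a) - κ * F t 1) := by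
        rw [Finset.sum_sub_distrib, ← Finset.mul_sum, hFen t ht]; simp; ring
      rw [e]
      refine Finset.sum_le_sum fun a ha => ?_
      have pa := hFpos t ht a ha
      have ha' := Finset.mem_Icc.1 ha
      have haI : (a : ℝ) ≤ I := by exact_mod_cast ha'.2
      have q : κ / I * (a * F t a) ≤ κ * F t a := by
        calc κ / I * (a * F t a) ≤ κ / I * (I * F t a) := by gcongr
          _ = κ * F t a := by field_simp
      have q1 : 0 < κ * F t 1 := by positivity
      rcases Nat.eq_or_lt_of_le ha'.1 with h | h
      · subst h
        refine le_trans ?_ (Finset.sum_nonneg fun c hc => g2 t ht 1 mem1 1 mem1 c hc)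
        linarith
      · obtain ⟨j, rfl⟩ : ∃ j, a = j + 1 := ⟨a - 1, by omega⟩
        have mj : j ∈ Finset.Icc 1 I := by simp; omega
        refine le_trans ?_ (Finset.single_le_sum (fun c hc => g2 t ht 1 mem1 _ ha c hc) mj)
        rw [if_pos (add_comm 1 j)]
        have := mul_le_mul_of_nonneg_right (hκK j mj) pa.le
        linarith
    linarith
  obtain ⟨m1, hm1, hm1F⟩ := base
  have all : ∀ k, 1 ≤ k → k ≤ I → ∃ m > 0, ∀ t ∈ Set.Ici (0 : ℝ), m ≤ F t k := by
    intro k hk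
    induction k, hk using Nat.le_induction with
    | base => intro _; exact ⟨m1, hm1, hm1F⟩
    | succ k hk ih =>
      intro hkI
      obtain ⟨m, hm, hmF⟩ := ih (by omega)
      have mk : k ∈ Finset.Icc 1 I := by simp; omega
      have mk1 : k + 1 ∈ Finset.Icc 1 I := by simp; omega
      refine lower (fun s => F s (k + 1)) _ (κ * (m1 * m)) M hM
        (by positivity) (hFpos 0 z _ mk1) (fun t ht => hF t ht _ mk1) ?_
      intro t ht
      have h1 := hMF (F t) (hFpos t ht) (hFE t ht) _ mk1
      have h2 := Finset.sum_nonneg fun b hb => Finset.sum_nonneg fun c hc =>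
        g2 t ht _ mk1 b hb c hc
      have h3 : κ * (m1 * m) ≤ ∑ b ∈ Finset.Icc 1 I, ∑ c ∈ Finset.Icc 1 I,
          if b + c = k + 1 then K12 (k + 1) b c * (F t b * F t c) else 0 := by
        refine le_trans ?_ (Finset.single_le_sum (fun b hb => Finset.sum_nonneg fun c hc =>
          g1 t ht _ mk1 b hb c hc) mem1)
        refine le_trans ?_ (Finset.single_le_sum (fun c hc => g1 t ht _ mk1 _ mem1 c hc) mk)
        rw [if_pos (add_comm 1 k)]
        have := hκK k mk
        have := hm1F t ht
        have := hmF t ht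
        have := (hK12pos (k + 1) 1 k).le
        have := (hFpos t ht 1 mem1).le
        gcongr
      linarith
  choose! μ hμ using all
  obtain ⟨m, hm, hmμ⟩ := unif_min (Finset.Icc 1 I) μ
    (fun k hk => (hμ k (Finset.mem_Icc.1 hk).1 (Finset.mem_Icc.1 hk).2).1)
  exact ⟨m, hm, fun k hk t ht => (hmμ k hk).trans
    ((hμ k (Finset.mem_Icc.1 hk).1 (Finset.mem_Icc.1 hk).2).2 t ht)⟩

end CC

/-- Exponential convergence to the Bose–Einstein equilibrium for the combined
discrete system `dF/dt = 𝒞₁₂[F] + 𝒞₂₂[F]`. -/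
theorem C12_C22_convergence_to_equilibrium (I : ℕ) (hI : 3 ≤ I)
    (K12 : ℕ → ℕ → ℕ → ℝ) (K22 : ℕ → ℕ → ℕ → ℕ → ℝ)
    (hK12pos : ∀ a b c, 0 < K12 a b c)
    (hK12symm : ∀ a b c, K12 a b c = K12 b a c ∧ K12 a b c = K12 a c b)
    (hK22pos : ∀ a b c d, 0 < K22 a b c d)
    (hK22symm : ∀ a b c d, K22 a b c d = K22 b a c d ∧ K22 a b c d = K22 a c b d ∧
      K22 a b c d = K22 a b d c)
    (F : ℝ → ℕ → ℝ)
    (hFpos : ∀ t ∈ Set.Ici (0 : ℝ), ∀ k ∈ Finset.Icc 1 I, 0 < F t k)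
    (hF : ∀ t ∈ Set.Ici (0 : ℝ), ∀ k₁ ∈ Finset.Icc 1 I,
      HasDerivWithinAt (fun s => F s k₁)
        (C12 I K12 (F t) k₁ + C22 I K22 (F t) k₁) (Set.Ici 0) t) :
    ∃ ρ > (0 : ℝ), ∃ C₁ > (0 : ℝ), ∃ C₂ > (0 : ℝ),
      (∑ k ∈ Finset.Icc 1 I, (k : ℝ) / (Real.exp (ρ * k) - 1)
        = ∑ k ∈ Finset.Icc 1 I, (k : ℝ) * F 0 k) ∧
      ∀ t ∈ Set.Ici (0 : ℝ), ∀ k ∈ Finset.Icc 1 I,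
        |F t k - 1 / (Real.exp (ρ * k) - 1)| ≤ C₁ * Real.exp (-C₂ * t) := by
  have z : (0 : ℝ) ∈ Set.Ici (0 : ℝ) := Set.mem_Ici.2 le_rfl
  have mem1 : 1 ∈ Finset.Icc 1 I := by simp; omega
  have hI' : (3 : ℝ) ≤ I := by exact_mod_cast hI
  set E := ∑ k ∈ Finset.Icc 1 I, (k : ℝ) * F 0 k with hEdef
  -- energy conservation
  have hder : ∀ t ∈ Set.Ici (0 : ℝ), HasDerivWithinAt
      (fun s => ∑ k ∈ Finset.Icc 1 I, (k : ℝ) * F s k) 0 (Set.Ici 0) t := by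
    intro t ht
    exact (HasDerivWithinAt.fun_sum fun k hk => (hF t ht k hk).const_mul (k : ℝ)).congr_deriv
      (CC.energy I K12 K22 hK12symm hK22symm (F t))
  have hFen : ∀ t ∈ Set.Ici (0 : ℝ), ∑ k ∈ Finset.Icc 1 I, (k : ℝ) * F t k = E := by
    intro t ht
    have hm1 : MonotoneOn (fun s => ∑ k ∈ Finset.Icc 1 I, (k : ℝ) * F s k) (Set.Ici 0) :=
      monotoneOn_of_hasDerivWithinAt_nonneg (convex_Ici 0) (f' := fun _ => 0)
        (fun t ht => (hder t ht).continuousWithinAt)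
        (fun t ht => (hder t (interior_subset ht)).mono interior_subset) (fun _ _ => le_rfl)
    have hm2 : AntitoneOn (fun s => ∑ k ∈ Finset.Icc 1 I, (k : ℝ) * F s k) (Set.Ici 0) :=
      antitoneOn_of_hasDerivWithinAt_nonpos (convex_Ici 0) (f' := fun _ => 0)
        (fun t ht => (hder t ht).continuousWithinAt)
        (fun t ht => (hder t (interior_subset ht)).mono interior_subset) (fun _ _ => le_rfl)
    exact le_antisymm (hm2 z ht ht) (hm1 z ht ht)
  have hbdE : ∀ G : ℕ → ℝ, (∀ k ∈ Finset.Icc 1 I, 0 < G k) →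
      ∑ k ∈ Finset.Icc 1 I, (k : ℝ) * G k = E → ∀ k ∈ Finset.Icc 1 I, G k ≤ E := by
    intro G hG hGE k hk
    have hk1 : (1 : ℝ) ≤ k := by exact_mod_cast (Finset.mem_Icc.1 hk).1
    have h1 := Finset.single_le_sum (f := fun k : ℕ => (k : ℝ) * G k)
      (fun k hk => mul_nonneg (Nat.cast_nonneg _) (hG k hk).le) hk
    have h2 := hG k hk
    rw [hGE] at h1
    nlinarith
  have hFE : ∀ t ∈ Set.Ici (0 : ℝ), ∀ k ∈ Finset.Icc 1 I, F t k ≤ E :=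
    fun t ht => hbdE (F t) (hFpos t ht) (hFen t ht)
  have hE : 0 < E := (hFpos 0 z 1 mem1).trans_le (hFE 0 z 1 mem1)
  obtain ⟨κ, hκ, hκK⟩ := CC.unif_min (Finset.Icc 1 I) (fun k => K12 (k + 1) 1 k)
    (fun k _ => hK12pos _ _ _)
  obtain ⟨m0, hm0, hm0F⟩ := CC.lower_all I hI K12 K22 hK12pos hK22pos F E κ hE hκ hκK hFpos hFE
    hFen hF
  obtain ⟨ρ, hρ, hρE⟩ := CC.exists_rho I hI E hE
  have hnpos : ∀ k ∈ Finset.Icc 1 I, 0 < CC.n (ρ * k) := by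
    intro k hk
    have hk1 : (1 : ℝ) ≤ k := by exact_mod_cast (Finset.mem_Icc.1 hk).1
    exact CC.n_pos (by positivity)
  have hnE : ∀ k ∈ Finset.Icc 1 I, CC.n (ρ * k) ≤ E :=
    hbdE (fun k => CC.n (ρ * k)) hnpos hρE
  obtain ⟨m2, hm2, hm2n⟩ := CC.unif_min (Finset.Icc 1 I) (fun k => CC.n (ρ * k)) hnpos
  set m := min m0 m2 with hmdef
  have hm : 0 < m := lt_min hm0 hm2
  have hmF : ∀ t ∈ Set.Ici (0 : ℝ), ∀ k ∈ Finset.Icc 1 I, m ≤ F t k :=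
    fun t ht k hk => (min_le_left _ _).trans (hm0F k hk t ht)
  have hmn : ∀ k ∈ Finset.Icc 1 I, m ≤ CC.n (ρ * k) :=
    fun k hk => (min_le_right _ _).trans (hm2n k hk)
  obtain ⟨C, hC, hstab⟩ := CC.stab I hI E ρ hρ hE hρE
  set H : ℝ → ℝ := fun t => ∑ k ∈ Finset.Icc 1 I, CC.h (CC.n (ρ * k)) (F t k) with hH
  set D : ℝ → ℝ := fun t => ∑ k ∈ Finset.Icc 1 I,
    CC.X (F t k) * (C12 I K12 (F t) k + C22 I K22 (F t) k) with hD
  have hhbd : ∀ t ∈ Set.Ici (0 : ℝ), ∀ k ∈ Finset.Icc 1 I, _ := fun t ht k hk =>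
    CC.h_bd hm (hmn k hk) (hmF t ht k hk) (hnE k hk) (hFE t ht k hk)
  have hHder : ∀ t ∈ Set.Ici (0 : ℝ), HasDerivWithinAt (fun s => - H s) (D t) (Set.Ici 0) t := by
    intro t ht
    have h1 : HasDerivWithinAt H (∑ k ∈ Finset.Icc 1 I, CC.h' (CC.n (ρ * k)) (F t k) *
        (C12 I K12 (F t) k + C22 I K22 (F t) k)) (Set.Ici 0) t :=
      HasDerivWithinAt.fun_sum fun k hk =>
        HasDerivAt.comp_hasDerivWithinAt (h₂ := CC.h (CC.n (ρ * k))) t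
          (CC.h_deriv (hFpos t ht k hk)) (hF t ht k hk)
    refine h1.neg.congr_deriv ?_
    have h2 := CC.energy I K12 K22 hK12symm hK22symm (F t)
    have h3 : ∑ k ∈ Finset.Icc 1 I, CC.h' (CC.n (ρ * k)) (F t k) *
        (C12 I K12 (F t) k + C22 I K22 (F t) k)
        = ρ * (∑ k ∈ Finset.Icc 1 I, (k : ℝ) * (C12 I K12 (F t) k + C22 I K22 (F t) k)) - D t := by
      rw [hD, Finset.mul_sum, ← Finset.sum_sub_distrib]
      refine Finset.sum_congr rfl fun k hk => ?_
      have hk1 : (1 : ℝ) ≤ k := by exact_mod_cast (Finset.mem_Icc.1 hk).1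
      have h4 : CC.h' (CC.n (ρ * k)) (F t k) = ρ * k - CC.X (F t k) := by
        have := CC.X_n (show 0 < ρ * (k : ℝ) by positivity)
        unfold CC.X at *
        unfold CC.h'
        linarith
      rw [h4]; ring
    rw [h3, h2]; ring
  set lam := 2 * m * (κ * m ^ 3) / (I * C ^ 2) with hlam
  have hlampos : 0 < lam := by positivity
  have hDH : ∀ t ∈ Set.Ici (0 : ℝ), lam * H t ≤ D t := by
    intro t ht
    have hd : ∀ k, 1 ≤ k → k + 1 ≤ I →
        κ * m ^ 3 * (CC.X (F t (k + 1)) - CC.X (F t 1) - CC.X (F t k)) ^ 2 ≤ D t := by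
      intro k hk hkI
      exact CC.dissip I K12 K22 hK12pos hK12symm hK22pos hK22symm (F t) m κ hm hκ
        (hmF t ht) k hk hkI (hκK k (by simp; omega))
    have hκm : 0 < κ * m ^ 3 := by positivity
    have hD0 : 0 ≤ D t := le_trans (by positivity) (hd 1 le_rfl (by omega))
    have hs := hstab (F t) (hFpos t ht) (hFE t ht) (hFen t ht) (Real.sqrt (D t / (κ * m ^ 3))) (by
      intro k hk hkI
      apply Real.abs_le_sqrt
      rw [le_div_iff₀ hκm, mul_comm]
      exact hd k hk hkI)
    have hHle : H t ≤ ∑ k ∈ Finset.Icc 1 I, (C ^ 2 * (D t / (κ * m ^ 3))) / (2 * m) := by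
      refine Finset.sum_le_sum fun k hk => (hhbd t ht k hk).2.trans ?_
      have h1 := hs k hk
      have h2 : (F t k - CC.n (ρ * k)) ^ 2 ≤ C ^ 2 * (D t / (κ * m ^ 3)) := by
        rw [← sq_abs]
        calc |F t k - CC.n (ρ * k)| ^ 2 ≤ (C * Real.sqrt (D t / (κ * m ^ 3))) ^ 2 := by gcongr
          _ = _ := by rw [mul_pow, Real.sq_sqrt (by positivity)]
      gcongr
    calc lam * H t ≤ lam * _ := mul_le_mul_of_nonneg_left hHle hlampos.le
      _ = D t := by
        rw [hlam]; simp; field_simp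
  have hHdecay : ∀ t ∈ Set.Ici (0 : ℝ), H t ≤ H 0 * Real.exp (-lam * t) := by
    intro t ht
    have := CC.gronwall (fun s => - H s) D 0 lam hlampos hHder (fun s hs => by
      have := hDH s hs
      linarith) t ht
    simp only [zero_div, sub_zero] at this
    linarith
  have hh0 : ∀ t ∈ Set.Ici (0 : ℝ), ∀ k ∈ Finset.Icc 1 I, 0 ≤ CC.h (CC.n (ρ * k)) (F t k) :=
    fun t ht k hk => le_trans (by positivity) (hhbd t ht k hk).1
  have hH0 : 0 ≤ H 0 := Finset.sum_nonneg fun k hk => hh0 0 z k hk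
  refine ⟨ρ, hρ, Real.sqrt (2 * (E * (1 + E)) * H 0) + 1, by positivity, lam / 2, by positivity,
    ?_, ?_⟩
  · rw [← hρE]
    refine Finset.sum_congr rfl fun k _ => ?_
    unfold CC.n; ring
  · intro t ht k hk
    have h1 := (hhbd t ht k hk).1
    have h2 : CC.h (CC.n (ρ * k)) (F t k) ≤ H t :=
      Finset.single_le_sum (f := fun k : ℕ => CC.h (CC.n (ρ * k)) (F t k))
        (fun k hk => hh0 t ht k hk) hk
    have h3 := hHdecay t ht
    have hEE : 0 < 2 * (E * (1 + E)) := by positivity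
    rw [div_le_iff₀ hEE] at h1
    have h4 : (F t k - CC.n (ρ * k)) ^ 2 ≤
        (2 * (E * (1 + E)) * H 0) * Real.exp (-(lam / 2) * t) ^ 2 := by
      have e : Real.exp (-(lam / 2) * t) ^ 2 = Real.exp (-lam * t) := by
        rw [← Real.exp_nat_mul]; congr 1; push_cast; ring
      rw [e]
      calc _ ≤ _ := h1
        _ ≤ (H 0 * Real.exp (-lam * t)) * (2 * (E * (1 + E))) := by
          apply mul_le_mul_of_nonneg_right (h2.trans h3) hEE.le
        _ = _ := by ring
    have h5 := Real.abs_le_sqrt h4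
    rw [Real.sqrt_mul (by positivity), Real.sqrt_sq (Real.exp_pos _).le] at h5
    refine h5.trans ?_
    have := Real.exp_pos (-(lam / 2) * t)
    gcongr
    linarith
end
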